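/- Let p ∈ [1,∞), let ((λ_n)_{n∈ℤ}, (μ_n)_{n∈ℤ}) ∈ SD_p, define φ(λ) := V.p.∏_{n∈ℤ} (λ_n−λ)/(π(n+1/2)) and ψ(λ) := (λ−μ₀)·V.p.∏_{n≠0} (μ_n−λ)/(πn), set α_n := −1/(φ′(λ_n)ψ(λ_n)) (these are positive), and let H ∈ L_p((−1,1),M₂) be the sum of Σ_{n∈ℤ}(α_n e^{−2λ_n sB} − e^{−π(2n+1)sB}) (Cesàro means for p = 1). Then: (i) the Krein equation R̃(x,t) + H(x−t) + ∫₀ˣ R̃(x,s) H(s−t) ds = 0 (0 ≤ t ≤ x ≤ 1) has a unique solution R̃ ∈ G_p(M₂) supported on {t ≤ x}; (ii) the GLM equation K(x,t) + F(x,t) + ∫₀ˣ K(x,s) F(s,t) ds = 0 (0 ≤ t ≤ x ≤ 1), with F(x,t) := (1/2)[H((x−t)/2) + H((x+t)/2)J], has a unique solution K ∈ G_p(M₂) supported on {t ≤ x}; and (iii) the matrix function Q(x) := R̃(x,0) J B is a Dirac-form potential in L_p(M₂), and for every λ ∈ ℂ the function u(x) := c₀(x,λ) + ∫₀ˣ K(x,t)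 c₀(t,λ) dt is absolutely continuous and solves B u′ + Q u = λu a.e. with u(0) = (1,0)ᵗ, i.e., I + 𝒦 is the transformation operator for the pair (Ã_Q, Ã₀). -/

import Mathlib

open MeasureTheory Complex Filter Set
open scoped Matrix.Norms.L2Operator ENNReal

noncomputable section

abbrev M2 := Matrix (Fin 2) (Fin 2) ℂ

def Bmat : M2 := !![0, 1; -1, 0]

def Jmat : M2 := !![1, 0; 0, -1]

/-- `expB τ = e^{-τ B} = [[cos τ, -sin τ],[sin τ, cos τ]]`. -/
def expB (τ : ℂ) : M2 := !![Complex.cos τ, -Complex.sin τ; Complex.sin τ, Complex.cos τ]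

/-- Lebesgue measure restricted to `(0,1)`. -/
def μ01 : Measure ℝ := volume.restrict (Set.Ioo 0 1)

/-- Lebesgue measure restricted to `(-1,1)`. -/
def μ11 : Measure ℝ := volume.restrict (Set.Ioo (-1) 1)

/-- A Dirac-form potential `Q = [[q₁,q₂],[q₂,-q₁]]`. -/
def IsDiracForm (Q : ℝ → M2) : Prop :=
  ∃ q1 q2 : ℝ → ℂ, ∀ x, Q x = !![q1 x, q2 x; q2 x, -q1 x]

/-- A Dirac-form potential with real-valued entries. -/
def IsRealDiracForm (Q : ℝ → M2) : Prop :=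
  ∃ q1 q2 : ℝ → ℝ, ∀ x, Q x = !![(q1 x : ℂ), (q2 x : ℂ); (q2 x : ℂ), -(q1 x : ℂ)]

/-- `U` is an absolutely continuous matrix solution of `B U' + Q U = λ U` a.e. on `(0,1)`. -/
def IsMatSolution (Q : ℝ → M2) (l : ℂ) (U : ℝ → M2) : Prop :=
  ∃ U' : ℝ → M2, IntegrableOn U' (Set.Ioo 0 1) ∧
    (∀ x ∈ Set.Icc (0:ℝ) 1, U x = U 0 + ∫ t in (0:ℝ)..x, U' t) ∧
    (∀ᵐ x ∂μ01, Bmat * U' x + Q x * U x = l • U x)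

/-- `u` is an absolutely continuous `ℂ²`-valued solution of `B u' + Q u = λ u` a.e. on `(0,1)`. -/
def IsVecSolution (Q : ℝ → M2) (l : ℂ) (u : ℝ → Fin 2 → ℂ) : Prop :=
  ∃ u' : ℝ → Fin 2 → ℂ, IntegrableOn u' (Set.Ioo 0 1) ∧
    (∀ x ∈ Set.Icc (0:ℝ) 1, u x = u 0 + ∫ t in (0:ℝ)..x, u' t) ∧
    (∀ᵐ x ∂μ01, Bmat.mulVec (u' x) + (Q x).mulVec (u x) = l • u x)

/-- `λ` is an eigenvalue of the Dirac operator `A_j` (`j = 0` for `A₁`, `j = 1` for `A₂`):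
there is a nonzero AC solution with `u₂(0) = 0` and `u_j(1) = 0`. -/
def IsEigenvalue (Q : ℝ → M2) (j : Fin 2) (l : ℝ) : Prop :=
  ∃ u : ℝ → Fin 2 → ℂ, IsVecSolution Q (l : ℂ) u ∧
    (∃ x ∈ Set.Icc (0:ℝ) 1, u x ≠ 0) ∧ u 0 1 = 0 ∧ u 1 j = 0

/-- `c₀(·,λ) = (cos λx, sin λx)ᵗ`. -/
def c0 (l : ℂ) (x : ℝ) : Fin 2 → ℂ := ![Complex.cos (l * x), Complex.sin (l * x)]

/-- n-th Fourier coefficient `e_n(g) = ∫₀¹ e^{-2πinx} g(x) dx`. -/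
def fc (g : ℝ → ℂ) (n : ℤ) : ℂ :=
  ∫ x in (0:ℝ)..1, Complex.exp (-2 * Real.pi * Complex.I * n * x) * g x

/-- The square of the `ℍ = L₂((0,1),ℂ²)` norm of `u`. -/
def hnormSq (u : ℝ → Fin 2 → ℂ) : ℝ :=
  ∫ x in Set.Ioo (0:ℝ) 1, (‖u x 0‖ ^ 2 + ‖u x 1‖ ^ 2)

/-- The `ℂ²` inner product `⟨v,w⟩ = v₁ w̄₁ + v₂ w̄₂`. -/
def ip2 (v w : Fin 2 → ℂ) : ℂ := v 0 * star (w 0) + v 1 * star (w 1)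

/-- The eigenvalue asymptotics `λ_n = π(n+1/2) + e_n(g)` for some `g ∈ L_p(0,1)`. -/
def LamAsymp (p : ℝ≥0∞) (lam : ℤ → ℝ) : Prop :=
  ∃ g : ℝ → ℂ, MemLp g p μ01 ∧
    ∀ n : ℤ, (lam n : ℂ) = Real.pi * (n + 1/2) + fc g n

/-- The eigenvalue asymptotics `μ_n = πn + e_n(g)` for some `g ∈ L_p(0,1)`. -/
def MuAsymp (p : ℝ≥0∞) (mu : ℤ → ℝ) : Prop :=
  ∃ g : ℝ → ℂ, MemLp g p μ01 ∧
    ∀ n : ℤ, (mu n : ℂ) = Real.pi * n + fc g n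

/-- The norming-constant asymptotics `α_n = 1 + e_n(g)` for some `g ∈ L_p(0,1)`. -/
def AlAsymp (p : ℝ≥0∞) (al : ℤ → ℝ) : Prop :=
  ∃ g : ℝ → ℂ, MemLp g p μ01 ∧ ∀ n : ℤ, (al n : ℂ) = 1 + fc g n

/-- Membership in the class `SD_p` of spectral data. -/
def MemSD (p : ℝ≥0∞) (lam mu : ℤ → ℝ) : Prop :=
  (∀ n : ℤ, lam (n - 1) < mu n ∧ mu n < lam n) ∧ LamAsymp p lam ∧ MuAsymp p mu

/-- Membership in the kernel space `G_p(M₂)`: all slices lie in `L_p` and the slice maps are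
continuous from `[0,1]` to `L_p((0,1),M₂)`. -/
def MemGp (p : ℝ≥0∞) (K : ℝ → ℝ → M2) : Prop :=
  (∀ x ∈ Set.Icc (0:ℝ) 1, MemLp (K x) p μ01) ∧
  (∀ t ∈ Set.Icc (0:ℝ) 1, MemLp (fun x => K x t) p μ01) ∧
  (∀ x₀ ∈ Set.Icc (0:ℝ) 1, ∀ ε > (0:ℝ), ∃ δ > (0:ℝ), ∀ x ∈ Set.Icc (0:ℝ) 1,
    |x - x₀| < δ → eLpNorm (fun t => K x t - K x₀ t) p μ01 < ENNReal.ofReal ε) ∧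
  (∀ t₀ ∈ Set.Icc (0:ℝ) 1, ∀ ε > (0:ℝ), ∃ δ > (0:ℝ), ∀ t ∈ Set.Icc (0:ℝ) 1,
    |t - t₀| < δ → eLpNorm (fun x => K x t - K x t₀) p μ01 < ENNReal.ofReal ε)

/-- The norm of the space `G_p(M₂)` (as an extended real number). -/
def gpNorm (p : ℝ≥0∞) (K : ℝ → ℝ → M2) : ℝ≥0∞ :=
  max (⨆ x ∈ Set.Icc (0:ℝ) 1, eLpNorm (K x) p μ01)
      (⨆ t ∈ Set.Icc (0:ℝ) 1, eLpNorm (fun x => K x t) p μ01)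


/-- The kernel `F(x,t) = (1/2)[H((x-t)/2) + H((x+t)/2)J]` built from `H`. -/
def Fker (H : ℝ → M2) (x t : ℝ) : M2 := (2:ℂ)⁻¹ • (H ((x - t)/2) + H ((x + t)/2) * Jmat)

/-- `R` solves the Krein equation `R̃(x,t) + H(x-t) + ∫₀ˣ R̃(x,s)H(s-t) ds = 0` on the
triangle `{0 ≤ t ≤ x ≤ 1}` and is supported there. -/
def SolvesKrein (H : ℝ → M2) (R : ℝ → ℝ → M2) : Prop :=
  (∀ x t : ℝ, ¬ (0 ≤ t ∧ t ≤ x ∧ x ≤ 1) → R x t = 0) ∧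
  ∀ x ∈ Set.Icc (0:ℝ) 1, ∀ᵐ t ∂(volume.restrict (Set.Ioo 0 x)),
    R x t + H (x - t) + ∫ s in (0:ℝ)..x, R x s * H (s - t) = 0

/-- `K` solves the GLM equation `K(x,t) + F(x,t) + ∫₀ˣ K(x,s)F(s,t) ds = 0` on the triangle
`{0 ≤ t ≤ x ≤ 1}` and is supported there. -/
def SolvesGLMwith (F K : ℝ → ℝ → M2) : Prop :=
  (∀ x t : ℝ, ¬ (0 ≤ t ∧ t ≤ x ∧ x ≤ 1) → K x t = 0) ∧
  ∀ x ∈ Set.Icc (0:ℝ) 1, ∀ᵐ t ∂(volume.restrict (Set.Ioo 0 x)),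
    K x t + F x t + ∫ s in (0:ℝ)..x, K x s * F s t = 0

/-- `H ∈ L_p((-1,1),M₂)` is the sum of the series
`Σ_{n∈ℤ} (α_n e^{-2λ_n sB} - e^{-π(2n+1) sB})` (in the sense of symmetric partial sums for
`p > 1` and of Cesàro means for `p = 1`). -/
def IsHSum (p : ℝ≥0∞) (lam al : ℤ → ℝ) (H : ℝ → M2) : Prop :=
  MemLp H p μ11 ∧
  (1 < p → Tendsto (fun N : ℕ => eLpNorm (fun s : ℝ =>
      (∑ n ∈ Finset.Icc (-(N:ℤ)) (N:ℤ),
        ((al n : ℂ) • expB (2 * (lam n : ℂ) * (s : ℂ)) -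
          expB (Real.pi * (2 * (n : ℂ) + 1) * (s : ℂ)))) - H s) p μ11)
    atTop (nhds 0)) ∧
  (p = 1 → Tendsto (fun N : ℕ => eLpNorm (fun s : ℝ =>
      ((N : ℂ)⁻¹ • ∑ k ∈ Finset.Icc 1 N, ∑ n ∈ Finset.Icc (-(k:ℤ)) (k:ℤ),
        ((al n : ℂ) • expB (2 * (lam n : ℂ) * (s : ℂ)) -
          expB (Real.pi * (2 * (n : ℂ) + 1) * (s : ℂ)))) - H s) 1 μ11)
    atTop (nhds 0))

/-- Hurwitz-type lower bound. -/
lemma hurwitz_lb (F X : ℕ → ℂ → ℂ) (G : ℂ → ℂ) (z0 : ℂ) (ρ : ℝ) (hρ : 0 < ρ) (k : ℕ)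
    (hF : ∀ S : Set ℂ, IsCompact S → TendstoUniformlyOn F G atTop S)
    (hG : Differentiable ℂ G) (hG0 : ∃ z, G z ≠ 0)
    (hX : ∀ N, Differentiable ℂ (X N))
    (hXne : ∀ N, ∀ z, ‖z - z0‖ < ρ → X N z ≠ 0)
    (hFX : ∀ᶠ N in atTop, ∀ z, F N z = (z - z0) ^ k * X N z) :
    ∃ ε > 0, ∀ᶠ N in atTop, ε ≤ ‖X N z0‖ := by
  have han : AnalyticOnNhd ℂ G univ := fun z _ => hG.analyticAt z
  have hev : ∀ᶠ z in nhdsWithin z0 {z0}ᶜ, G z ≠ 0 := by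
    rcases (hG.analyticAt z0).eventually_eq_zero_or_eventually_ne_zero with h | h
    · exfalso
      obtain ⟨z, hz⟩ := hG0
      exact hz (han.eqOn_zero_of_preconnected_of_eventuallyEq_zero isPreconnected_univ
        (mem_univ z0) h (mem_univ z))
    · exact h
  rw [eventually_nhdsWithin_iff, Metric.eventually_nhds_iff] at hev
  obtain ⟨r0, hr0, hr⟩ := hev
  set r := min r0 ρ / 2 with hrdef
  have hrpos : 0 < r := by positivity
  have hr1 : r < r0 := by
    have := min_le_left r0 ρ; have : 0 < min r0 ρ := by positivity
    linarith
  have hr2 : r < ρ := by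
    have := min_le_right r0 ρ; have : 0 < min r0 ρ := by positivity
    linarith
  have hcomp : IsCompact (Metric.sphere z0 r) := isCompact_sphere z0 r
  have hne : (Metric.sphere z0 r).Nonempty := NormedSpace.sphere_nonempty.2 hrpos.le
  obtain ⟨w, hw, hwmin⟩ := hcomp.exists_isMinOn hne (hG.continuous.norm.continuousOn)
  have hGw : 0 < ‖G w‖ := by
    rw [norm_pos_iff]
    apply hr
    · rw [Metric.mem_sphere] at hw; rw [hw]; exact hr1
    · intro h
      have h' : w = z0 := h
      rw [h', Metric.mem_sphere, dist_self] at hw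
      exact hrpos.ne hw
  refine ⟨‖G w‖ / 2 / r ^ k, by positivity, ?_⟩
  have hu := Metric.tendstoUniformlyOn_iff.1 (hF _ hcomp) (‖G w‖ / 2) (by positivity)
  filter_upwards [hu, hFX] with N hN hNX
  have hb : ∀ z ∈ Metric.sphere z0 r, ‖G w‖ / 2 / r ^ k ≤ ‖X N z‖ := by
    intro z hz
    have h1 := hN z hz
    rw [dist_eq_norm] at h1
    have h2 : ‖G w‖ ≤ ‖G z‖ := hwmin hz
    have h3 : ‖G z‖ - ‖F N z‖ ≤ ‖G z - F N z‖ := norm_sub_norm_le _ _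
    have h4 : ‖G w‖ / 2 ≤ ‖F N z‖ := by linarith
    rw [hNX z, norm_mul, norm_pow] at h4
    rw [mem_sphere_iff_norm] at hz
    rw [hz] at h4
    rw [div_le_iff₀ (by positivity)]
    linarith [mul_comm (r ^ k) ‖X N z‖]
  have hmax : ‖(X N z0)⁻¹‖ ≤ (‖G w‖ / 2 / r ^ k)⁻¹ := by
    have hfr : frontier (Metric.ball z0 r) = Metric.sphere z0 r := frontier_ball z0 hrpos.ne'
    refine Complex.norm_le_of_forall_mem_frontier_norm_le (f := fun z => (X N z)⁻¹)
      (U := Metric.ball z0 r) Metric.isBounded_ball ?_ ?_ (subset_closure (Metric.mem_ball_self hrpos))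
    · have hcl : closure (Metric.ball z0 r) = Metric.closedBall z0 r := closure_ball z0 hrpos.ne'
      have : DifferentiableOn ℂ (fun z => (X N z)⁻¹) (closure (Metric.ball z0 r)) := by
        rw [hcl]
        intro z hz
        refine ((hX N z).inv (hXne N z ?_)).differentiableWithinAt
        rw [mem_closedBall_iff_norm] at hz
        linarith
      exact this.diffContOnCl
    · intro z hz
      rw [hfr] at hz
      rw [norm_inv]
      exact inv_anti₀ (by positivity) (hb z hz)
  rw [norm_inv] at hmax
  have hXp : 0 < ‖X N z0‖ := norm_pos_iff.2 (hXne N z0 (by simpa using hρ))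
  exact (inv_le_inv₀ hXp (by positivity)).1 hmax

lemma entire_of_unif (F : ℕ → ℂ → ℂ) (G : ℂ → ℂ)
    (hF : ∀ S : Set ℂ, IsCompact S → TendstoUniformlyOn F G atTop S)
    (hd : ∀ N, Differentiable ℂ (F N)) :
    Differentiable ℂ G ∧ ∀ z, Tendsto (fun N => deriv (F N) z) atTop (nhds (deriv G z)) := by
  have hl : TendstoLocallyUniformlyOn F G atTop univ := by
    rw [tendstoLocallyUniformlyOn_iff_forall_isCompact isOpen_univ]
    exact fun K _ hK => hF K hK
  refine ⟨?_, fun z => ?_⟩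
  · rw [← differentiableOn_univ]
    exact hl.differentiableOn (Eventually.of_forall fun N => (hd N).differentiableOn) isOpen_univ
  · have := hl.deriv (Eventually.of_forall fun N => (hd N).differentiableOn) isOpen_univ
    exact this.tendsto_at (mem_univ z)

lemma lam_strictMono {lam mu : ℤ → ℝ} (h : ∀ n : ℤ, lam (n - 1) < mu n ∧ mu n < lam n) :
    StrictMono lam := by
  refine strictMono_int_of_lt_succ fun n => ?_
  have := h (n + 1)
  simp only [add_sub_cancel_right] at this
  exact this.1.trans this.2

lemma mu_strictMono {lam mu : ℤ → ℝ} (h : ∀ n : ℤ, lam (n - 1) < mu n ∧ mu n < lam n) :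
    StrictMono mu := by
  refine strictMono_int_of_lt_succ fun n => ?_
  have := h (n + 1)
  simp only [add_sub_cancel_right] at this
  exact (h n).2.trans this.1

lemma sep_of_strictMono {f : ℤ → ℝ} (hf : StrictMono f) (n : ℤ) :
    ∃ ρ > 0, ∀ m, m ≠ n → ρ ≤ |f m - f n| := by
  refine ⟨min (f (n+1) - f n) (f n - f (n-1)), ?_, ?_⟩
  · have h1 := hf (show n < n + 1 by omega)
    have h2 := hf (show n - 1 < n by omega)
    exact lt_min (by linarith) (by linarith)
  · intro m hm
    rcases lt_or_gt_of_ne hm with h | h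
    · have h1 := hf.monotone (show m ≤ n - 1 by omega)
      have h2 := hf h
      rw [abs_of_neg (by linarith)]
      exact (min_le_right _ _).trans (by linarith)
    · have h1 := hf.monotone (show n + 1 ≤ m by omega)
      have h2 := hf h
      rw [abs_of_pos (by linarith)]
      exact (min_le_left _ _).trans (by linarith)

lemma cm_ne (m : ℤ) : (Real.pi * ((m : ℂ) + 1/2) : ℂ) ≠ 0 := by
  have : ((Real.pi * ((m : ℝ) + 1/2) : ℝ) : ℂ) ≠ 0 := by
    rw [Complex.ofReal_ne_zero]
    refine mul_ne_zero Real.pi_ne_zero ?_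
    intro h
    have : ((2 * m + 1 : ℤ) : ℝ) = 0 := by push_cast; linarith
    have : (2 * m + 1 : ℤ) = 0 := by exact_mod_cast this
    omega
  simpa using this

def phiN (lam : ℤ → ℝ) (N : ℕ) (l : ℂ) : ℂ :=
  ∏ n ∈ Finset.Icc (-(N:ℤ)) (N:ℤ), ((lam n : ℂ) - l) / (Real.pi * ((n : ℂ) + 1/2))

def psiN (mu : ℤ → ℝ) (N : ℕ) (l : ℂ) : ℂ := (l - (mu 0 : ℂ)) *
  ∏ n ∈ (Finset.Icc (-(N:ℤ)) (N:ℤ)).erase 0, ((mu n : ℂ) - l) / (Real.pi * (n : ℂ))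

def chiN (lam : ℤ → ℝ) (k : ℤ) (N : ℕ) (l : ℂ) : ℂ :=
  -(Real.pi * ((k : ℂ) + 1/2))⁻¹ *
  ∏ n ∈ (Finset.Icc (-(N:ℤ)) (N:ℤ)).erase k, ((lam n : ℂ) - l) / (Real.pi * ((n : ℂ) + 1/2))

lemma phiN_eq (lam : ℤ → ℝ) (k : ℤ) (N : ℕ) (hN : k.natAbs ≤ N) (l : ℂ) :
    phiN lam N l = (l - lam k) ^ 1 * chiN lam k N l := by
  unfold phiN chiN
  rw [← Finset.mul_prod_erase _ _ (show k ∈ Finset.Icc (-(N:ℤ)) (N:ℤ) by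
    rw [Finset.mem_Icc]; omega)]
  ring

lemma al_dichotomy (lam mu : ℤ → ℝ) (h_itl : ∀ n : ℤ, lam (n - 1) < mu n ∧ mu n < lam n)
    (phi psi : ℂ → ℂ)
    (hphi : ∀ S : Set ℂ, IsCompact S → TendstoUniformlyOn (phiN lam) phi atTop S)
    (hpsi : ∀ S : Set ℂ, IsCompact S → TendstoUniformlyOn (psiN mu) psi atTop S)
    (al : ℤ → ℝ)
    (hal : ∀ n : ℤ, (al n : ℂ) = -1 / (deriv phi (lam n) * psi (lam n))) :
    (∀ n, 0 < al n) ∨ (∀ n, al n = 0) := by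
  have hlm := lam_strictMono h_itl
  have hmm := mu_strictMono h_itl
  have hdphi : ∀ N, Differentiable ℂ (phiN lam N) := by
    intro N; unfold phiN; fun_prop
  have hdpsi : ∀ N, Differentiable ℂ (psiN mu N) := by
    intro N; unfold psiN; fun_prop
  have hdchi : ∀ k N, Differentiable ℂ (chiN lam k N) := by
    intro k N; unfold chiN; fun_prop
  obtain ⟨hphid, hphi'⟩ := entire_of_unif _ _ hphi hdphi
  obtain ⟨hpsid, -⟩ := entire_of_unif _ _ hpsi hdpsi
  by_cases h1 : ∃ z, phi z ≠ 0
  swap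
  · right
    push Not at h1
    intro n
    have : phi = fun _ => 0 := funext h1
    have h2 := hal n
    rw [this] at h2
    simpa using h2
  by_cases h2 : ∃ z, psi z ≠ 0
  swap
  · right
    push Not at h2
    intro n
    have h3 := hal n
    rw [h2] at h3
    simpa using h3
  left
  intro k
  -- chi lower bound
  obtain ⟨ρ, hρ, hρs⟩ := sep_of_strictMono hlm k
  obtain ⟨ε1, hε1, hc1⟩ := hurwitz_lb (phiN lam) (chiN lam k) phi (lam k) ρ hρ 1 hphi hphid h1
    (hdchi k) (by
      intro N z hz
      unfold chiN
      refine mul_ne_zero (neg_ne_zero.2 (inv_ne_zero (cm_ne k))) ?_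
      rw [Finset.prod_ne_zero_iff]
      intro m hm
      refine div_ne_zero ?_ (cm_ne m)
      intro h0
      have h3 : (lam m : ℂ) = z := sub_eq_zero.1 h0
      rw [← h3, ← Complex.ofReal_sub, Complex.norm_real, Real.norm_eq_abs] at hz
      exact absurd (hρs m (Finset.ne_of_mem_erase hm)) (not_le.2 hz))
    (by
      filter_upwards [eventually_ge_atTop k.natAbs] with N hN z
      exact phiN_eq lam k N hN z)
  have hμ1 := (h_itl k).2
  have hμ2 : lam k < mu (k+1) := by simpa using (h_itl (k+1)).1
  obtain ⟨ε2, hε2, hc2⟩ := hurwitz_lb (psiN mu) (psiN mu) psi (lam k)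
    (min (lam k - mu k) (mu (k+1) - lam k)) (lt_min (by linarith) (by linarith)) 0 hpsi hpsid h2
    hdpsi (by
      have key : ∀ z : ℂ, ‖z - lam k‖ < min (lam k - mu k) (mu (k+1) - lam k) →
          ∀ m, z ≠ (mu m : ℂ) := by
        intro z hz m h0
        rw [h0, ← Complex.ofReal_sub, Complex.norm_real, Real.norm_eq_abs, lt_min_iff] at hz
        rcases le_or_gt m k with h | h
        · have := hmm.monotone h
          rw [abs_of_neg (by linarith)] at hz
          linarith [hz.1]
        · have := hmm.monotone (show k + 1 ≤ m by omega)
          rw [abs_of_pos (by linarith)] at hz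
          linarith [hz.2]
      intro N z hz
      unfold psiN
      refine mul_ne_zero (sub_ne_zero.2 (key z hz 0)) ?_
      rw [Finset.prod_ne_zero_iff]
      intro m hm
      refine div_ne_zero (sub_ne_zero.2 (key z hz m).symm) ?_
      have := Finset.ne_of_mem_erase hm
      exact mul_ne_zero (by exact_mod_cast Real.pi_ne_zero) (by exact_mod_cast this))
    (by simp)
  -- limit
  have hpt : Tendsto (fun N => psiN mu N (lam k)) atTop (nhds (psi (lam k))) :=
    (hpsi {(lam k : ℂ)} isCompact_singleton).tendsto_at (mem_singleton _)
  have hder : ∀ᶠ N in atTop, deriv (phiN lam N) (lam k) = chiN lam k N (lam k) := by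
    filter_upwards [eventually_ge_atTop k.natAbs] with N hN
    have : phiN lam N = fun z => (z - lam k) * chiN lam k N z := by
      funext z; rw [phiN_eq lam k N hN z, pow_one]
    rw [this, deriv_fun_mul (by fun_prop) (hdchi k N _)]
    simp
  have hlim : Tendsto (fun N => -(chiN lam k N (lam k) * psiN mu N (lam k))) atTop
      (nhds (-(deriv phi (lam k) * psi (lam k)))) := by
    refine Tendsto.neg (Tendsto.mul ?_ hpt)
    exact (hphi' (lam k)).congr' hder
  -- positivity
  have hpos : ∀ᶠ N in atTop, ∃ x : ℝ, 0 ≤ x ∧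
      -(chiN lam k N (lam k) * psiN mu N (lam k)) = x := by
    filter_upwards [eventually_ge_atTop k.natAbs] with N hN
    -- real versions
    let s := Finset.Icc (-(N:ℤ)) (N:ℤ)
    let A : ℤ → ℝ := fun m => if m = k then 1 else lam m - lam k
    let Bq : ℤ → ℝ := fun m => mu m - lam k
    let Cq : ℤ → ℝ := fun m => Real.pi * (m + 1/2)
    let Dq : ℤ → ℝ := fun m => if m = 0 then 1 else Real.pi * m
    have hk : k ∈ s := by simp only [s, Finset.mem_Icc]; omega
    have h0 : (0:ℤ) ∈ s := by simp only [s, Finset.mem_Icc]; omega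
    refine ⟨-∏ m ∈ s, (A m * Bq m) / (Cq m * Dq m), ?_, ?_⟩
    · rw [← Finset.mul_prod_erase _ _ hk, ← neg_mul]
      have hCD : ∀ m, 0 < Cq m * Dq m := by
        intro m
        simp only [Cq, Dq]
        split_ifs with hm
        · rw [hm]; have := Real.pi_pos; push_cast; positivity
        · have hpi := Real.pi_pos
          rcases lt_or_gt_of_ne hm with h | h
          · have : (m : ℝ) ≤ -1 := by exact_mod_cast (show m ≤ -1 by omega)
            apply mul_pos_of_neg_of_neg
            · apply mul_neg_of_pos_of_neg hpi; linarith
            · apply mul_neg_of_pos_of_neg hpi; linarith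
          · have : (1 : ℝ) ≤ m := by exact_mod_cast (show 1 ≤ m by omega)
            positivity
      apply mul_nonneg
      · rw [← neg_div]
        apply div_nonneg _ (hCD k).le
        simp only [A, Bq, if_true]
        linarith
      · apply Finset.prod_nonneg
        intro m hm
        apply div_nonneg _ (hCD m).le
        have hmk := Finset.ne_of_mem_erase hm
        simp only [A, Bq, if_neg hmk]
        rcases lt_or_gt_of_ne hmk with h | h
        · have := hlm h
          have := hmm h
          apply mul_nonneg_of_nonpos_of_nonpos <;> linarith
        · have := hlm h
          have := hmm.monotone (show k + 1 ≤ m by omega)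
          apply mul_nonneg <;> linarith
    · have e1 : chiN lam k N (lam k) = -((∏ m ∈ s, A m / Cq m : ℝ) : ℂ) := by
        rw [← Finset.mul_prod_erase _ _ hk]
        unfold chiN
        push_cast
        rw [neg_mul]
        congr 1
        congr 1
        · simp [A, Cq]
        · refine Finset.prod_congr rfl fun m hm => ?_
          have hmk := Finset.ne_of_mem_erase hm
          simp [A, Cq, hmk]
      have e2 : psiN mu N (lam k) = -((∏ m ∈ s, Bq m / Dq m : ℝ) : ℂ) := by
        rw [← Finset.mul_prod_erase _ _ h0]
        unfold psiN
        push_cast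
        rw [← neg_mul]
        congr 1
        · simp [Bq, Dq]
        · refine Finset.prod_congr rfl fun m hm => ?_
          have hmk := Finset.ne_of_mem_erase hm
          simp [Bq, Dq, hmk]
      rw [e1, e2]
      have : (∏ m ∈ s, (A m * Bq m) / (Cq m * Dq m)) = (∏ m ∈ s, A m / Cq m) * ∏ m ∈ s, Bq m / Dq m := by
        rw [← Finset.prod_mul_distrib]
        exact Finset.prod_congr rfl fun m _ => (div_mul_div_comm _ _ _ _).symm
      rw [this]
      push_cast
      ring
  have hal' : ((al k : ℝ) : ℂ) = (-(deriv phi (lam k) * psi (lam k)))⁻¹ := by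
    rw [hal k, ← neg_inv, neg_div, one_div]
  set ζ := -(deriv phi (lam k) * psi (lam k)) with hζ
  have hre : 0 ≤ ζ.re := by
    refine ge_of_tendsto ((Complex.continuous_re.tendsto _).comp hlim) ?_
    filter_upwards [hpos] with N ⟨x, hx, hxe⟩
    simp only [Function.comp, hxe, Complex.ofReal_re]; exact hx
  have him : ζ.im = 0 := by
    refine tendsto_nhds_unique ((Complex.continuous_im.tendsto _).comp hlim) ?_
    refine tendsto_const_nhds.congr' ?_
    filter_upwards [hpos] with N ⟨x, hx, hxe⟩
    simp only [Function.comp, hxe, Complex.ofReal_im]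
  have hζ0 : ζ ≠ 0 := by
    have : ε1 * ε2 ≤ ‖ζ‖ := by
      refine ge_of_tendsto hlim.norm ?_
      filter_upwards [hc1, hc2] with N h3 h4
      rw [norm_neg, norm_mul]
      gcongr
    have h5 : 0 < ε1 * ε2 := by positivity
    exact norm_pos_iff.1 (h5.trans_le this)
  have hζr : ζ = (ζ.re : ℂ) := Complex.ext (by simp) (by simpa using him)
  have hre' : 0 < ζ.re := by
    refine lt_of_le_of_ne hre fun h => hζ0 ?_
    rw [hζr, ← h]; simp
  rw [hζr, ← Complex.ofReal_inv, Complex.ofReal_inj] at hal'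
  rw [hal']
  exact inv_pos.2 hre'

lemma mu01_eq : μ01 = volume.restrict (Ioc (0:ℝ) 1) := by
  unfold μ01; exact Measure.restrict_congr_set Ioo_ae_eq_Ioc

instance : IsFiniteMeasure μ01 := by unfold μ01; infer_instance

lemma integral_mu01 {E : Type*} [NormedAddCommGroup E] [NormedSpace ℝ E] (f : ℝ → E) :
    ∫ s, f s ∂μ01 = ∫ s in (0:ℝ)..1, f s := by
  rw [mu01_eq, intervalIntegral.integral_of_le zero_le_one]

/-- The Fourier-type transform. -/
def FT (f : ℝ → ℂ) (z : ℝ) : ℂ := ∫ s, f s * cexp (-(2 * I * z * s)) ∂μ01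

lemma norm_cexp_FT (z s : ℝ) : ‖cexp (-(2 * I * z * s))‖ = 1 := by
  have : (-(2 * I * z * s) : ℂ) = ((-(2 * z * s) : ℝ) : ℂ) * I := by push_cast; ring
  rw [this, Complex.norm_exp_ofReal_mul_I]

lemma integrable_FT {f : ℝ → ℂ} (hf : Integrable f μ01) (z : ℝ) :
    Integrable (fun s : ℝ => f s * cexp (-(2 * I * z * s))) μ01 := by
  refine hf.mul_bdd (c := 1) (by fun_prop) (Eventually.of_forall fun s => (norm_cexp_FT z s).le)

lemma parseval_FT {f : ℝ → ℂ} (hf : MemLp f 2 μ01) :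
    HasSum (fun n : ℤ => ‖FT f (Real.pi * (n + 1/2))‖ ^ 2) (∫ s, ‖f s‖ ^ 2 ∂μ01) := by
  have hL : MemLp (fun s : ℝ => f s * cexp (-(2 * I * ((Real.pi/2 : ℝ):ℂ) * s))) 2
      (volume.restrict (Ioc (0:ℝ) 1)) := by
    rw [← mu01_eq]
    refine hf.of_le (hf.1.mul (by fun_prop)) (Eventually.of_forall fun s => ?_)
    rw [norm_mul, norm_cexp_FT, mul_one]
  have h := hasSum_sq_fourierCoeffOn (zero_lt_one) hL
  convert h using 2
  · rename_i n
    congr 1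
    rw [fourierCoeffOn_eq_integral, FT, integral_mu01]
    simp only [sub_zero, div_one, one_smul]
    congr 1
    refine intervalIntegral.integral_congr fun s _ => ?_
    simp only [smul_eq_mul]
    rw [fourier_coe_apply, mul_left_comm, ← Complex.exp_add]
    congr 2
    push_cast
    ring
  · rw [integral_mu01]
    simp only [sub_zero, inv_one, one_smul]
    refine intervalIntegral.integral_congr fun s _ => ?_
    simp only [norm_mul, norm_cexp_FT, mul_one]

lemma FT_continuous {f : ℝ → ℂ} (hf : Integrable f μ01) : Continuous (FT f) := by
  unfold FT
  refine continuous_of_dominated (bound := fun s => ‖f s‖) ?_ ?_ hf.norm ?_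
  · intro z; exact (integrable_FT hf z).1
  · intro z; refine Eventually.of_forall fun s => ?_
    rw [norm_mul, norm_cexp_FT, mul_one]
  · refine Eventually.of_forall fun s => ?_
    fun_prop

lemma ae_mu01_mem : ∀ᵐ s ∂μ01, s ∈ Ioo (0:ℝ) 1 := by
  unfold μ01; exact ae_restrict_mem measurableSet_Ioo

lemma integrable_smulFT {f : ℝ → ℂ} (hf : Integrable f μ01) :
    Integrable (fun s : ℝ => (-(2 * I * s)) * f s) μ01 := by
  refine hf.bdd_mul (c := 2) (by fun_prop) ?_
  filter_upwards [ae_mu01_mem] with s hs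
  simp only [norm_neg, norm_mul, Complex.norm_I, Complex.norm_ofNat, Complex.norm_real, Real.norm_eq_abs]
  rw [abs_of_pos hs.1]; linarith [hs.2]

lemma FT_hasDerivAt {f : ℝ → ℂ} (hf : Integrable f μ01) (z : ℝ) :
    HasDerivAt (FT f) (FT (fun s : ℝ => (-(2 * I * s)) * f s) z) z := by
  unfold FT
  refine (hasDerivAt_integral_of_dominated_loc_of_deriv_le (s := univ)
    (bound := fun s => 2 * ‖f s‖) (F := fun (z : ℝ) (s : ℝ) => f s * cexp (-(2 * I * z * s)))
    (F' := fun (z : ℝ) (s : ℝ) => (-(2 * I * s)) * f s * cexp (-(2 * I * z * s))) univ_mem ?_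
    (integrable_FT hf z) ?_ ?_ (hf.norm.const_mul 2) ?_).2
  · exact Eventually.of_forall fun z => (integrable_FT hf z).1
  · exact (integrable_FT (integrable_smulFT hf) z).1
  · filter_upwards [ae_mu01_mem] with s hs w _
    rw [norm_mul, norm_cexp_FT, mul_one, norm_mul]
    gcongr
    simp only [norm_neg, norm_mul, Complex.norm_I, Complex.norm_ofNat, Complex.norm_real, Real.norm_eq_abs]
    rw [abs_of_pos hs.1]; linarith [hs.2]
  · refine Eventually.of_forall fun s w _ => ?_
    have h1 : HasDerivAt (fun z : ℝ => (-(2 * I * z * s) : ℂ)) (-(2 * I * 1 * s)) w :=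
      (((Complex.ofRealCLM.hasDerivAt (x := w)).const_mul (2 * I)).mul_const (s:ℂ)).neg
    have h2 := (h1.cexp).const_mul (f s)
    exact h2.congr_deriv (by ring)

lemma sq_integral_le {a b : ℝ} (hab : a ≤ b) {g : ℝ → ℝ} (hg : IntervalIntegrable g volume a b)
    (hg2 : IntervalIntegrable (fun x => g x ^ 2) volume a b) :
    (∫ x in a..b, g x) ^ 2 ≤ (b - a) * ∫ x in a..b, g x ^ 2 := by
  rcases hab.eq_or_lt with rfl | hlt
  · simp
  set m := (∫ x in a..b, g x) / (b - a) with hm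
  have h0 : 0 ≤ ∫ x in a..b, (g x - m) ^ 2 :=
    intervalIntegral.integral_nonneg hab fun x _ => sq_nonneg _
  have h1 : ∫ x in a..b, (g x - m) ^ 2 = (∫ x in a..b, g x ^ 2) - 2 * m * (∫ x in a..b, g x) + (b - a) * m ^ 2 := by
    have : (fun x => (g x - m) ^ 2) = fun x => g x ^ 2 - 2 * m * g x + m ^ 2 := by
      funext x; ring
    rw [this, intervalIntegral.integral_add (hg2.sub (hg.const_mul _)) (by simp),
      intervalIntegral.integral_sub hg2 (hg.const_mul _), intervalIntegral.integral_const_mul]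
    simp
  have hba : 0 < b - a := by linarith
  have h2 : ∫ x in a..b, g x = (b - a) * m := by rw [hm]; field_simp
  rw [h1] at h0
  rw [h2] at h0 ⊢
  nlinarith

/-- Near-lattice completeness. -/
lemma near_lattice {f : ℝ → ℂ} (hf : MemLp f 2 μ01) (nu : ℤ → ℝ)
    (hnu : ∀ n, |nu n - Real.pi * (n + 1/2)| ≤ 1/8) (h0 : ∀ n, FT f (nu n) = 0) :
    f =ᵐ[μ01] 0 := by
  have hfi : Integrable f μ01 := hf.integrable (by norm_num)
  set f1 : ℝ → ℂ := fun s : ℝ => (-(2 * I * s)) * f s with hf1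
  have hf1i : Integrable f1 μ01 := integrable_smulFT hfi
  have hf1b : ∀ᵐ s ∂μ01, ‖f1 s‖ ≤ 2 * ‖f s‖ := by
    filter_upwards [ae_mu01_mem] with s hs
    simp only [hf1]
    rw [norm_mul]
    gcongr
    simp only [norm_neg, norm_mul, Complex.norm_I, Complex.norm_ofNat, Complex.norm_real, Real.norm_eq_abs]
    rw [abs_of_pos hs.1]; linarith [hs.2]
  have hf1L : MemLp f1 2 μ01 := by
    refine MemLp.of_le_mul (c := 2) hf hf1i.1 hf1b
  have hc1 : Continuous (FT f1) := FT_continuous hf1i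
  set A := ∫ s, ‖f s‖ ^ 2 ∂μ01 with hA
  have hA0 : 0 ≤ A := integral_nonneg fun s => sq_nonneg _
  have hfsq : Integrable (fun s => ‖f s‖ ^ 2) μ01 := (memLp_two_iff_integrable_sq_norm hf.1).1 hf
  -- Bessel
  have hbes : ∀ (T : Finset ℤ) (u : ℝ), ∑ n ∈ T, ‖FT f1 (Real.pi * (n + 1/2) + u)‖ ^ 2 ≤ 4 * A := by
    intro T u
    set g : ℝ → ℂ := fun s => f1 s * cexp (-(2 * I * u * s)) with hg
    have hgL : MemLp g 2 μ01 := by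
      refine hf1L.of_le (hf1i.1.mul (by fun_prop)) (Eventually.of_forall fun s => ?_)
      rw [hg]; simp only
      rw [norm_mul, norm_cexp_FT, mul_one]
    have hs := parseval_FT hgL
    have e : ∀ n : ℤ, FT g (Real.pi * (n + 1/2)) = FT f1 (Real.pi * (n + 1/2) + u) := by
      intro n
      unfold FT
      congr 1; funext s
      simp only [hg]
      rw [mul_assoc, ← Complex.exp_add]
      congr 2
      push_cast
      ring
    simp only [e] at hs
    refine (sum_le_hasSum T (fun _ _ => sq_nonneg _) hs).trans ?_
    rw [hA, ← integral_const_mul]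
    refine integral_mono_ae ((memLp_two_iff_integrable_sq_norm hgL.1).1 hgL) (hfsq.const_mul 4) ?_
    filter_upwards [hf1b] with s hs
    simp only [hg]
    rw [norm_mul, norm_cexp_FT, mul_one]
    nlinarith [norm_nonneg (f1 s), norm_nonneg (f s)]
  -- pointwise
  have hpt : ∀ n : ℤ, ‖FT f (Real.pi * (n + 1/2))‖ ^ 2 ≤
      (1/4) * ∫ u in (-(1/8) : ℝ)..(1/8), ‖FT f1 (Real.pi * (n + 1/2) + u)‖ ^ 2 := by
    intro n
    set x := Real.pi * ((n:ℝ) + 1/2) with hx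
    have hy := hnu n
    set y := nu n - x with hy'
    rw [abs_le] at hy
    have hft : ∫ u in (0:ℝ)..y, FT f1 (x + u) = - FT f x := by
      rw [intervalIntegral.integral_eq_sub_of_hasDerivAt (f := fun u => FT f (x + u))]
      · rw [hy']; simp [h0 n]
      · intro u _
        exact (FT_hasDerivAt hfi (x + u)).comp_const_add x u
      · exact (hc1.comp (continuous_const.add continuous_id)).intervalIntegrable _ _
    have hcn : Continuous fun u => ‖FT f1 (x + u)‖ := (hc1.comp (continuous_const.add continuous_id)).norm
    have hn1 : ‖FT f x‖ ≤ ∫ u in (-(1/8) : ℝ)..(1/8), ‖FT f1 (x + u)‖ := by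
      rw [← norm_neg, ← hft]
      refine intervalIntegral.norm_integral_le_integral_norm_uIoc.trans ?_
      rw [intervalIntegral.integral_of_le (by norm_num)]
      refine setIntegral_mono_set ?_ (Eventually.of_forall fun u => norm_nonneg _) ?_
      · exact (hcn.integrableOn_Icc (a := -(1/8)) (b := 1/8)).mono_set Ioc_subset_Icc_self
      · refine LE.le.eventuallyLE ?_
        rw [uIoc]
        refine Ioc_subset_Ioc ?_ ?_
        · exact le_min (by norm_num) hy.1
        · exact max_le (by norm_num) hy.2
    have hcs := sq_integral_le (show -(1/8:ℝ) ≤ 1/8 by norm_num) (hcn.intervalIntegrable _ _)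
      ((hcn.pow 2).intervalIntegrable _ _)
    calc ‖FT f x‖ ^ 2 ≤ (∫ u in (-(1/8) : ℝ)..(1/8), ‖FT f1 (x + u)‖) ^ 2 := by gcongr
      _ ≤ _ := hcs
      _ = _ := by norm_num
  have hsum : ∀ T : Finset ℤ, ∑ n ∈ T, ‖FT f (Real.pi * (n + 1/2))‖ ^ 2 ≤ (1/4) * A := by
    intro T
    refine (Finset.sum_le_sum fun n _ => hpt n).trans ?_
    rw [← Finset.mul_sum, ← intervalIntegral.integral_finsetSum]
    · have : ∫ u in (-(1/8) : ℝ)..(1/8), ∑ n ∈ T, ‖FT f1 (Real.pi * (n + 1/2) + u)‖ ^ 2 ≤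
        ∫ u in (-(1/8) : ℝ)..(1/8), 4 * A := by
        refine intervalIntegral.integral_mono_on (by norm_num) ?_ (by simp) fun u _ => hbes T u
        refine Continuous.intervalIntegrable ?_ _ _
        refine continuous_finsetSum _ fun n _ => ?_
        exact ((hc1.comp (continuous_const.add continuous_id)).norm).pow 2
      rw [intervalIntegral.integral_const, smul_eq_mul] at this
      norm_num at this ⊢
      linarith
    · intro n _
      refine Continuous.intervalIntegrable ?_ _ _
      exact ((hc1.comp (continuous_const.add continuous_id)).norm).pow 2
  have hAle : A ≤ (1/4) * A := le_of_tendsto (parseval_FT hf) (Eventually.of_forall hsum)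
  have hA00 : A = 0 := by linarith
  have := (integral_eq_zero_iff_of_nonneg (fun s => sq_nonneg _) hfsq).1 hA00
  filter_upwards [this] with s hs
  simpa using hs

lemma tri_swap {φ ψ : ℝ → ℂ} (hφ : Integrable φ μ01) (hψ : Integrable ψ μ01) :
    ∫ s, ψ s * (∫ r in (0:ℝ)..s, φ r) ∂μ01 = ∫ r, φ r * (∫ s in r..(1:ℝ), ψ s) ∂μ01 := by
  have h_itl : Integrable (Function.uncurry fun s r : ℝ =>
      {q : ℝ × ℝ | q.2 ≤ q.1}.indicator (fun q => ψ q.1 * φ q.2) (s, r)) (μ01.prod μ01) :=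
    (hψ.mul_prod hφ).indicator (measurableSet_le measurable_snd measurable_fst)
  have hsw := integral_integral_swap h_itl
  have e1 : ∀ᵐ s ∂μ01, ∫ r, {q : ℝ × ℝ | q.2 ≤ q.1}.indicator (fun q => ψ q.1 * φ q.2) (s, r) ∂μ01
      = ψ s * (∫ r in (0:ℝ)..s, φ r) := by
    filter_upwards [ae_mu01_mem] with s hs
    have : (fun r => {q : ℝ × ℝ | q.2 ≤ q.1}.indicator (fun q => ψ q.1 * φ q.2) (s, r)) =
        (Iic s).indicator (fun r => ψ s * φ r) := by
      funext r; simp only [indicator, mem_ofPred_eq, mem_Iic]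
    rw [this, integral_indicator measurableSet_Iic, mu01_eq, Measure.restrict_restrict measurableSet_Iic,
      intervalIntegral.integral_of_le hs.1.le, ← integral_const_mul]
    congr 2
    ext r; simp only [mem_inter_iff, mem_Iic, mem_Ioc]
    constructor
    · rintro ⟨h1, h2, h3⟩; exact ⟨h2, h1⟩
    · rintro ⟨h1, h2⟩; exact ⟨h2, h1, h2.trans hs.2.le⟩
  have e2 : ∀ᵐ r ∂μ01, ∫ s, {q : ℝ × ℝ | q.2 ≤ q.1}.indicator (fun q => ψ q.1 * φ q.2) (s, r) ∂μ01
      = φ r * (∫ s in r..(1:ℝ), ψ s) := by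
    filter_upwards [ae_mu01_mem] with r hr
    have : (fun s => {q : ℝ × ℝ | q.2 ≤ q.1}.indicator (fun q => ψ q.1 * φ q.2) (s, r)) =
        (Ici r).indicator (fun s => φ r * ψ s) := by
      funext s; simp only [indicator, mem_ofPred_eq, mem_Ici, mul_comm]
    rw [this, integral_indicator measurableSet_Ici, mu01_eq, Measure.restrict_restrict measurableSet_Ici,
      intervalIntegral.integral_of_le hr.2.le, ← integral_const_mul]
    have : Ici r ∩ Ioc 0 1 = Icc r 1 := by
      ext s; simp only [mem_inter_iff, mem_Ici, mem_Ioc, mem_Icc]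
      constructor
      · rintro ⟨h1, h2, h3⟩; exact ⟨h1, h3⟩
      · rintro ⟨h1, h2⟩; exact ⟨h1, hr.1.trans_le h1, h2⟩
    rw [this]
    exact integral_Icc_eq_integral_Ioc
  rw [← integral_congr_ae e1, ← integral_congr_ae e2]
  exact hsw

/-- division step -/
lemma FT_divide {f : ℝ → ℂ} (hf : MemLp f 2 μ01) (a b : ℝ) (h0 : FT f a = 0) :
    ∃ g : ℝ → ℂ, MemLp g 2 μ01 ∧ ∀ z : ℝ, FT g z * (z - a) = FT f z * (z - b) := by
  have hfi : Integrable f μ01 := hf.integrable (by norm_num)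
  set φ : ℝ → ℂ := fun r => f r * cexp (-(2 * I * a * r)) with hφ
  have hφi : Integrable φ μ01 := integrable_FT hfi a
  have hφii : IntervalIntegrable φ volume 0 1 := by
    rw [intervalIntegrable_iff_integrableOn_Ioc_of_le zero_le_one]
    rw [mu01_eq] at hφi; exact hφi
  set V : ℝ → ℂ := fun s => ∫ r in (0:ℝ)..s, φ r with hV
  have hVc : ContinuousOn V (Icc 0 1) := by
    have := intervalIntegral.continuousOn_primitive_interval' hφii (left_mem_uIcc)
    rwa [uIcc_of_le zero_le_one] at this
  have hVm : AEStronglyMeasurable V μ01 := by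
    have := (hVc.mono Ioo_subset_Icc_self).aestronglyMeasurable measurableSet_Ioo (μ := volume)
    exact this
  obtain ⟨C, hC⟩ := isCompact_Icc.exists_bound_of_continuousOn hVc
  set G : ℝ → ℂ := fun s => V s * cexp (-(2 * I * (-a : ℝ) * s)) with hG
  have hGb : ∀ᵐ s ∂μ01, ‖G s‖ ≤ C := by
    filter_upwards [ae_mu01_mem] with s hs
    simp only [hG]
    rw [norm_mul, norm_cexp_FT, mul_one]
    exact hC s ⟨hs.1.le, hs.2.le⟩
  have hGm : AEStronglyMeasurable G μ01 := hVm.mul (by fun_prop)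
  have hGL : MemLp G 2 μ01 := MemLp.of_bound hGm C hGb
  have hGi : Integrable G μ01 := hGL.integrable (by norm_num)
  have key : ∀ z : ℝ, 2 * I * (z - a) * FT G z = FT f z := by
    intro z
    set ψ : ℝ → ℂ := fun s => cexp (-(2 * I * ((z - a : ℝ):ℂ) * s)) with hψ
    have hψi : Integrable ψ μ01 := Integrable.of_bound (by fun_prop) 1
      (Eventually.of_forall fun s => (norm_cexp_FT _ s).le)
    have e1 : FT G z = ∫ s, ψ s * (∫ r in (0:ℝ)..s, φ r) ∂μ01 := by
      unfold FT
      congr 1; funext s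
      simp only [hG, hψ]
      rw [mul_assoc, ← Complex.exp_add, mul_comm]
      congr 2
      push_cast; ring
    rw [e1, tri_swap hφi hψi, ← integral_const_mul]
    have e2 : ∀ r : ℝ, 2 * I * (z - a) * (φ r * ∫ s in r..(1:ℝ), ψ s) =
        f r * cexp (-(2 * I * z * r)) - ψ 1 * φ r := by
      intro r
      have e3 : 2 * I * (z - a) * ∫ s in r..(1:ℝ), ψ s = ψ r - ψ 1 := by
        rw [← intervalIntegral.integral_const_mul]
        rw [intervalIntegral.integral_eq_sub_of_hasDerivAt (f := fun s => - ψ s)]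
        · ring
        · intro s _
          have h1 : HasDerivAt (fun s : ℝ => (-(2 * I * ((z - a : ℝ):ℂ) * s) : ℂ))
              (-(2 * I * ((z - a : ℝ):ℂ) * 1)) s :=
            ((Complex.ofRealCLM.hasDerivAt (x := s)).const_mul (2 * I * ((z - a : ℝ):ℂ))).neg
          have h2 : HasDerivAt (fun s => - ψ s) _ s := (h1.cexp).neg
          refine h2.congr_deriv ?_
          simp only [hψ]
          push_cast
          ring
        · refine Continuous.intervalIntegrable ?_ _ _
          simp only [hψ]; fun_prop
      rw [mul_left_comm, e3]
      simp only [hφ]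
      have : cexp (-(2 * I * a * r)) * ψ r = cexp (-(2 * I * z * r)) := by
        simp only [hψ]; rw [← Complex.exp_add]; congr 1; push_cast; ring
      rw [← this]; ring
    simp only [e2]
    rw [integral_sub (integrable_FT hfi z) (hφi.const_mul _), integral_const_mul]
    have : ∫ r, φ r ∂μ01 = 0 := h0
    rw [this]; simp [FT]
  refine ⟨fun s => f s + 2 * I * (a - b) * G s, hf.add (hGL.const_mul _), fun z => ?_⟩
  have e : FT (fun s => f s + 2 * I * (a - b) * G s) z = FT f z + 2 * I * (a - b) * FT G z := by
    unfold FT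
    rw [← integral_const_mul, ← integral_add (integrable_FT hfi z) ((integrable_FT hGi z).const_mul _)]
    congr 1; funext s; ring
  rw [e, add_mul]
  linear_combination (a - b : ℂ) * key z

lemma FT_divide_finset {f : ℝ → ℂ} (hf : MemLp f 2 μ01) (a b : ℤ → ℝ) (ha : Function.Injective a)
    (S : Finset ℤ) (h0 : ∀ n ∈ S, FT f (a n) = 0) :
    ∃ g : ℝ → ℂ, MemLp g 2 μ01 ∧ ∀ z : ℝ,
      FT g z * ∏ n ∈ S, ((z:ℂ) - a n) = FT f z * ∏ n ∈ S, ((z:ℂ) - b n) := by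
  induction S using Finset.induction_on with
  | empty => exact ⟨f, hf, fun z => by simp⟩
  | insert k S hk ih =>
    obtain ⟨g, hg, hgz⟩ := ih fun n hn => h0 n (Finset.mem_insert_of_mem hn)
    have hgk : FT g (a k) = 0 := by
      have := hgz (a k)
      rw [h0 k (Finset.mem_insert_self _ _), zero_mul] at this
      refine (mul_eq_zero.1 this).resolve_right ?_
      refine Finset.prod_ne_zero_iff.2 ?_
      intro n hn
      rw [sub_ne_zero]
      intro h
      have : a k = a n := by exact_mod_cast h
      rw [ha this] at hk
      exact hk hn
    obtain ⟨g2, hg2, hg2z⟩ := FT_divide hg (a k) (b k) hgk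
    refine ⟨g2, hg2, fun z => ?_⟩
    rw [Finset.prod_insert hk, Finset.prod_insert hk, ← mul_assoc, hg2z z]
    linear_combination ((z:ℂ) - b k) * hgz z

lemma fc_tendsto {p : ℝ≥0∞} (hp : 1 ≤ p) {g : ℝ → ℂ} (hg : MemLp g p μ01) :
    Tendsto (fun n : ℤ => ‖fc g n‖) cofinite (nhds 0) := by
  have h := Real.tendsto_integral_exp_smul_cocompact ((Ioc (0:ℝ) 1).indicator g)
  have h2 : Tendsto (fun n : ℤ => (n : ℝ)) cofinite (cocompact ℝ) := Int.tendsto_coe_cofinite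
  have h3 := (h.comp h2).norm
  rw [norm_zero] at h3
  refine h3.congr fun n => ?_
  simp only [Function.comp]
  congr 1
  unfold fc
  rw [intervalIntegral.integral_of_le zero_le_one, ← integral_indicator measurableSet_Ioc]
  congr 1; funext s
  by_cases hs : s ∈ Ioc (0:ℝ) 1
  · simp only [indicator_of_mem hs]
    rw [Circle.smul_def, Real.fourierChar_apply, smul_eq_mul]
    congr 2
    push_cast; ring
  · simp only [indicator_of_notMem hs, smul_zero]

theorem completeness {p : ℝ≥0∞} (hp : 1 ≤ p) {lam : ℤ → ℝ} (hm : StrictMono lam)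
    (hlam : LamAsymp p lam) {f : ℝ → ℂ} (hf : MemLp f 2 μ01) (h0 : ∀ n, FT f (lam n) = 0) :
    f =ᵐ[μ01] 0 := by
  obtain ⟨g, hg, hgl⟩ := hlam
  have hev : ∀ᶠ n : ℤ in cofinite, ‖fc g n‖ < 1/8 := (fc_tendsto hp hg).eventually_lt_const (by norm_num)
  rw [eventually_cofinite] at hev
  set S := hev.toFinset with hS
  have hnS : ∀ n, n ∉ S → |lam n - Real.pi * (n + 1/2)| ≤ 1/8 := by
    intro n hn
    have h1 : ‖fc g n‖ < 1/8 := by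
      by_contra h
      exact hn (hev.mem_toFinset.2 h)
    have h2 : fc g n = ((lam n - Real.pi * (n + 1/2) : ℝ) : ℂ) := by
      push_cast
      rw [hgl n]; ring
    rw [h2, Complex.norm_real, Real.norm_eq_abs] at h1
    exact h1.le
  -- generic shift
  obtain ⟨t, ht, htS⟩ : ∃ t ∈ Ioo (0:ℝ) (1/8),
      t ∉ ((S ×ˢ S).image fun q => lam q.2 - Real.pi * (q.1 + 1/2) : Finset ℝ) := by
    have hinf : (Ioo (0:ℝ) (1/8)).Infinite := Ioo_infinite (by norm_num)
    exact hinf.exists_notMem_finset _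
  set b : ℤ → ℝ := fun n => Real.pi * (n + 1/2) + t with hb
  obtain ⟨g1, hg1, hg1z⟩ := FT_divide_finset hf lam b hm.injective S fun n _ => h0 n
  have hg10 : g1 =ᵐ[μ01] 0 := by
    refine near_lattice hg1 (fun n => if n ∈ S then b n else lam n) ?_ ?_
    · intro n
      by_cases hn : n ∈ S
      · simp only [hn, if_true, hb]
        rw [add_sub_cancel_left, abs_of_pos ht.1]; exact ht.2.le
      · simp only [hn, if_false]; exact hnS n hn
    · intro n
      by_cases hn : n ∈ S
      · simp only [hn, if_true]
        have h1 := hg1z (b n)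
        rw [Finset.prod_eq_zero (i := n) (f := fun k => ((b n : ℝ) : ℂ) - b k) hn (sub_self _), mul_zero] at h1
        refine (mul_eq_zero.1 h1).resolve_right ?_
        refine Finset.prod_ne_zero_iff.2 ?_
        intro k hk h2
        have h3 : b n = lam k := by exact_mod_cast sub_eq_zero.1 h2
        apply htS
        rw [Finset.mem_image]
        refine ⟨(n, k), Finset.mem_product.2 ⟨hn, hk⟩, ?_⟩
        simp only [hb] at h3
        simp only
        linarith
      · simp only [hn, if_false]
        have h1 := hg1z (lam n)
        rw [h0 n, zero_mul] at h1
        refine (mul_eq_zero.1 h1).resolve_right ?_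
        refine Finset.prod_ne_zero_iff.2 ?_
        intro k hk h2
        have h3 : lam n = lam k := by exact_mod_cast sub_eq_zero.1 h2
        rw [hm.injective h3] at hn
        exact hn hk
  have hFT1 : ∀ z, FT g1 z = 0 := by
    intro z
    unfold FT
    rw [integral_congr_ae (g := fun _ => 0)]
    · simp
    · filter_upwards [hg10] with s hs
      simp [hs]
  have hfz : ∀ z : ℝ, z ∉ S.image b → FT f z = 0 := by
    intro z hz
    have h1 := hg1z z
    rw [hFT1, zero_mul] at h1
    refine (mul_eq_zero.1 h1.symm).resolve_right ?_
    refine Finset.prod_ne_zero_iff.2 ?_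
    intro k hk h2
    have h3 : z = b k := by exact_mod_cast sub_eq_zero.1 h2
    exact hz (Finset.mem_image.2 ⟨k, hk, h3.symm⟩)
  have hcont := FT_continuous (hf.integrable (by norm_num))
  have hd : Dense ((S.image b : Finset ℝ) : Set ℝ)ᶜ := by
    exact (Finset.finite_toSet _).countable.dense_compl ℝ
  have hall : FT f = fun _ => 0 := by
    refine Continuous.ext_on hd hcont continuous_const ?_
    intro z hz
    exact hfz z (by simpa using hz)
  refine near_lattice hf (fun n => Real.pi * (n + 1/2)) (fun n => by simp) fun n => by rw [hall]

section abstractHilbert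
variable {E : Type*} [NormedAddCommGroup E] [InnerProductSpace ℂ E]

/-- limit quadratic form facts -/
structure QForm (ι : ℕ → Type) [∀ n, Fintype (ι n)] (c : ∀ n, ι n → ℝ) (ell : ∀ n, ι n → (E →L[ℂ] ℂ))
    (Q : E → ℝ) : Prop where
  cauchy : ∀ ε > 0, ∃ n0 : ℕ, ∀ n ≥ n0, ∀ f : E, |Q f - (‖f‖ ^ 2 + ∑ j, c n j * ‖ell n j f‖ ^ 2)| ≤ ε * ‖f‖ ^ 2
  pos : ∀ f, 0 ≤ Q f

variable {ι : ℕ → Type} [∀ n, Fintype (ι n)] {c : ∀ n, ι n → ℝ} {ell : ∀ n, ι n → (E →L[ℂ] ℂ)}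
    {Q : E → ℝ}

lemma QForm.tendsto (h : QForm ι c ell Q) (f : E) :
    Tendsto (fun n => ‖f‖ ^ 2 + ∑ j, c n j * ‖ell n j f‖ ^ 2) atTop (nhds (Q f)) := by
  rw [Metric.tendsto_atTop]
  intro ε hε
  obtain ⟨n0, hn⟩ := h.cauchy (ε / (‖f‖ ^ 2 + 1)) (by positivity)
  refine ⟨n0, fun n hnn => ?_⟩
  rw [dist_comm, Real.dist_eq]
  refine (hn n hnn f).trans_lt ?_
  rw [div_mul_eq_mul_div, div_lt_iff₀ (by positivity)]
  nlinarith

lemma QForm.par (h : QForm ι c ell Q) (f g : E) : Q (f + g) + Q (f - g) = 2 * Q f + 2 * Q g := by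
  refine tendsto_nhds_unique ((h.tendsto (f + g)).add (h.tendsto (f - g))) ?_
  refine (((h.tendsto f).const_mul 2).add ((h.tendsto g).const_mul 2)).congr fun n => ?_
  have h1 := parallelogram_law_with_norm ℂ f g
  have h2 : ∀ j, ‖ell n j (f + g)‖ ^ 2 + ‖ell n j (f - g)‖ ^ 2 =
      2 * (‖ell n j f‖ ^ 2 + ‖ell n j g‖ ^ 2) := by
    intro j
    rw [map_add, map_sub]
    have := parallelogram_law_with_norm ℂ (ell n j f) (ell n j g)
    linarith
  have h3 : (∑ j, c n j * ‖ell n j (f + g)‖ ^ 2) + (∑ j, c n j * ‖ell n j (f - g)‖ ^ 2) =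
      2 * (∑ j, c n j * ‖ell n j f‖ ^ 2) + 2 * (∑ j, c n j * ‖ell n j g‖ ^ 2) := by
    rw [← Finset.sum_add_distrib, Finset.mul_sum, Finset.mul_sum, ← Finset.sum_add_distrib]
    refine Finset.sum_congr rfl fun j _ => ?_
    linear_combination c n j * h2 j
  linarith

lemma QForm.sub_le (h : QForm ι c ell Q) (f g : E) : Q (f - g) ≤ 2 * Q f + 2 * Q g := by
  linarith [h.par f g, h.pos (f + g)]

lemma QForm.add_le (h : QForm ι c ell Q) (f g : E) : Q (f + g) ≤ 2 * Q f + 2 * Q g := by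
  linarith [h.par f g, h.pos (f - g)]

lemma QForm.lemA (h : QForm ι c ell Q) (f : ℕ → E) (M : ℝ) (hM : ∀ k, ‖f k‖ ≤ M)
    (hQ : Tendsto (fun k => Q (f k)) atTop (nhds 0)) :
    ∃ s : ℕ → ℕ, StrictMono s ∧ CauchySeq (f ∘ s) := by
  obtain ⟨m, hm⟩ := h.cauchy (1/2) (by norm_num)
  have hm := hm m le_rfl
  -- coefficient vectors
  have hb : Bornology.IsBounded (Metric.closedBall (0 : ι m → ℂ) ((∑ j, ‖ell m j‖) * M)) :=
    Metric.isBounded_closedBall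
  have hM0 : 0 ≤ M := (norm_nonneg _).trans (hM 0)
  obtain ⟨a, -, s, hs, hlim⟩ := tendsto_subseq_of_bounded hb (x := fun k => fun j => ell m j (f k)) (by
    intro k
    rw [mem_closedBall_zero_iff, pi_norm_le_iff_of_nonneg (by positivity)]
    intro j
    refine ((ell m j).le_opNorm _).trans ?_
    refine mul_le_mul ?_ (hM k) (norm_nonneg _) (by positivity)
    exact Finset.single_le_sum (f := fun j => ‖ell m j‖) (fun _ _ => norm_nonneg _) (Finset.mem_univ j))
  refine ⟨s, hs, ?_⟩
  have hc := hlim.cauchySeq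
  have hQs := hQ.comp hs.tendsto_atTop
  rw [Metric.cauchySeq_iff] at hc ⊢
  intro ε hε
  set C := (∑ j, |c m j|) + 1 with hC
  have hCpos : 0 < C := by positivity
  obtain ⟨N1, hN1⟩ := hc (Real.sqrt (ε ^ 2 / (8 * C))) (by positivity)
  obtain ⟨N2, hN2⟩ := (hQs.eventually_lt_const (show (0:ℝ) < ε ^ 2 / 16 by positivity)).exists_forall_of_atTop
  refine ⟨max N1 N2, fun k hk l hl => ?_⟩
  have h1 := hN1 k (le_of_max_le_left hk) l (le_of_max_le_left hl)
  have h2 := hN2 k (le_of_max_le_right hk)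
  have h3 := hN2 l (le_of_max_le_right hl)
  simp only [Function.comp] at h1 h2 h3 ⊢
  rw [dist_eq_norm] at h1 ⊢
  set g := f (s k) - f (s l) with hg
  have h4 := h.sub_le (f (s k)) (f (s l))
  have h5 := (abs_le.1 (hm g)).1
  have h6 : ∀ j, ‖ell m j g‖ ^ 2 ≤ ε ^ 2 / (8 * C) := by
    intro j
    have : ‖ell m j g‖ ≤ Real.sqrt (ε ^ 2 / (8 * C)) := by
      refine le_trans ?_ h1.le
      have := norm_le_pi_norm ((fun j => ell m j (f (s k))) - fun j => ell m j (f (s l))) j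
      simpa [hg] using this
    calc ‖ell m j g‖ ^ 2 ≤ (Real.sqrt (ε ^ 2 / (8 * C))) ^ 2 := by gcongr
      _ = _ := Real.sq_sqrt (by positivity)
  have h7 : -(∑ j, c m j * ‖ell m j g‖ ^ 2) ≤ (∑ j, |c m j|) * (ε ^ 2 / (8 * C)) := by
    rw [← Finset.sum_neg_distrib, Finset.sum_mul]
    refine Finset.sum_le_sum fun j _ => ?_
    rw [← neg_mul]
    exact mul_le_mul (neg_le_abs _) (h6 j) (sq_nonneg _) (abs_nonneg _)
  have h8 : (∑ j, |c m j|) * (ε ^ 2 / (8 * C)) ≤ ε ^ 2 / 8 := by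
    rw [mul_div_assoc', div_le_div_iff₀ (by positivity) (by norm_num)]
    have : 0 < ε ^ 2 := by positivity
    nlinarith
  have h9 : ‖g‖ ^ 2 < ε ^ 2 := by nlinarith
  exact lt_of_pow_lt_pow_left₀ 2 hε.le h9

lemma QForm.coer [CompleteSpace E] (h : QForm ι c ell Q) (hinj : ∀ f, Q f = 0 → f = 0) :
    ∃ δ > 0, ∃ n0 : ℕ, ∀ n ≥ n0, ∀ f : E, δ * ‖f‖ ^ 2 ≤ ‖f‖ ^ 2 + ∑ j, c n j * ‖ell n j f‖ ^ 2 := by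
  have main : ∃ δ > 0, ∀ f : E, ‖f‖ = 1 → δ ≤ Q f := by
    by_contra hcon
    push Not at hcon
    choose f hf1 hf2 using fun k : ℕ => hcon (1 / ((k:ℝ) + 1)) (by positivity)
    have hQ : Tendsto (fun k => Q (f k)) atTop (nhds 0) :=
      squeeze_zero (fun k => h.pos _) (fun k => (hf2 k).le) tendsto_one_div_add_atTop_nhds_zero_nat
    obtain ⟨s, hs, hc⟩ := h.lemA f 1 (fun k => (hf1 k).le) hQ
    obtain ⟨f0, hf0⟩ := cauchySeq_tendsto_of_complete hc
    have hn : ‖f0‖ = 1 := by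
      refine tendsto_nhds_unique hf0.norm ?_
      simp [Function.comp_def, hf1]
    -- bound of Q
    obtain ⟨m, hm⟩ := h.cauchy 1 (by norm_num)
    have hm := hm m le_rfl
    set B := 2 + ∑ j, |c m j| * ‖ell m j‖ ^ 2 with hB
    have hQb : ∀ g, Q g ≤ B * ‖g‖ ^ 2 := by
      intro g
      have h1 := (abs_le.1 (hm g)).2
      have h2 : ∑ j, c m j * ‖ell m j g‖ ^ 2 ≤ (∑ j, |c m j| * ‖ell m j‖ ^ 2) * ‖g‖ ^ 2 := by
        rw [Finset.sum_mul]
        refine Finset.sum_le_sum fun j _ => ?_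
        rw [mul_assoc, ← mul_pow]
        refine mul_le_mul (le_abs_self _) ?_ (by positivity) (abs_nonneg _)
        gcongr
        exact (ell m j).le_opNorm g
      rw [hB]; linarith
    have hz : Q f0 ≤ 0 := by
      have hlim : Tendsto (fun k => 2 * Q (f (s k)) + 2 * (B * ‖f0 - f (s k)‖ ^ 2)) atTop (nhds (2 * 0 + 2 * (B * ‖f0 - f0‖ ^ 2))) := by
        refine ((hQ.comp hs.tendsto_atTop).const_mul 2).add (((((hf0.const_sub f0).norm).pow 2).const_mul B).const_mul 2)
      simp only [sub_self, norm_zero] at hlim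
      norm_num at hlim
      refine ge_of_tendsto hlim (Eventually.of_forall fun k => ?_)
      have := h.add_le (f (s k)) (f0 - f (s k))
      rw [add_sub_cancel] at this
      linarith [hQb (f0 - f (s k))]
    have := hinj f0 (le_antisymm hz (h.pos _))
    rw [this, norm_zero] at hn
    norm_num at hn
  obtain ⟨δ, hδ, hmain⟩ := main
  have hmain2 : ∀ f : E, δ * ‖f‖ ^ 2 ≤ Q f := by
    intro f
    by_cases hf : f = 0
    · subst hf; simp [h.pos]
    have hfn : ‖f‖ ≠ 0 := norm_ne_zero_iff.2 hf
    have h1 := hmain ((((‖f‖⁻¹ : ℝ) : ℂ)) • f) (by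
      rw [norm_smul, Complex.norm_real, norm_inv, norm_norm, inv_mul_cancel₀ hfn])
    have h2 : Q ((((‖f‖⁻¹ : ℝ) : ℂ)) • f) = ‖f‖⁻¹ ^ 2 * Q f := by
      refine tendsto_nhds_unique (h.tendsto _) (((h.tendsto f).const_mul (‖f‖⁻¹ ^ 2)).congr fun n => ?_)
      simp only [map_smul, norm_smul, Complex.norm_real, norm_inv, norm_norm, mul_pow]
      rw [mul_add, Finset.mul_sum]
      congr 1
      refine Finset.sum_congr rfl fun j _ => by ring
    rw [h2] at h1
    calc δ * ‖f‖ ^ 2 ≤ (‖f‖⁻¹ ^ 2 * Q f) * ‖f‖ ^ 2 := by gcongr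
      _ = Q f := by field_simp
  obtain ⟨n0, hn0⟩ := h.cauchy (δ / 2) (by positivity)
  refine ⟨δ / 2, by positivity, n0, fun n hn f => ?_⟩
  have h1 := (abs_le.1 (hn0 n hn f)).2
  linarith [hmain2 f]

end abstractHilbert

/-- data of an exponential sum -/
structure ES where
  ι : Type
  [fin : Fintype ι]
  [dec : DecidableEq ι]
  c : ι → ℝ
  w : ι → ℝ

attribute [instance] ES.fin ES.dec

def ex (w s : ℝ) : ℂ := cexp (I * w * s)

def ES.h (E : ES) (u : ℝ) : ℂ := ∑ j, (E.c j : ℂ) * ex (E.w j) u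

@[simp] lemma norm_ex (w s : ℝ) : ‖ex w s‖ = 1 := by
  unfold ex
  have : (I * w * s : ℂ) = ((w * s : ℝ) : ℂ) * I := by push_cast; ring
  rw [this, Complex.norm_exp_ofReal_mul_I]

lemma conj_ex (w s : ℝ) : (starRingEnd ℂ) (ex w s) = ex w (-s) := by
  unfold ex
  rw [← Complex.exp_conj]
  simp

lemma ex_add (w s t : ℝ) : ex w (s + t) = ex w s * ex w t := by
  unfold ex
  rw [← Complex.exp_add]; congr 1; push_cast; ring

lemma ex_sub (w s t : ℝ) : ex w (s - t) = ex w s * (starRingEnd ℂ) (ex w t) := by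
  rw [conj_ex, ← ex_add, sub_eq_add_neg]

@[simp] lemma ex_zero (w : ℝ) : ex w 0 = 1 := by simp [ex]

@[fun_prop] lemma continuous_ex (w : ℝ) : Continuous (ex w) := by
  unfold ex; fun_prop

lemma ES.continuous_h (E : ES) : Continuous E.h := by
  unfold ES.h
  refine continuous_finsetSum _ fun j _ => ?_
  fun_prop

lemma ES.conj_h (E : ES) (u : ℝ) : (starRingEnd ℂ) (E.h u) = E.h (-u) := by
  unfold ES.h
  rw [map_sum]
  refine Finset.sum_congr rfl fun j _ => ?_
  rw [map_mul, conj_ex, Complex.conj_ofReal]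

lemma ES.norm_h_le (E : ES) (u : ℝ) : ‖E.h u‖ ≤ ∑ j, |E.c j| := by
  unfold ES.h
  refine (norm_sum_le _ _).trans (Finset.sum_le_sum fun j _ => ?_)
  rw [norm_mul, norm_ex, mul_one, Complex.norm_real, Real.norm_eq_abs]

def ES.coef (E : ES) (f : ℝ → ℂ) (j : E.ι) : ℂ := ∫ s, f s * ex (E.w j) s ∂μ01

def ES.q (E : ES) (f : ℝ → ℂ) : ℝ := ∑ j, E.c j * ‖E.coef f j‖ ^ 2

def Coer (E : ES) (δ : ℝ) : Prop := ∀ f : ℝ → ℂ, MemLp f 2 μ01 →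
  δ * ∫ s, ‖f s‖ ^ 2 ∂μ01 ≤ (∫ s, ‖f s‖ ^ 2 ∂μ01) + E.q f

lemma integrable_mul_ex {μ : Measure ℝ} {f : ℝ → ℂ} (hf : Integrable f μ) (w : ℝ) :
    Integrable (fun s : ℝ => f s * ex w s) μ := by
  refine hf.mul_bdd (c := 1) (by fun_prop) (Eventually.of_forall fun s => (norm_ex w s).le)

lemma integrable_conj {α : Type*} [MeasurableSpace α] {μ : Measure α} {f : α → ℂ} (hf : Integrable f μ) :
    Integrable (fun s => (starRingEnd ℂ) (f s)) μ :=
  ContinuousLinearMap.integrable_comp (Complex.conjCLE : ℂ →L[ℝ] ℂ) hf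

lemma ES.quad (E : ES) {f : ℝ → ℂ} (hf : Integrable f μ01) :
    (E.q f : ℂ) = ∫ z : ℝ × ℝ, f z.1 * (starRingEnd ℂ) (f z.2) * E.h (z.1 - z.2) ∂(μ01.prod μ01) := by
  have h1 : ∀ j, Integrable (fun z : ℝ × ℝ => (E.c j : ℂ) * ((f z.1 * ex (E.w j) z.1) * (starRingEnd ℂ) (f z.2 * ex (E.w j) z.2)))
      (μ01.prod μ01) := by
    intro j
    have h1 := integrable_mul_ex hf (E.w j)
    have h2 : Integrable (fun s => (starRingEnd ℂ) (f s * ex (E.w j) s)) μ01 :=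
      integrable_conj h1
    exact (h1.mul_prod h2).const_mul _
  have h2 : (fun z : ℝ × ℝ => f z.1 * (starRingEnd ℂ) (f z.2) * E.h (z.1 - z.2)) =
      fun z => ∑ j, (E.c j : ℂ) * ((f z.1 * ex (E.w j) z.1) * (starRingEnd ℂ) (f z.2 * ex (E.w j) z.2)) := by
    funext z
    unfold ES.h
    rw [Finset.mul_sum]
    refine Finset.sum_congr rfl fun j _ => ?_
    rw [ex_sub, map_mul]; ring
  rw [h2, integral_finsetSum _ fun j _ => h1 j]
  unfold ES.q
  push_cast
  refine Finset.sum_congr rfl fun j _ => ?_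
  rw [integral_const_mul, integral_prod_mul (fun s => f s * ex (E.w j) s) (fun s => (starRingEnd ℂ) (f s * ex (E.w j) s)),
    integral_conj]
  unfold ES.coef
  rw [Complex.mul_conj, Complex.normSq_eq_norm_sq]
  push_cast; rfl

lemma shift_int_le {k : ℝ → ℝ} (hk : Continuous k) (hk0 : ∀ u, 0 ≤ k u) {s : ℝ} (hs : s ∈ Icc (0:ℝ) 1) :
    ∫ t, k (s - t) ∂μ01 ≤ ∫ u in (-1:ℝ)..1, k u := by
  rw [integral_mu01, intervalIntegral.integral_comp_sub_left (fun u => k u) s]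
  refine intervalIntegral.integral_mono_interval (by linarith [hs.1]) (by linarith) (by linarith [hs.2])
    (Eventually.of_forall hk0) (hk.intervalIntegrable _ _)

lemma shift_int_le' {k : ℝ → ℝ} (hk : Continuous k) (hk0 : ∀ u, 0 ≤ k u) {s : ℝ} (hs : s ∈ Icc (0:ℝ) 1) :
    ∫ t, k (t - s) ∂μ01 ≤ ∫ u in (-1:ℝ)..1, k u := by
  rw [integral_mu01, intervalIntegral.integral_comp_sub_right (fun u => k u) s]
  refine intervalIntegral.integral_mono_interval (by linarith [hs.2]) (by linarith) (by linarith [hs.1])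
    (Eventually.of_forall hk0) (hk.intervalIntegrable _ _)

lemma ES.quad_diff (E E' : ES) {f : ℝ → ℂ} (hf : MemLp f 2 μ01) :
    |E.q f - E'.q f| ≤ (∫ u in (-1:ℝ)..1, ‖E.h u - E'.h u‖) * ∫ s, ‖f s‖ ^ 2 ∂μ01 := by
  have hfi : Integrable f μ01 := hf.integrable (by norm_num)
  have hfsq : Integrable (fun s => ‖f s‖ ^ 2) μ01 := (memLp_two_iff_integrable_sq_norm hf.1).1 hf
  set k : ℝ → ℝ := fun u => ‖E.h u - E'.h u‖ with hk
  have hkc : Continuous k := (E.continuous_h.sub E'.continuous_h).norm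
  have hk0 : ∀ u, 0 ≤ k u := fun u => norm_nonneg _
  set B := (∑ j, |E.c j|) + ∑ j, |E'.c j| with hB
  have hkB : ∀ u, k u ≤ B := fun u => (norm_sub_le _ _).trans (add_le_add (E.norm_h_le u) (E'.norm_h_le u))
  have h_itl : ∀ E : ES, Integrable (fun z : ℝ × ℝ => f z.1 * (starRingEnd ℂ) (f z.2) * E.h (z.1 - z.2)) (μ01.prod μ01) := by
    intro E
    have h2 : Integrable (fun s => (starRingEnd ℂ) (f s)) μ01 := integrable_conj hfi
    refine (hfi.mul_prod h2).mul_bdd (c := ∑ j, |E.c j|) ?_ (Eventually.of_forall fun z => E.norm_h_le _)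
    exact (E.continuous_h.comp (continuous_fst.sub continuous_snd)).aestronglyMeasurable
  have e : ((E.q f - E'.q f : ℝ) : ℂ) = ∫ z : ℝ × ℝ, (f z.1 * (starRingEnd ℂ) (f z.2) * E.h (z.1 - z.2) -
      f z.1 * (starRingEnd ℂ) (f z.2) * E'.h (z.1 - z.2)) ∂(μ01.prod μ01) := by
    rw [integral_sub (h_itl E) (h_itl E'), ← E.quad hfi, ← E'.quad hfi]; push_cast; rfl
  have h1 : |E.q f - E'.q f| = ‖((E.q f - E'.q f : ℝ) : ℂ)‖ := by rw [Complex.norm_real, Real.norm_eq_abs]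
  rw [h1, e]
  have hkp : AEStronglyMeasurable (fun z : ℝ × ℝ => k (z.1 - z.2)) (μ01.prod μ01) :=
    (hkc.comp (continuous_fst.sub continuous_snd)).aestronglyMeasurable
  have hkn : ∀ᵐ z ∂(μ01.prod μ01), ‖k (z.1 - z.2)‖ ≤ B := Eventually.of_forall fun z => by
    rw [Real.norm_eq_abs, abs_of_nonneg (hk0 _)]; exact hkB _
  have hA : Integrable (fun z : ℝ × ℝ => ‖f z.1‖ ^ 2 * k (z.1 - z.2)) (μ01.prod μ01) :=
    (hfsq.comp_fst μ01).mul_bdd hkp hkn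
  have hA' : Integrable (fun z : ℝ × ℝ => ‖f z.2‖ ^ 2 * k (z.1 - z.2)) (μ01.prod μ01) :=
    (hfsq.comp_snd μ01).mul_bdd hkp hkn
  refine (norm_integral_le_of_norm_le (g := fun z => (1/2) * (‖f z.1‖ ^ 2 * k (z.1 - z.2)) +
    (1/2) * (‖f z.2‖ ^ 2 * k (z.1 - z.2))) ((hA.const_mul _).add (hA'.const_mul _))
    (Eventually.of_forall fun z => ?_)).trans ?_
  · rw [← mul_sub, norm_mul, norm_mul, RCLike.norm_conj]
    have : ‖f z.1‖ * ‖f z.2‖ ≤ (1/2) * ‖f z.1‖ ^ 2 + (1/2) * ‖f z.2‖ ^ 2 := by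
      nlinarith [sq_nonneg (‖f z.1‖ - ‖f z.2‖)]
    have := mul_le_mul_of_nonneg_right this (hk0 (z.1 - z.2))
    simp only [hk] at this ⊢
    linarith
  · rw [integral_add (hA.const_mul _) (hA'.const_mul _), integral_const_mul, integral_const_mul]
    have b1 : ∫ z : ℝ × ℝ, ‖f z.1‖ ^ 2 * k (z.1 - z.2) ∂(μ01.prod μ01) ≤
        (∫ u in (-1:ℝ)..1, k u) * ∫ s, ‖f s‖ ^ 2 ∂μ01 := by
      rw [integral_prod _ hA, ← integral_const_mul]
      refine integral_mono_ae hA.integral_prod_left (hfsq.const_mul _) ?_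
      filter_upwards [ae_mu01_mem] with s hs
      rw [integral_const_mul, mul_comm]
      exact mul_le_mul_of_nonneg_right (shift_int_le hkc hk0 ⟨hs.1.le, hs.2.le⟩) (sq_nonneg _)
    have b2 : ∫ z : ℝ × ℝ, ‖f z.2‖ ^ 2 * k (z.1 - z.2) ∂(μ01.prod μ01) ≤
        (∫ u in (-1:ℝ)..1, k u) * ∫ s, ‖f s‖ ^ 2 ∂μ01 := by
      rw [integral_prod_symm _ hA', ← integral_const_mul]
      refine integral_mono_ae hA'.integral_prod_right (hfsq.const_mul _) ?_
      filter_upwards [ae_mu01_mem] with s hs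
      rw [integral_const_mul, mul_comm]
      exact mul_le_mul_of_nonneg_right (shift_int_le' hkc hk0 ⟨hs.1.le, hs.2.le⟩) (sq_nonneg _)
    linarith

/-- the functional `f ↦ ∫ f e^{iws}` on `L²`. -/
lemma exists_ell (w : ℝ) : ∃ T : Lp ℂ 2 μ01 →L[ℂ] ℂ, ∀ f : Lp ℂ 2 μ01, T f = ∫ s, f s * ex w s ∂μ01 := by
  have hm : MemLp (fun s => ex w (-s)) 2 μ01 :=
    MemLp.of_bound (by have := (continuous_ex w).comp continuous_neg; exact this.aestronglyMeasurable) 1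
      (Eventually.of_forall fun s => (norm_ex _ _).le)
  refine ⟨innerSL ℂ hm.toLp, fun f => ?_⟩
  rw [innerSL_apply_apply, L2.inner_def]
  refine integral_congr_ae ?_
  filter_upwards [hm.coeFn_toLp] with s hs
  rw [hs, ← conj_ex]
  simp

lemma L2_norm_sq (f : Lp ℂ 2 μ01) : ‖f‖ ^ 2 = ∫ s, ‖f s‖ ^ 2 ∂μ01 := by
  have h := inner_self_eq_norm_sq_to_K (𝕜 := ℂ) f
  rw [L2.inner_def] at h
  have h2 : ∀ s, inner ℂ (f s) (f s) = ((‖f s‖ ^ 2 : ℝ) : ℂ) := by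
    intro s; rw [inner_self_eq_norm_sq_to_K]; push_cast; rfl
  simp only [h2] at h
  rw [integral_complex_ofReal] at h
  exact Complex.ofReal_injective (by rw [h]; push_cast; rfl)

/-- the weighted partial sums -/
def esN (lam al wt : ℤ → ℝ) (N : ℕ) : ES where
  ι := ↥(Finset.Icc (-(N:ℤ)) (N:ℤ)) ⊕ ↥(Finset.Icc (-(N:ℤ)) (N:ℤ))
  c := Sum.elim (fun n => wt n * al n) (fun n => - wt n)
  w := Sum.elim (fun n => -(2 * lam n)) (fun n => -(Real.pi * (2 * ((n:ℤ):ℝ) + 1)))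

lemma esN_h (lam al wt : ℤ → ℝ) (N : ℕ) (u : ℝ) : (esN lam al wt N).h u =
    ∑ n ∈ Finset.Icc (-(N:ℤ)) (N:ℤ), (wt n : ℂ) * ((al n : ℂ) * ex (-(2 * lam n)) u - ex (-(Real.pi * (2 * (n:ℝ) + 1))) u) := by
  unfold ES.h
  change ∑ j : ↥(Finset.Icc (-(N:ℤ)) (N:ℤ)) ⊕ ↥(Finset.Icc (-(N:ℤ)) (N:ℤ)), _ = _
  rw [Fintype.sum_sum_type]
  simp only [esN, Sum.elim_inl, Sum.elim_inr]
  rw [Finset.sum_coe_sort (Finset.Icc (-(N:ℤ)) (N:ℤ)) (fun n => ((wt n * al n : ℝ) : ℂ) * ex (-(2 * lam n)) u),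
    Finset.sum_coe_sort (Finset.Icc (-(N:ℤ)) (N:ℤ)) (fun n => ((- wt n : ℝ) : ℂ) * ex (-(Real.pi * (2 * (n:ℝ) + 1))) u),
    ← Finset.sum_add_distrib]
  refine Finset.sum_congr rfl fun n _ => ?_
  push_cast; ring

lemma esN_q (lam al wt : ℤ → ℝ) (N : ℕ) (f : ℝ → ℂ) : (esN lam al wt N).q f =
    (∑ n ∈ Finset.Icc (-(N:ℤ)) (N:ℤ), wt n * al n * ‖FT f (lam n)‖ ^ 2) -
    ∑ n ∈ Finset.Icc (-(N:ℤ)) (N:ℤ), wt n * ‖FT f (Real.pi * (n + 1/2))‖ ^ 2 := by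
  unfold ES.q
  change ∑ j : ↥(Finset.Icc (-(N:ℤ)) (N:ℤ)) ⊕ ↥(Finset.Icc (-(N:ℤ)) (N:ℤ)), _ = _
  rw [Fintype.sum_sum_type]
  have e1 : ∀ n : ↥(Finset.Icc (-(N:ℤ)) (N:ℤ)), (esN lam al wt N).coef f (Sum.inl n) = FT f (lam n) := by
    intro n
    unfold ES.coef FT ex
    congr 1; funext s; simp only [esN, Sum.elim_inl]; congr 2; push_cast; ring
  have e2 : ∀ n : ↥(Finset.Icc (-(N:ℤ)) (N:ℤ)), (esN lam al wt N).coef f (Sum.inr n) = FT f (Real.pi * (((n:ℤ):ℝ) + 1/2)) := by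
    intro n
    unfold ES.coef FT ex
    congr 1; funext s; simp only [esN, Sum.elim_inr]; congr 2; push_cast; ring
  simp only [e1, e2]
  simp only [esN, Sum.elim_inl, Sum.elim_inr]
  rw [Finset.sum_coe_sort (Finset.Icc (-(N:ℤ)) (N:ℤ)) (fun n => wt n * al n * ‖FT f (lam n)‖ ^ 2),
    Finset.sum_coe_sort (Finset.Icc (-(N:ℤ)) (N:ℤ)) (fun n => (- wt n) * ‖FT f (Real.pi * ((n:ℝ) + 1/2))‖ ^ 2)]
  simp only [neg_mul, Finset.sum_neg_distrib, sub_eq_add_neg]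

lemma FT_lattice (m n : ℤ) : FT (fun s => cexp (2 * I * (Real.pi * (m + 1/2)) * s)) (Real.pi * (n + 1/2)) =
    if m = n then 1 else 0 := by
  unfold FT
  rw [integral_mu01]
  have e : ∀ s : ℝ, cexp (2 * I * (Real.pi * (m + 1/2)) * s) * cexp (-(2 * I * (Real.pi * (n + 1/2) : ℝ) * s)) =
      cexp ((2 * Real.pi * I * (m - n)) * s) := by
    intro s; rw [← Complex.exp_add]; congr 1; push_cast; ring
  simp only [e]
  split_ifs with h
  · subst h; simp
  · have hne : (2 * Real.pi * I * (m - n) : ℂ) ≠ 0 := by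
      have : ((m:ℂ) - n) ≠ 0 := by rw [sub_ne_zero]; exact_mod_cast h
      have hpi : (Real.pi : ℂ) ≠ 0 := by exact_mod_cast Real.pi_ne_zero
      simp [this, hpi]
    rw [integral_exp_mul_complex hne]
    have : cexp (2 * Real.pi * I * (m - n) * (1:ℝ)) = 1 := by
      rw [Complex.exp_eq_one_iff]; exact ⟨m - n, by push_cast; ring⟩
    rw [this]; simp

theorem coer_main {p : ℝ≥0∞} (hp : 1 ≤ p) {lam al : ℤ → ℝ} (hm : StrictMono lam) (hlam : LamAsymp p lam)
    (hal : (∀ n, 0 < al n) ∨ (∀ n, al n = 0)) (wt : ℕ → ℤ → ℝ) (w0 : ∀ N n, 0 ≤ wt N n) (w1 : ∀ N n, wt N n ≤ 1)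
    (wl : ∀ n, Tendsto (fun N => wt N n) atTop (nhds 1))
    (hC : ∀ ε > 0, ∃ n0 : ℕ, ∀ n ≥ n0, ∀ m ≥ n0,
      ∫ u in (-1:ℝ)..1, ‖(esN lam al (wt n) n).h u - (esN lam al (wt m) m).h u‖ ≤ ε) :
    (∀ n, 0 < al n) ∧ ∃ δ > 0, ∃ n0 : ℕ, ∀ n ≥ n0, Coer (esN lam al (wt n) n) δ := by
  classical
  set E : ℕ → ES := fun n => esN lam al (wt n) n with hE
  choose ell hell using exists_ell
  have hal0 : ∀ n, 0 ≤ al n := by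
    rcases hal with h | h
    · exact fun n => (h n).le
    · exact fun n => (h n).ge
  have hq : ∀ (n : ℕ) (f : Lp ℂ 2 μ01), ∑ j, (E n).c j * ‖ell ((E n).w j) f‖ ^ 2 = (E n).q f := by
    intro n f
    unfold ES.q ES.coef
    simp only [hell]
  -- lower bound
  have hlow : ∀ (n : ℕ) (f : ℝ → ℂ), MemLp f 2 μ01 → ∀ k : ℤ, k ∈ Finset.Icc (-(n:ℤ)) (n:ℤ) →
      wt n k * al k * ‖FT f (lam k)‖ ^ 2 ≤ (∫ s, ‖f s‖ ^ 2 ∂μ01) + (E n).q f := by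
    intro n f hf k hk
    simp only [hE]
    rw [esN_q]
    have h1 : ∑ n_1 ∈ Finset.Icc (-(n:ℤ)) (n:ℤ), wt n n_1 * ‖FT f (Real.pi * (n_1 + 1/2))‖ ^ 2 ≤ ∫ s, ‖f s‖ ^ 2 ∂μ01 := by
      refine le_trans (Finset.sum_le_sum fun i _ => ?_) (sum_le_hasSum (Finset.Icc (-(n:ℤ)) (n:ℤ)) (fun _ _ => sq_nonneg _) (parseval_FT hf))
      exact mul_le_of_le_one_left (sq_nonneg _) (w1 n i)
    have h2 := Finset.single_le_sum (f := fun k => wt n k * al k * ‖FT f (lam k)‖ ^ 2)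
      (fun i _ => mul_nonneg (mul_nonneg (w0 n i) (hal0 i)) (sq_nonneg _)) hk
    linarith
  have hmem : ∀ (k : ℤ) (n : ℕ), k.natAbs ≤ n → k ∈ Finset.Icc (-(n:ℤ)) (n:ℤ) := by
    intro k n h; rw [Finset.mem_Icc]; omega
  have hQc : ∀ f : Lp ℂ 2 μ01, ∃ L, Tendsto (fun n => ‖f‖ ^ 2 + (E n).q f) atTop (nhds L) := by
    intro f
    refine cauchySeq_tendsto_of_complete ?_
    rw [Metric.cauchySeq_iff]
    intro ε hε
    obtain ⟨n0, hn0⟩ := hC (ε / (‖f‖ ^ 2 + 1)) (by positivity)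
    refine ⟨n0, fun n hn m hm => ?_⟩
    rw [Real.dist_eq, add_sub_add_left_eq_sub]
    refine ((E n).quad_diff (E m) (Lp.memLp f)).trans_lt ?_
    rw [← L2_norm_sq]
    refine (mul_le_mul_of_nonneg_right (hn0 n hn m hm) (sq_nonneg _)).trans_lt ?_
    rw [div_mul_eq_mul_div, div_lt_iff₀ (by positivity)]
    nlinarith
  choose Q hQ using hQc
  have hform : QForm (fun n => (E n).ι) (fun n => (E n).c) (fun n j => ell ((E n).w j)) Q := by
    constructor
    · intro ε hε
      obtain ⟨n0, hn0⟩ := hC ε hε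
      refine ⟨n0, fun n hn f => ?_⟩
      rw [hq]
      have := ((hQ f).sub_const (‖f‖ ^ 2 + (E n).q f)).abs
      refine le_of_tendsto this ?_
      filter_upwards [eventually_ge_atTop n0] with m hm
      rw [add_sub_add_left_eq_sub]
      refine ((E m).quad_diff (E n) (Lp.memLp f)).trans ?_
      rw [← L2_norm_sq]
      exact mul_le_mul_of_nonneg_right (hn0 m hm n hn) (sq_nonneg _)
    · intro f
      refine ge_of_tendsto (hQ f) (Eventually.of_forall fun n => ?_)
      have := hlow n f (Lp.memLp f) 0 (hmem 0 n (by simp))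
      rw [← L2_norm_sq] at this
      exact le_trans (mul_nonneg (mul_nonneg (w0 n 0) (hal0 0)) (sq_nonneg _)) this
  have hpos : ∀ n, 0 < al n := by
    rcases hal with h | h
    · exact h
    exfalso
    have hem : ∀ k : ℕ, MemLp (fun s : ℝ => cexp (2 * I * (Real.pi * ((k:ℤ) + 1/2)) * s)) 2 μ01 := by
      intro k
      refine MemLp.of_bound (by fun_prop) 1 (Eventually.of_forall fun s => ?_)
      have : (2 * I * (Real.pi * ((k:ℤ) + 1/2)) * s : ℂ) = ((2 * (Real.pi * (k + 1/2)) * s : ℝ) : ℂ) * I := by push_cast; ring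
      rw [this, Complex.norm_exp_ofReal_mul_I]
    set e : ℕ → Lp ℂ 2 μ01 := fun k => (hem k).toLp with he
    have hFT : ∀ (k : ℕ) (n : ℤ), FT (e k) (Real.pi * (n + 1/2)) = if (k:ℤ) = n then 1 else 0 := by
      intro k n
      rw [← FT_lattice]
      unfold FT
      refine integral_congr_ae ?_
      filter_upwards [(hem k).coeFn_toLp] with s hs
      simp only [he]
      rw [hs]
    have hen : ∀ k, ‖e k‖ ^ 2 = 1 := by
      intro k
      rw [L2_norm_sq]
      have := parseval_FT (Lp.memLp (e k))
      refine this.unique ?_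
      have h2 := hasSum_ite_eq (k:ℤ) (1:ℝ)
      convert h2 using 2 with n
      rw [hFT]
      by_cases hkn : (k:ℤ) = n
      · simp [hkn]
      · simp [hkn, Ne.symm hkn]
    have hQe : ∀ k, Q (e k) = 0 := by
      intro k
      refine tendsto_nhds_unique (hQ (e k)) ?_
      have : Tendsto (fun N => 1 - wt N k) atTop (nhds (1 - 1)) := (wl k).const_sub 1
      rw [sub_self] at this
      refine this.congr' ?_
      filter_upwards [eventually_ge_atTop k] with N hN
      simp only [hE]
      rw [esN_q, hen]
      simp only [h, mul_zero, zero_mul, Finset.sum_const_zero, zero_sub, hFT]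
      rw [← sub_eq_add_neg]
      congr 1
      rw [Finset.sum_eq_single (k:ℤ)]
      · simp
      · intro b _ hb; simp [hb.symm]
      · intro hk; exact absurd (hmem k N (by simpa using hN)) hk
    have hen1 : ∀ k, ‖e k‖ ≤ 1 := fun k => by nlinarith [hen k, norm_nonneg (e k)]
    obtain ⟨s, hs, hc⟩ := hform.lemA e 1 hen1 (by simp only [hQe]; exact tendsto_const_nhds)
    rw [Metric.cauchySeq_iff] at hc
    obtain ⟨N, hN⟩ := hc 1 one_pos
    have h1 := hN N le_rfl (N+1) (Nat.le_succ N)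
    rw [dist_eq_norm] at h1
    simp only [Function.comp] at h1
    have hs1 : s N < s (N+1) := hs (Nat.lt_succ_self N)
    set g := e (s N) - e (s (N+1)) with hg
    have h2 := sum_le_hasSum {((s N : ℕ):ℤ)} (fun _ _ => sq_nonneg _) (parseval_FT (Lp.memLp g))
    rw [← L2_norm_sq, Finset.sum_singleton] at h2
    have h3 : FT g (Real.pi * (((s N : ℕ):ℤ) + 1/2)) = 1 := by
      have : FT g (Real.pi * (((s N : ℕ):ℤ) + 1/2)) = FT (e (s N)) (Real.pi * (((s N : ℕ):ℤ) + 1/2)) - FT (e (s (N+1))) (Real.pi * (((s N : ℕ):ℤ) + 1/2)) := by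
        unfold FT
        rw [← integral_sub (integrable_FT ((Lp.memLp (e (s N))).integrable (by norm_num)) _) (integrable_FT ((Lp.memLp (e (s (N+1)))).integrable (by norm_num)) _)]
        refine integral_congr_ae ?_
        filter_upwards [Lp.coeFn_sub (e (s N)) (e (s (N+1)))] with t ht
        rw [hg, ht]; simp only [Pi.sub_apply]; ring
      rw [this, hFT, hFT, if_pos rfl, if_neg (by omega), sub_zero]
    rw [h3] at h2
    norm_num at h2
    nlinarith [norm_nonneg g]
  refine ⟨hpos, ?_⟩
  obtain ⟨δ, hδ, n0, hn0⟩ := hform.coer (by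
    intro f hf
    have hz : ∀ k, FT f (lam k) = 0 := by
      intro k
      have h1 : al k * ‖FT f (lam k)‖ ^ 2 ≤ 0 := by
        rw [← hf]
        have ht : Tendsto (fun n => wt n k * al k * ‖FT f (lam k)‖ ^ 2) atTop (nhds (1 * al k * ‖FT f (lam k)‖ ^ 2)) :=
          ((wl k).mul_const _).mul_const _
        rw [one_mul] at ht
        refine le_of_tendsto_of_tendsto ht (hQ f) ?_
        filter_upwards [eventually_ge_atTop k.natAbs] with n hn
        rw [L2_norm_sq]
        exact hlow n f (Lp.memLp f) k (hmem k n hn)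
      have h2 : ‖FT f (lam k)‖ ^ 2 ≤ 0 := by
        by_contra h; push Not at h
        exact absurd h1 (not_le.2 (mul_pos (hpos k) h))
      have h3 : ‖FT f (lam k)‖ = 0 := by nlinarith [norm_nonneg (FT f (lam k))]
      exact norm_eq_zero.1 h3
    have := completeness hp hm hlam (Lp.memLp f) hz
    exact (Lp.eq_zero_iff_ae_eq_zero).2 this)
  refine ⟨δ, hδ, n0, fun n hn f hf => ?_⟩
  have h1 := hn0 n hn hf.toLp
  rw [hq, L2_norm_sq] at h1
  have e1 : ∫ s, ‖hf.toLp f s‖ ^ 2 ∂μ01 = ∫ s, ‖f s‖ ^ 2 ∂μ01 := by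
    refine integral_congr_ae ?_
    filter_upwards [hf.coeFn_toLp] with s hs
    rw [hs]
  have e2 : (E n).q (hf.toLp f) = (E n).q f := by
    unfold ES.q ES.coef
    refine Finset.sum_congr rfl fun j _ => ?_
    congr 3
    refine integral_congr_ae ?_
    filter_upwards [hf.coeFn_toLp] with s hs
    rw [hs]
  rwa [e1, e2] at h1

local notation "cj" => (starRingEnd ℂ)

lemma ind_int {E : Type*} [NormedAddCommGroup E] [NormedSpace ℝ E] {x : ℝ} (hx : x ∈ Icc (0:ℝ) 1) (F : ℝ → E) :
    ∫ s, (Ioc 0 x).indicator F s ∂μ01 = ∫ s in (0:ℝ)..x, F s := by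
  rw [integral_indicator measurableSet_Ioc, mu01_eq, Measure.restrict_restrict measurableSet_Ioc,
    intervalIntegral.integral_of_le hx.1, inter_eq_self_of_subset_left (Ioc_subset_Ioc_right hx.2)]

/-- bounded measurable on `(0,x]` -/
def BM (x : ℝ) (f : ℝ → ℂ) : Prop := AEStronglyMeasurable f (volume.restrict (Ioc 0 x)) ∧ ∃ C, ∀ t, ‖f t‖ ≤ C

lemma BM.ii {x : ℝ} (hx : 0 ≤ x) {f : ℝ → ℂ} (h : BM x f) : IntervalIntegrable f volume 0 x := by
  obtain ⟨h1, C, h2⟩ := h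
  rw [intervalIntegrable_iff_integrableOn_Ioc_of_le hx]
  exact Integrable.of_bound h1 C (Eventually.of_forall h2)

lemma ii_mul_ex {x : ℝ} {f : ℝ → ℂ} (h : IntervalIntegrable f volume 0 x) (w : ℝ) :
    IntervalIntegrable (fun s => f s * ex w s) volume 0 x :=
  h.mul_continuousOn (continuous_ex w).continuousOn

lemma continuous_cj : Continuous (fun z : ℂ => cj z) := Complex.continuous_conj

lemma ii_cj {a b : ℝ} {f : ℝ → ℂ} (h : IntervalIntegrable f volume a b) :
    IntervalIntegrable (fun s => cj (f s)) volume a b :=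
  ⟨integrable_conj h.1, integrable_conj h.2⟩

lemma int_cj {a b : ℝ} (f : ℝ → ℂ) : ∫ s in a..b, cj (f s) = cj (∫ s in a..b, f s) := by
  simp only [intervalIntegral, integral_conj, map_sub]

def ES.co (E : ES) (x : ℝ) (f : ℝ → ℂ) (j : E.ι) : ℂ := ∫ s in (0:ℝ)..x, f s * ex (E.w j) s

/-- `-Σ c_k v_k conj e_k(t)` -/
def ES.trig (E : ES) (v : E.ι → ℂ) (t : ℝ) : ℂ := -∑ k, (E.c k : ℂ) * v k * cj (ex (E.w k) t)

lemma ES.continuous_trig (E : ES) (v : E.ι → ℂ) : Continuous (E.trig v) := by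
  unfold ES.trig
  refine (continuous_finsetSum _ fun k _ => ?_).neg
  exact continuous_const.mul (continuous_cj.comp (continuous_ex _))

lemma ES.norm_trig_le (E : ES) (v : E.ι → ℂ) (t : ℝ) : ‖E.trig v t‖ ≤ ∑ k, |E.c k| * ‖v k‖ := by
  unfold ES.trig
  rw [norm_neg]
  refine (norm_sum_le _ _).trans (Finset.sum_le_sum fun j _ => ?_)
  rw [norm_mul, norm_mul, RCLike.norm_conj, norm_ex, mul_one, Complex.norm_real, Real.norm_eq_abs]

lemma ES.BM_trig (E : ES) (v : E.ι → ℂ) (x : ℝ) : BM x (E.trig v) :=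
  ⟨(E.continuous_trig v).aestronglyMeasurable, _, E.norm_trig_le v⟩

lemma BM.sub {x : ℝ} {f g : ℝ → ℂ} (hf : BM x f) (hg : BM x g) : BM x (fun t => f t - g t) := by
  obtain ⟨h1, C, h2⟩ := hf
  obtain ⟨h1', C', h2'⟩ := hg
  exact ⟨h1.sub h1', C + C', fun t => (norm_sub_le _ _).trans (add_le_add (h2 t) (h2' t))⟩

lemma BM.add {x : ℝ} {f g : ℝ → ℂ} (hf : BM x f) (hg : BM x g) : BM x (fun t => f t + g t) := by
  obtain ⟨h1, C, h2⟩ := hf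
  obtain ⟨h1', C', h2'⟩ := hg
  exact ⟨h1.add h1', C + C', fun t => (norm_add_le _ _).trans (add_le_add (h2 t) (h2' t))⟩

def ES.A (E : ES) (x : ℝ) : Matrix E.ι E.ι ℂ := fun j k => ∫ s in (0:ℝ)..x, ex (E.w j) s * cj (ex (E.w k) s)

def ES.Mx (E : ES) (x : ℝ) : Matrix E.ι E.ι ℂ := 1 + E.A x * Matrix.diagonal (fun k => (E.c k : ℂ))

lemma ES.Mx_mulVec (E : ES) (x : ℝ) (v : E.ι → ℂ) (j : E.ι) : (E.Mx x).mulVec v j = v j + ∑ k, E.A x j k * ((E.c k : ℂ) * v k) := by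
  unfold ES.Mx
  rw [Matrix.add_mulVec, Matrix.one_mulVec, ← Matrix.mulVec_mulVec]
  simp only [Pi.add_apply, Matrix.mulVec, dotProduct, Matrix.diagonal_apply]
  congr 1
  refine Finset.sum_congr rfl fun k _ => ?_
  congr 1
  simp

lemma ES.co_trig (E : ES) (x : ℝ) (v : E.ι → ℂ) (j : E.ι) : E.co x (E.trig v) j = v j - (E.Mx x).mulVec v j := by
  rw [E.Mx_mulVec]
  unfold ES.co ES.trig ES.A
  have : ∀ s, (-∑ k, (E.c k : ℂ) * v k * cj (ex (E.w k) s)) * ex (E.w j) s =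
      ∑ k, (-((E.c k : ℂ) * v k)) * (ex (E.w j) s * cj (ex (E.w k) s)) := by
    intro s
    rw [neg_mul, Finset.sum_mul, ← Finset.sum_neg_distrib]
    refine Finset.sum_congr rfl fun k _ => by ring
  simp only [this]
  rw [intervalIntegral.integral_finsetSum]
  · simp only [intervalIntegral.integral_const_mul]
    rw [sub_add_cancel_left, ← Finset.sum_neg_distrib]
    refine Finset.sum_congr rfl fun k _ => by ring
  · intro k _
    refine Continuous.intervalIntegrable ?_ _ _
    exact continuous_const.mul ((continuous_ex _).mul (continuous_cj.comp (continuous_ex _)))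

lemma ES.conv_h (E : ES) {x : ℝ} {f : ℝ → ℂ} (hf : IntervalIntegrable f volume 0 x) (t : ℝ) :
    ∫ s in (0:ℝ)..x, f s * E.h (s - t) = - E.trig (E.co x f) t := by
  unfold ES.trig ES.h ES.co
  have : ∀ s, f s * ∑ j, (E.c j : ℂ) * ex (E.w j) (s - t) =
      ∑ j, ((E.c j : ℂ) * cj (ex (E.w j) t)) * (f s * ex (E.w j) s) := by
    intro s
    rw [Finset.mul_sum]
    refine Finset.sum_congr rfl fun k _ => by rw [ex_sub]; ring
  simp only [this]
  rw [intervalIntegral.integral_finsetSum, neg_neg]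
  · simp only [intervalIntegral.integral_const_mul]
    refine Finset.sum_congr rfl fun k _ => by ring
  · intro k _
    exact (ii_mul_ex hf _).const_mul _

lemma ES.int_cj_trig (E : ES) {x : ℝ} {f : ℝ → ℂ} (hf : IntervalIntegrable f volume 0 x) (v : E.ι → ℂ) :
    ∫ s in (0:ℝ)..x, f s * cj (E.trig v s) = -∑ j, (E.c j : ℂ) * cj (v j) * E.co x f j := by
  unfold ES.trig ES.co
  have : ∀ s, f s * cj (-∑ k, (E.c k : ℂ) * v k * cj (ex (E.w k) s)) =
      ∑ j, (-((E.c j : ℂ) * cj (v j))) * (f s * ex (E.w j) s) := by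
    intro s
    rw [map_neg, map_sum, mul_neg, Finset.mul_sum, ← Finset.sum_neg_distrib]
    refine Finset.sum_congr rfl fun k _ => ?_
    rw [map_mul, map_mul, Complex.conj_conj, Complex.conj_ofReal]; ring
  simp only [this]
  rw [intervalIntegral.integral_finsetSum]
  · simp only [intervalIntegral.integral_const_mul]
    rw [← Finset.sum_neg_distrib]
    refine Finset.sum_congr rfl fun k _ => by ring
  · intro k _
    exact (ii_mul_ex hf _).const_mul _

lemma Coer.on {E : ES} {δ : ℝ} (hE : Coer E δ) {x : ℝ} (hx : x ∈ Icc (0:ℝ) 1) {f : ℝ → ℂ} (hf : BM x f) :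
    δ * ∫ s in (0:ℝ)..x, ‖f s‖ ^ 2 ≤ (∫ s in (0:ℝ)..x, ‖f s‖ ^ 2) + ∑ j, E.c j * ‖E.co x f j‖ ^ 2 := by
  obtain ⟨h1, C, h2⟩ := hf
  have hm : MemLp ((Ioc 0 x).indicator f) 2 μ01 := by
    refine MemLp.of_bound ?_ (max C 0) (Eventually.of_forall fun t => ?_)
    · rw [aestronglyMeasurable_indicator_iff measurableSet_Ioc, mu01_eq, Measure.restrict_restrict measurableSet_Ioc,
        inter_eq_self_of_subset_left (Ioc_subset_Ioc_right hx.2)]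
      exact h1
    · by_cases ht : t ∈ Ioc 0 x
      · rw [indicator_of_mem ht]; exact (h2 t).trans (le_max_left _ _)
      · rw [indicator_of_notMem ht, norm_zero]; exact le_max_right _ _
  have h := hE _ hm
  have e1 : ∫ s, ‖(Ioc 0 x).indicator f s‖ ^ 2 ∂μ01 = ∫ s in (0:ℝ)..x, ‖f s‖ ^ 2 := by
    rw [← ind_int hx]
    congr 1; funext s
    by_cases ht : s ∈ Ioc 0 x
    · simp only [indicator_of_mem ht]
    · simp [indicator_of_notMem ht]
  have e2 : ∀ j, E.coef ((Ioc 0 x).indicator f) j = E.co x f j := by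
    intro j
    unfold ES.coef ES.co
    rw [← ind_int hx]
    congr 1; funext s
    by_cases ht : s ∈ Ioc 0 x
    · simp only [indicator_of_mem ht]
    · simp [indicator_of_notMem ht]
  unfold ES.q at h
  simp only [e1, e2] at h
  exact h

lemma ES.energy (E : ES) {x : ℝ} (hx : 0 ≤ x) {f : ℝ → ℂ} (hf : BM x f) :
    (((∫ s in (0:ℝ)..x, ‖f s‖ ^ 2) + ∑ j, E.c j * ‖E.co x f j‖ ^ 2 : ℝ) : ℂ) =
    ∫ s in (0:ℝ)..x, f s * cj (f s + ∫ r in (0:ℝ)..x, f r * E.h (r - s)) := by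
  have hi := hf.ii hx
  have hii : IntervalIntegrable (fun s => f s * cj (f s)) volume 0 x := by
    obtain ⟨h1, C, h2⟩ := hf
    have : BM x (fun s => f s * cj (f s)) := by
      refine ⟨h1.mul (continuous_cj.comp_aestronglyMeasurable h1), C * C, fun t => ?_⟩
      rw [norm_mul, RCLike.norm_conj]
      exact mul_le_mul (h2 t) (h2 t) (norm_nonneg _) ((norm_nonneg _).trans (h2 t))
    exact this.ii hx
  simp only [E.conv_h hi, map_add, map_neg, mul_add, mul_neg]
  have hii2 : IntervalIntegrable (fun s => -(f s * cj (E.trig (E.co x f) s))) volume 0 x := by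
    exact (hi.mul_continuousOn (continuous_cj.comp (E.continuous_trig _)).continuousOn).neg
  rw [intervalIntegral.integral_add hii hii2, intervalIntegral.integral_neg, E.int_cj_trig hi]
  have e : ∀ s, f s * cj (f s) = ((‖f s‖ ^ 2 : ℝ) : ℂ) := fun s => by
    rw [Complex.mul_conj, Complex.normSq_eq_norm_sq]
  simp only [e]
  rw [intervalIntegral.integral_ofReal]
  push_cast
  congr 1
  rw [neg_neg]
  refine Finset.sum_congr rfl fun j _ => ?_
  rw [mul_assoc, mul_comm (cj _), Complex.mul_conj, Complex.normSq_eq_norm_sq]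
  push_cast; rfl

lemma Coer.det_ne {E : ES} {δ : ℝ} (hδ : 0 < δ) (hE : Coer E δ) {x : ℝ} (hx : x ∈ Icc (0:ℝ) 1) : (E.Mx x).det ≠ 0 := by
  intro h0
  obtain ⟨v, hv, hM⟩ := Matrix.exists_mulVec_eq_zero_iff.2 h0
  have hco : E.co x (E.trig v) = v := by
    funext j; rw [E.co_trig, hM]; simp
  have hbm := E.BM_trig v x
  have h1 := hE.on hx hbm
  have h2 := E.energy hx.1 hbm
  have h3 : ∀ s, E.trig v s + ∫ r in (0:ℝ)..x, E.trig v r * E.h (r - s) = 0 := by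
    intro s; rw [E.conv_h (hbm.ii hx.1), hco]; simp
  simp only [h3, map_zero, mul_zero, intervalIntegral.integral_zero] at h2
  have h2' : (∫ s in (0:ℝ)..x, ‖E.trig v s‖ ^ 2) + ∑ j, E.c j * ‖E.co x (E.trig v) j‖ ^ 2 = 0 := by exact_mod_cast h2
  rw [h2'] at h1
  have h4 : ∫ s in (0:ℝ)..x, ‖E.trig v s‖ ^ 2 = 0 := by
    refine le_antisymm ?_ (intervalIntegral.integral_nonneg hx.1 fun _ _ => sq_nonneg _)
    by_contra h; push Not at h
    exact absurd h1 (not_le.2 (mul_pos hδ h))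
  have h5 : ∀ᵐ s ∂(volume.restrict (Ioc 0 x)), E.trig v s = 0 := by
    have := (intervalIntegral.integral_eq_zero_iff_of_le_of_nonneg_ae hx.1 (Eventually.of_forall fun _ => sq_nonneg _)
      (((E.continuous_trig v).norm.pow 2).intervalIntegrable _ _)).1 h4
    filter_upwards [this] with s hs
    simpa using hs
  apply hv
  rw [← hco]
  funext j
  unfold ES.co
  rw [intervalIntegral.integral_of_le hx.1, integral_congr_ae (g := fun _ => 0)]
  · simp
  · filter_upwards [h5] with s hs
    rw [hs, zero_mul]

/-- solving the finite rank equation -/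
lemma Coer.solve {E : ES} {δ : ℝ} (hδ : 0 < δ) (hE : Coer E δ) {x : ℝ} (hx : x ∈ Icc (0:ℝ) 1) {g : ℝ → ℂ} (hg : BM x g) :
    ∃ f : ℝ → ℂ, BM x f ∧ ∀ t, f t + ∫ r in (0:ℝ)..x, f r * E.h (r - t) = g t := by
  have hdet := hE.det_ne hδ hx
  set v := (E.Mx x)⁻¹.mulVec (E.co x g) with hv
  have hbm := E.BM_trig v x
  refine ⟨fun t => g t + E.trig v t, hg.add hbm, fun t => ?_⟩
  have hi := (hg.add hbm).ii hx.1
  rw [E.conv_h hi]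
  have : E.co x (fun t => g t + E.trig v t) = v := by
    funext j
    have h1 : E.co x (fun t => g t + E.trig v t) j = E.co x g j + E.co x (E.trig v) j := by
      unfold ES.co
      rw [← intervalIntegral.integral_add (ii_mul_ex (hg.ii hx.1) _) (ii_mul_ex (hbm.ii hx.1) _)]
      simp only [add_mul]
    rw [h1, E.co_trig, hv, Matrix.mulVec_mulVec, Matrix.mul_nonsing_inv _ (isUnit_iff_ne_zero.2 hdet), Matrix.one_mulVec]
    ring
  rw [this]; ring

def LB (E : ES) (M : ℝ) : Prop := ∀ x ∈ Icc (0:ℝ) 1, ∀ f : ℝ → ℂ, IntervalIntegrable f volume 0 x →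
  ∫ s in (0:ℝ)..x, ‖f s‖ ≤ M * ∫ t in (0:ℝ)..x, ‖f t + ∫ s in (0:ℝ)..x, f s * E.h (s - t)‖

lemma half_bound {u : ℝ → ℝ} {K : ℝ} (hb : ∃ C, ∀ t, u t ≤ C)
    (h : ∀ C, (∀ t, u t ≤ C) → ∀ t, u t ≤ K + C / 2) (t : ℝ) : u t ≤ 2 * K := by
  obtain ⟨C, hC⟩ := hb
  have hbdd : BddAbove (range u) := ⟨C, by rintro _ ⟨t, rfl⟩; exact hC t⟩
  have h1 : ∀ t, u t ≤ ⨆ s, u s := fun t => le_ciSup hbdd t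
  have h2 := ciSup_le (h _ h1)
  linarith [h1 t]

/-- sliding window integral bound -/
lemma window_le {k : ℝ → ℝ} (hk : IntervalIntegrable k volume (-1) 1) (hk0 : ∀ u, 0 ≤ k u) {x t : ℝ} (hx : x ∈ Icc (0:ℝ) 1) (ht : t ∈ Icc 0 x) :
    ∫ s in (0:ℝ)..x, k (s - t) ≤ ∫ u in (-1:ℝ)..1, k u := by
  rw [intervalIntegral.integral_comp_sub_right (fun u => k u) t]
  refine intervalIntegral.integral_mono_interval (by linarith [hx.2, ht.2]) (by linarith [hx.1]) (by linarith [hx.2, ht.1])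
    (Eventually.of_forall hk0) hk

lemma lb_of_coer {E E' : ES} {δ B : ℝ} (hδ : 0 < δ) (hE : Coer E δ) (hB : ∀ u, ‖E'.h u‖ ≤ B)
    (hd : ∫ u in (-1:ℝ)..1, ‖E.h u - E'.h u‖ ≤ 1/2) : LB E (2 * (1 + B / δ)) := by
  intro x hx f hf
  have hB0 : 0 ≤ B := (norm_nonneg _).trans (hB 0)
  -- sup bound for solutions
  have sup : ∀ g : ℝ → ℂ, AEStronglyMeasurable g (volume.restrict (Ioc 0 x)) → (∀ t, ‖g t‖ ≤ 1) →
      ∃ χ : ℝ → ℂ, BM x χ ∧ (∀ t, χ t + ∫ r in (0:ℝ)..x, χ r * E.h (r - t) = g t) ∧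
        ∀ t ∈ Icc 0 x, ‖χ t‖ ≤ 2 * (1 + B / δ) := by
    intro g hgm hg1
    obtain ⟨χ, hχ, hχe⟩ := hE.solve hδ hx ⟨hgm, 1, hg1⟩
    refine ⟨χ, hχ, hχe, ?_⟩
    have hχi := hχ.ii hx.1
    have hsq : IntervalIntegrable (fun s => ‖χ s‖ ^ 2) volume 0 x := by
      obtain ⟨h1, C, h2⟩ := hχ
      rw [intervalIntegrable_iff_integrableOn_Ioc_of_le hx.1]
      refine Integrable.of_bound (h1.norm.pow 2) (C ^ 2) (Eventually.of_forall fun t => ?_)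
      rw [norm_pow, norm_norm]; gcongr; exact h2 t
    have hI0 : 0 ≤ ∫ s in (0:ℝ)..x, ‖χ s‖ := intervalIntegral.integral_nonneg hx.1 fun _ _ => norm_nonneg _
    have hI : ∫ s in (0:ℝ)..x, ‖χ s‖ ≤ 1 / δ := by
      have h1 := hE.on hx hχ
      have h2 := E.energy hx.1 hχ
      simp only [hχe] at h2
      have h3 : (∫ s in (0:ℝ)..x, ‖χ s‖ ^ 2) + ∑ j, E.c j * ‖E.co x χ j‖ ^ 2 ≤ ∫ s in (0:ℝ)..x, ‖χ s‖ := by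
        refine ((le_abs_self _).trans_eq (by rw [← Real.norm_eq_abs, ← Complex.norm_real])).trans ?_
        rw [h2]
        refine intervalIntegral.norm_integral_le_of_norm_le hx.1 (Eventually.of_forall fun t _ => ?_) hχi.norm
        rw [norm_mul, RCLike.norm_conj]
        exact mul_le_of_le_one_right (norm_nonneg _) (hg1 t)
      have h4 := sq_integral_le hx.1 hχi.norm hsq
      have h5 : (∫ s in (0:ℝ)..x, ‖χ s‖) ^ 2 ≤ ∫ s in (0:ℝ)..x, ‖χ s‖ ^ 2 := by
        refine h4.trans ?_
        refine mul_le_of_le_one_left (intervalIntegral.integral_nonneg hx.1 fun _ _ => sq_nonneg _) (by linarith [hx.2])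
      set I1 := ∫ s in (0:ℝ)..x, ‖χ s‖
      rw [le_div_iff₀ hδ]
      by_contra hcon; push Not at hcon
      have hpos : 0 < I1 := by
        rcases hI0.eq_or_lt with h | h
        · rw [← h] at hcon; norm_num at hcon
        · exact h
      have h6 : δ * I1 ^ 2 ≤ I1 := (mul_le_mul_of_nonneg_left h5 hδ.le).trans (h1.trans h3)
      nlinarith
    -- iterate
    have key := half_bound (u := (Icc 0 x).indicator fun t => ‖χ t‖) (K := 1 + B / δ) (by
      obtain ⟨h1, C, h2⟩ := hχ
      refine ⟨C, fun t => ?_⟩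
      by_cases ht : t ∈ Icc 0 x
      · rw [indicator_of_mem ht]; exact h2 t
      · rw [indicator_of_notMem ht]; exact (norm_nonneg _).trans (h2 0)) (by
      intro C hC t
      have hC0 : 0 ≤ C := by
        refine le_trans ?_ (hC 0)
        exact indicator_nonneg (fun _ _ => norm_nonneg _) _
      by_cases ht : t ∈ Icc 0 x
      swap
      · rw [indicator_of_notMem ht]; positivity
      rw [indicator_of_mem ht]
      have e1 : χ t = g t - (∫ r in (0:ℝ)..x, χ r * (E.h (r - t) - E'.h (r - t))) - ∫ r in (0:ℝ)..x, χ r * E'.h (r - t) := by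
        rw [← hχe t]
        have hc : ∀ E : ES, Continuous fun r => E.h (r - t) := fun E => E.continuous_h.comp (continuous_id.sub continuous_const)
        have : ∫ r in (0:ℝ)..x, χ r * (E.h (r - t) - E'.h (r - t)) = (∫ r in (0:ℝ)..x, χ r * E.h (r - t)) - ∫ r in (0:ℝ)..x, χ r * E'.h (r - t) := by
          rw [← intervalIntegral.integral_sub (hχi.mul_continuousOn (hc E).continuousOn) (hχi.mul_continuousOn (hc E').continuousOn)]
          simp only [mul_sub]
        rw [this]; ring
      have hkc : Continuous fun u => ‖E.h u - E'.h u‖ := (E.continuous_h.sub E'.continuous_h).norm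
      have b1 : ‖∫ r in (0:ℝ)..x, χ r * (E.h (r - t) - E'.h (r - t))‖ ≤ C * (1/2) := by
        have : ∫ r in (0:ℝ)..x, C * ‖E.h (r - t) - E'.h (r - t)‖ ≤ C * (1/2) := by
          rw [intervalIntegral.integral_const_mul]
          exact mul_le_mul_of_nonneg_left ((window_le (hkc.intervalIntegrable _ _) (fun _ => norm_nonneg _) hx ht).trans hd) hC0
        refine le_trans (intervalIntegral.norm_integral_le_of_norm_le hx.1 (Eventually.of_forall fun r hr => ?_) ?_) this
        · rw [norm_mul]
          refine mul_le_mul_of_nonneg_right ?_ (norm_nonneg _)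
          have := hC r
          rwa [indicator_of_mem (Ioc_subset_Icc_self hr)] at this
        · refine Continuous.intervalIntegrable ?_ _ _
          exact continuous_const.mul (hkc.comp (continuous_id.sub continuous_const))
      have b2 : ‖∫ r in (0:ℝ)..x, χ r * E'.h (r - t)‖ ≤ B / δ := by
        have : ∫ r in (0:ℝ)..x, B * ‖χ r‖ ≤ B / δ := by
          rw [intervalIntegral.integral_const_mul, div_eq_mul_one_div]
          exact mul_le_mul_of_nonneg_left hI hB0
        refine le_trans (intervalIntegral.norm_integral_le_of_norm_le hx.1 (Eventually.of_forall fun r hr => ?_) ?_) this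
        · rw [norm_mul, mul_comm]
          exact mul_le_mul_of_nonneg_right (hB _) (norm_nonneg _)
        · exact hχi.norm.const_mul _
      rw [e1]
      refine (norm_sub_le _ _).trans ?_
      have := norm_sub_le (g t) (∫ r in (0:ℝ)..x, χ r * (E.h (r - t) - E'.h (r - t)))
      linarith [hg1 t])
    intro t ht
    have := key t
    rwa [indicator_of_mem ht] at this
  -- duality
  have hfm : AEStronglyMeasurable f (volume.restrict (Ioc 0 x)) := by
    rw [intervalIntegrable_iff_integrableOn_Ioc_of_le hx.1] at hf; exact hf.1
  obtain ⟨χ, hχ, hχe, hχb⟩ := sup (fun t => f t / (‖f t‖ : ℂ)) (by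
      have : AEMeasurable (fun t => (‖f t‖ : ℂ)) (volume.restrict (Ioc 0 x)) :=
        Complex.measurable_ofReal.comp_aemeasurable hfm.aemeasurable.norm
      exact (hfm.aemeasurable.div this).aestronglyMeasurable) (by
    intro t
    rw [norm_div, Complex.norm_real, norm_norm]
    exact div_self_le_one _)
  have hχi := hχ.ii hx.1
  set G : ℝ → ℂ := fun t => f t + ∫ s in (0:ℝ)..x, f s * E.h (s - t) with hG
  have hGe : ∀ t, G t = f t - E.trig (E.co x f) t := fun t => by simp only [hG]; rw [E.conv_h hf]; ring
  have hGi : IntervalIntegrable G volume 0 x := by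
    have : G = fun t => f t - E.trig (E.co x f) t := funext hGe
    rw [this]
    exact hf.sub ((E.continuous_trig _).intervalIntegrable _ _)
  have hfχ : IntervalIntegrable (fun s => f s * cj (χ s)) volume 0 x := by
    obtain ⟨h1, C, h2⟩ := hχ
    rw [intervalIntegrable_iff_integrableOn_Ioc_of_le hx.1] at hf ⊢
    refine hf.mul_bdd (c := C) (continuous_cj.comp_aestronglyMeasurable h1) (Eventually.of_forall fun t => ?_)
    rw [RCLike.norm_conj]; exact h2 t
  have hid : ∫ s in (0:ℝ)..x, (‖f s‖ : ℂ) = ∫ s in (0:ℝ)..x, G s * cj (χ s) := by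
    have e1 : ∀ s, (‖f s‖ : ℂ) = f s * cj (χ s) + -(f s * cj (E.trig (E.co x χ) s)) := by
      intro s
      have : f s * cj (f s / (‖f s‖ : ℂ)) = (‖f s‖ : ℂ) := by
        by_cases h : f s = 0
        · simp [h]
        · rw [map_div₀, Complex.conj_ofReal, ← mul_div_assoc, Complex.mul_conj, Complex.normSq_eq_norm_sq]
          have : (‖f s‖ : ℂ) ≠ 0 := by exact_mod_cast norm_ne_zero_iff.2 h
          push_cast
          field_simp
      rw [← this, ← hχe s, E.conv_h hχi, map_add, map_neg]; ring
    have e2 : ∀ s, G s * cj (χ s) = f s * cj (χ s) + -(cj (χ s * cj (E.trig (E.co x f) s))) := by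
      intro s
      rw [hGe, map_mul, Complex.conj_conj]; ring
    simp only [e1, e2]
    have hi1 : IntervalIntegrable (fun s => f s * cj (E.trig (E.co x χ) s)) volume 0 x :=
      hf.mul_continuousOn (continuous_cj.comp (E.continuous_trig _)).continuousOn
    have hi2 : IntervalIntegrable (fun s => χ s * cj (E.trig (E.co x f) s)) volume 0 x :=
      hχi.mul_continuousOn (continuous_cj.comp (E.continuous_trig _)).continuousOn
    have hi1n : IntervalIntegrable (fun s => -(f s * cj (E.trig (E.co x χ) s))) volume 0 x := hi1.neg
    have hi2n : IntervalIntegrable (fun s => -(cj (χ s * cj (E.trig (E.co x f) s)))) volume 0 x := (ii_cj hi2).neg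
    rw [intervalIntegral.integral_add hfχ hi1n, intervalIntegral.integral_add hfχ hi2n,
      intervalIntegral.integral_neg, intervalIntegral.integral_neg, int_cj, E.int_cj_trig hf, E.int_cj_trig hχi]
    congr 2
    rw [map_neg, map_sum]
    congr 1
    refine Finset.sum_congr rfl fun j _ => ?_
    rw [map_mul, map_mul, Complex.conj_conj, Complex.conj_ofReal]; ring
  rw [intervalIntegral.integral_ofReal] at hid
  have hn : ∫ s in (0:ℝ)..x, ‖f s‖ = ‖((∫ s in (0:ℝ)..x, ‖f s‖ : ℝ) : ℂ)‖ := by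
    rw [Complex.norm_real, Real.norm_eq_abs, abs_of_nonneg (intervalIntegral.integral_nonneg hx.1 fun _ _ => norm_nonneg _)]
  rw [hn, hid, ← intervalIntegral.integral_const_mul]
  refine intervalIntegral.norm_integral_le_of_norm_le hx.1 (Eventually.of_forall fun t ht => ?_) (hGi.norm.const_mul _)
  rw [norm_mul, RCLike.norm_conj, mul_comm]
  exact mul_le_mul_of_nonneg_right (hχb t (Ioc_subset_Icc_self ht)) (norm_nonneg _)

lemma diff_det {ι : Type} [Fintype ι] [DecidableEq ι] {M : ℝ → Matrix ι ι ℂ} {x : ℝ}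
    (h : ∀ i j, DifferentiableAt ℝ (fun y => M y i j) x) : DifferentiableAt ℝ (fun y => (M y).det) x := by
  simp only [Matrix.det_apply]
  refine DifferentiableAt.fun_sum fun σ _ => ?_
  refine DifferentiableAt.const_smul ?_ _
  exact DifferentiableAt.fun_finsetProd fun i _ => h _ _

lemma diff_adj {ι : Type} [Fintype ι] [DecidableEq ι] {M : ℝ → Matrix ι ι ℂ} {x : ℝ}
    (h : ∀ i j, DifferentiableAt ℝ (fun y => M y i j) x) (i j : ι) : DifferentiableAt ℝ (fun y => (M y).adjugate i j) x := by
  simp only [Matrix.adjugate_apply]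
  refine diff_det fun k l => ?_
  simp only [Matrix.updateRow_apply]
  by_cases hk : k = j
  · simp [hk]
  · simp only [hk, if_false]; exact h _ _

lemma hasDerivAt_ex (w x : ℝ) : HasDerivAt (ex w) (I * w * ex w x) x := by
  unfold ex
  have h1 : HasDerivAt (fun s : ℝ => (I * w * (s:ℂ))) (I * w) x := by
    simpa using (hasDerivAt_id x).ofReal_comp.const_mul (I * (w:ℂ))
  have := h1.cexp
  convert this using 1; ring

lemma ex_mul_cj (w x : ℝ) : ex w x * cj (ex w x) = 1 := by
  rw [Complex.mul_conj, Complex.normSq_eq_norm_sq, norm_ex]; simp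

lemma ES.hasDerivAt_A (E : ES) (x : ℝ) (j k : E.ι) :
    HasDerivAt (fun y => E.A y j k) (ex (E.w j) x * cj (ex (E.w k) x)) x := by
  unfold ES.A
  have hc : Continuous fun s => ex (E.w j) s * cj (ex (E.w k) s) := (continuous_ex _).mul (continuous_cj.comp (continuous_ex _))
  exact intervalIntegral.integral_hasDerivAt_right (hc.intervalIntegrable _ _) (hc.stronglyMeasurableAtFilter _ _) hc.continuousAt

lemma ES.diff_Mx (E : ES) (x : ℝ) (j k : E.ι) : DifferentiableAt ℝ (fun y => E.Mx y j k) x := by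
  unfold ES.Mx
  simp only [Matrix.add_apply, Matrix.mul_diagonal]
  exact ((E.hasDerivAt_A x j k).differentiableAt.mul_const _).const_add _

def ES.Reg (E : ES) : Prop := ∀ x ∈ Icc (0:ℝ) 1, (E.Mx x).det ≠ 0

def ES.rho (E : ES) (x : ℝ) : E.ι → ℂ := (E.Mx x)⁻¹.mulVec (fun j => ex (E.w j) x)

def ES.r (E : ES) (x t : ℝ) : ℂ := E.trig (E.rho x) t

lemma ES.diff_rho {E : ES} (hE : E.Reg) {x : ℝ} (hx : x ∈ Icc (0:ℝ) 1) (j : E.ι) : DifferentiableAt ℝ (fun y => E.rho y j) x := by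
  unfold ES.rho
  simp only [Matrix.mulVec, dotProduct, Matrix.inv_def, Matrix.smul_apply, Ring.inverse_eq_inv', smul_eq_mul]
  refine DifferentiableAt.fun_sum fun k _ => ?_
  exact (((diff_det (E.diff_Mx x)).inv (hE x hx)).mul (diff_adj (E.diff_Mx x) _ _)).mul (hasDerivAt_ex _ _).differentiableAt

lemma ES.Mx_rho {E : ES} (hE : E.Reg) {x : ℝ} (hx : x ∈ Icc (0:ℝ) 1) : (E.Mx x).mulVec (E.rho x) = fun j => ex (E.w j) x := by
  unfold ES.rho
  rw [Matrix.mulVec_mulVec, Matrix.mul_nonsing_inv _ (isUnit_iff_ne_zero.2 (hE x hx)), Matrix.one_mulVec]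

lemma ES.Mx_inj {E : ES} (hE : E.Reg) {x : ℝ} (hx : x ∈ Icc (0:ℝ) 1) {u v : E.ι → ℂ} (h : (E.Mx x).mulVec u = (E.Mx x).mulVec v) : u = v := by
  have := congrArg ((E.Mx x)⁻¹.mulVec) h
  rwa [Matrix.mulVec_mulVec, Matrix.mulVec_mulVec, Matrix.nonsing_inv_mul _ (isUnit_iff_ne_zero.2 (hE x hx)), Matrix.one_mulVec, Matrix.one_mulVec] at this

/-- Krein identity -/
lemma ES.krein {E : ES} (hE : E.Reg) {x : ℝ} (hx : x ∈ Icc (0:ℝ) 1) (t : ℝ) :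
    E.r x t + E.h (x - t) + ∫ s in (0:ℝ)..x, E.r x s * E.h (s - t) = 0 := by
  unfold ES.r
  rw [E.conv_h ((E.BM_trig _ _).ii hx.1)]
  have : E.co x (E.trig (E.rho x)) = fun j => E.rho x j - ex (E.w j) x := by
    funext j
    rw [E.co_trig, E.Mx_rho hE hx]
  rw [this]
  unfold ES.trig ES.h
  simp only [ex_sub, neg_neg, mul_sub, sub_mul, Finset.sum_sub_distrib, mul_assoc]
  ring

def ES.sig (E : ES) (x : ℝ) (j : E.ι) : ℂ := E.rho x j * cj (ex (E.w j) x)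

lemma ES.sig_ex (E : ES) (x : ℝ) (j : E.ι) : E.sig x j * ex (E.w j) x = E.rho x j := by
  unfold ES.sig
  rw [mul_assoc, mul_comm (cj _), ex_mul_cj, mul_one]

lemma ES.A_rot (E : ES) (x : ℝ) (j k : E.ι) :
    cj (ex (E.w j) x) * E.A x j k * ex (E.w k) x = cj (E.A x j k) := by
  unfold ES.A
  have h1 := intervalIntegral.integral_comp_sub_left (a := 0) (b := x) (fun s => ex (E.w j) s * cj (ex (E.w k) s)) x
  rw [sub_zero, sub_self] at h1
  conv_lhs => rw [← h1]
  rw [← int_cj, ← intervalIntegral.integral_const_mul, ← intervalIntegral.integral_mul_const]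
  congr 1; funext s
  simp only [ex_sub, map_mul, Complex.conj_conj]
  linear_combination (cj (ex (E.w j) s) * ex (E.w k) s * (cj (ex (E.w k) x) * ex (E.w k) x)) * ex_mul_cj (E.w j) x
    + (cj (ex (E.w j) s) * ex (E.w k) s) * ex_mul_cj (E.w k) x

lemma ES.sig_eq {E : ES} (hE : E.Reg) {x : ℝ} (hx : x ∈ Icc (0:ℝ) 1) (j : E.ι) :
    E.sig x j + ∑ k, cj (E.A x j k) * ((E.c k : ℂ) * E.sig x k) = 1 := by
  have h := congrFun (E.Mx_rho hE hx) j
  rw [E.Mx_mulVec] at h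
  have h2 := congrArg (fun z => z * cj (ex (E.w j) x)) h
  simp only [add_mul, ex_mul_cj, Finset.sum_mul] at h2
  rw [← h2]
  congr 1
  refine Finset.sum_congr rfl fun k _ => ?_
  rw [← E.A_rot, ← E.sig_ex x k]; ring

lemma hasDerivAt_cj {f : ℝ → ℂ} {f' : ℂ} {x : ℝ} (h : HasDerivAt f f' x) : HasDerivAt (fun y => cj (f y)) (cj f') x := h.star

lemma ES.r_zero (E : ES) (x : ℝ) : E.r x 0 = -∑ k, (E.c k : ℂ) * E.rho x k := by
  unfold ES.r ES.trig; simp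

/-- the derivative of sigma: `σ' = q conj ρ` -/
lemma ES.hasDerivAt_sig {E : ES} (hE : E.Reg) {x : ℝ} (hx : x ∈ Ioo (0:ℝ) 1) (j : E.ι) :
    HasDerivAt (fun y => E.sig y j) (E.r x 0 * cj (E.rho x j)) x := by
  have hx' := Ioo_subset_Icc_self hx
  have hd : ∀ j, DifferentiableAt ℝ (fun y => E.sig y j) x := fun j => by
    unfold ES.sig
    exact (E.diff_rho hE hx' j).mul (hasDerivAt_cj (hasDerivAt_ex _ _)).differentiableAt
  set d : E.ι → ℂ := fun j => deriv (fun y => E.sig y j) x with hdd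
  have hd' : ∀ j, HasDerivAt (fun y => E.sig y j) (d j) x := fun j => (hd j).hasDerivAt
  have heq : ∀ j, d j + ∑ k, (cj (ex (E.w j) x * cj (ex (E.w k) x)) * ((E.c k : ℂ) * E.sig x k) + cj (E.A x j k) * ((E.c k : ℂ) * d k)) = 0 := by
    intro j
    have h1 : HasDerivAt (fun y => E.sig y j + ∑ k, cj (E.A y j k) * ((E.c k : ℂ) * E.sig y k))
        (d j + ∑ k, (cj (ex (E.w j) x * cj (ex (E.w k) x)) * ((E.c k : ℂ) * E.sig x k) + cj (E.A x j k) * ((E.c k : ℂ) * d k))) x := by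
      refine (hd' j).add (HasDerivAt.fun_sum fun k _ => ?_)
      exact (hasDerivAt_cj (E.hasDerivAt_A x j k)).mul ((hd' k).const_mul _)
    have h2 : (fun y => E.sig y j + ∑ k, cj (E.A y j k) * ((E.c k : ℂ) * E.sig y k)) =ᶠ[nhds x] fun _ => 1 := by
      filter_upwards [Ioo_mem_nhds hx.1 hx.2] with y hy
      exact E.sig_eq hE (Ioo_subset_Icc_self hy) j
    exact (h1.congr_of_eventuallyEq h2.symm).unique (hasDerivAt_const x (1:ℂ))
  have hv : (fun j => cj (d j)) = fun j => cj (E.r x 0) * E.rho x j := by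
    refine E.Mx_inj hE hx' ?_
    have e2 : (E.Mx x).mulVec (fun j => cj (E.r x 0) * E.rho x j) = fun j => cj (E.r x 0) * ex (E.w j) x := by
      have : (fun j => cj (E.r x 0) * E.rho x j) = cj (E.r x 0) • E.rho x := rfl
      rw [this, Matrix.mulVec_smul, E.Mx_rho hE hx']; rfl
    rw [e2]
    funext j
    rw [E.Mx_mulVec]
    have h3 := congrArg cj (heq j)
    simp only [map_add, map_sum, map_mul, map_zero, Complex.conj_conj, Complex.conj_ofReal, Finset.sum_add_distrib] at h3
    have h4 : ∑ k, ex (E.w j) x * cj (ex (E.w k) x) * ((E.c k : ℂ) * cj (E.sig x k)) = - (cj (E.r x 0) * ex (E.w j) x) := by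
      rw [E.r_zero, map_neg, map_sum, neg_mul, neg_neg, Finset.sum_mul]
      refine Finset.sum_congr rfl fun k _ => ?_
      rw [← E.sig_ex x k, map_mul, map_mul, Complex.conj_ofReal]; ring
    rw [h4] at h3
    linear_combination h3
  have := congrArg cj (congrFun hv j)
  simp only [Complex.conj_conj, map_mul] at this
  rw [← this]
  exact hd' j

lemma ES.continuousOn_rho {E : ES} (hE : E.Reg) (j : E.ι) : ContinuousOn (fun x => E.rho x j) (Icc 0 1) :=
  fun x hx => (E.diff_rho hE hx j).continuousAt.continuousWithinAt

lemma ES.continuousOn_r {E : ES} (hE : E.Reg) : ContinuousOn (fun z : ℝ × ℝ => E.r z.1 z.2) (Icc 0 1 ×ˢ univ) := by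
  unfold ES.r ES.trig
  refine (continuousOn_finsetSum _ fun k _ => ?_).neg
  refine (continuousOn_const.mul ((E.continuousOn_rho hE k).comp continuousOn_fst fun z hz => hz.1)).mul ?_
  exact (continuous_cj.comp ((continuous_ex _).comp continuous_snd)).continuousOn

/-- the function `a` -/
def ES.a (E : ES) (l : ℂ) (x : ℝ) : ℂ := cexp (-(I * l * x)) + ∫ y in (0:ℝ)..x, E.r x y * cexp (-(I * l * (2 * y - x)))

def ES.g (E : ES) (l : ℂ) (x : ℝ) (k : E.ι) : ℂ := ∫ y in (0:ℝ)..x, ex (E.w k) y * cexp (2 * I * l * y)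

lemma ES.continuous_gi (E : ES) (l : ℂ) (k : E.ι) : Continuous fun y : ℝ => ex (E.w k) y * cexp (2 * I * l * y) := by
  fun_prop

lemma ES.a_eq (E : ES) (l : ℂ) (x : ℝ) : E.a l x = cexp (-(I * l * x)) * (1 - ∑ k, (E.c k : ℂ) * E.sig x k * E.g l x k) := by
  unfold ES.a
  have h1 := intervalIntegral.integral_comp_sub_left (a := 0) (b := x) (fun y : ℝ => E.r x y * cexp (-(I * l * (2 * y - x)))) x
  rw [sub_zero, sub_self] at h1
  rw [← h1, mul_sub, mul_one, sub_eq_add_neg]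
  congr 1
  unfold ES.g
  rw [Finset.mul_sum]
  have : ∀ y : ℝ, E.r x (x - y) * cexp (-(I * l * (2 * (x - y : ℝ) - x))) =
     ∑ k, -(cexp (-(I * l * x)) * ((E.c k : ℂ) * E.sig x k)) * (ex (E.w k) y * cexp (2 * I * l * y)) := by
    intro y
    unfold ES.r ES.trig ES.sig
    rw [neg_mul, Finset.sum_mul, ← Finset.sum_neg_distrib]
    refine Finset.sum_congr rfl fun k _ => ?_
    have : cexp (-(I * l * (2 * (x - y : ℝ) - x))) = cexp (-(I * l * x)) * cexp (2 * I * l * y) := by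
      rw [← Complex.exp_add]; congr 1; push_cast; ring
    rw [this, ex_sub, map_mul, Complex.conj_conj]; ring
  simp only [this]
  rw [intervalIntegral.integral_finsetSum fun k _ => ((E.continuous_gi l k).const_mul _).intervalIntegrable _ _]
  simp only [intervalIntegral.integral_const_mul]
  rw [← Finset.sum_neg_distrib]
  refine Finset.sum_congr rfl fun k _ => by ring

lemma conj_cexp_aux (l : ℂ) (x : ℝ) : cj (cexp (-(I * cj l * x))) = cexp (I * l * x) := by
  rw [← Complex.exp_conj]; congr 1; simp

lemma ES.cj_a (E : ES) (l : ℂ) (x : ℝ) : cj (E.a (cj l) x) = cexp (I * l * x) + ∫ y in (0:ℝ)..x, cj (E.r x y) * cexp (I * l * (2 * y - x)) := by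
  unfold ES.a
  rw [map_add, conj_cexp_aux, ← int_cj]
  congr 1
  congr 1; funext y
  rw [map_mul]
  congr 1
  have := conj_cexp_aux l (2 * y - x)
  push_cast at this
  exact this

lemma ES.cj_a_eq (E : ES) (l : ℂ) (x : ℝ) : cj (E.a (cj l) x) = cexp (I * l * x) - cexp (-(I * l * x)) * ∑ k, (E.c k : ℂ) * cj (E.rho x k) * E.g l x k := by
  rw [E.cj_a, sub_eq_add_neg]
  congr 1
  have : ∀ y : ℝ, cj (E.r x y) * cexp (I * l * (2 * y - x)) =
     ∑ k, -(cexp (-(I * l * x)) * ((E.c k : ℂ) * cj (E.rho x k))) * (ex (E.w k) y * cexp (2 * I * l * y)) := by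
    intro y
    unfold ES.r ES.trig
    rw [map_neg, map_sum, neg_mul, Finset.sum_mul, ← Finset.sum_neg_distrib]
    refine Finset.sum_congr rfl fun k _ => ?_
    have : cexp (I * l * (2 * y - x)) = cexp (-(I * l * x)) * cexp (2 * I * l * y) := by
      rw [← Complex.exp_add]; congr 1; ring
    rw [this, map_mul, map_mul, Complex.conj_conj, Complex.conj_ofReal]; ring
  simp only [this]
  rw [intervalIntegral.integral_finsetSum fun k _ => ((E.continuous_gi l k).const_mul _).intervalIntegrable _ _]
  simp only [intervalIntegral.integral_const_mul]
  unfold ES.g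
  rw [Finset.mul_sum, ← Finset.sum_neg_distrib]
  refine Finset.sum_congr rfl fun k _ => by ring

lemma ES.hasDerivAt_g (E : ES) (l : ℂ) (x : ℝ) (k : E.ι) : HasDerivAt (fun y => E.g l y k) (ex (E.w k) x * cexp (2 * I * l * x)) x := by
  have hc := E.continuous_gi l k
  exact intervalIntegral.integral_hasDerivAt_right (hc.intervalIntegrable _ _) (hc.stronglyMeasurableAtFilter _ _) hc.continuousAt

lemma ES.hasDerivAt_a {E : ES} (hE : E.Reg) (l : ℂ) {x : ℝ} (hx : x ∈ Ioo (0:ℝ) 1) :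
    HasDerivAt (E.a l) (-(I * l) * E.a l x + E.r x 0 * cj (E.a (cj l) x)) x := by
  have h0 : HasDerivAt (fun y : ℝ => cexp (-(I * l * y))) (cexp (-(I * l * x)) * (-(I * l))) x := by
    have : HasDerivAt (fun y : ℝ => -(I * l * (y:ℂ))) (-(I * l)) x := by
      have h := (hasDerivAt_id x).ofReal_comp.const_mul (I * l)
      simp only [id, Complex.ofReal_one, mul_one] at h
      exact h.neg
    exact this.cexp
  have h1 : HasDerivAt (fun y => 1 - ∑ k, (E.c k : ℂ) * E.sig y k * E.g l y k)
      (-∑ k, ((E.c k : ℂ) * (E.r x 0 * cj (E.rho x k)) * E.g l x k + (E.c k : ℂ) * E.sig x k * (ex (E.w k) x * cexp (2 * I * l * x)))) x := by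
    refine (HasDerivAt.fun_sum fun k _ => ?_).const_sub 1
    exact ((E.hasDerivAt_sig hE hx k).const_mul _).mul (E.hasDerivAt_g l x k)
  have h2 := h0.mul h1
  have e : E.a l = fun y : ℝ => cexp (-(I * l * y)) * (1 - ∑ k, (E.c k : ℂ) * E.sig y k * E.g l y k) := funext (E.a_eq l)
  rw [e]
  refine h2.congr_deriv ?_
  simp only
  rw [E.cj_a_eq]
  have e1 : ∑ k, ((E.c k : ℂ) * (E.r x 0 * cj (E.rho x k)) * E.g l x k + (E.c k : ℂ) * E.sig x k * (ex (E.w k) x * cexp (2 * I * l * x)))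
    = E.r x 0 * (∑ k, (E.c k : ℂ) * cj (E.rho x k) * E.g l x k) - cexp (2 * I * l * x) * E.r x 0 := by
    rw [Finset.sum_add_distrib, sub_eq_add_neg, E.r_zero, mul_neg, neg_neg, Finset.mul_sum, Finset.mul_sum]
    congr 1
    · refine Finset.sum_congr rfl fun k _ => by ring
    · refine Finset.sum_congr rfl fun k _ => by rw [← E.sig_ex x k]; ring
  rw [e1]
  have e2 : cexp (-(I * l * x)) * cexp (2 * I * l * x) = cexp (I * l * x) := by
    rw [← Complex.exp_add]; congr 1; ring
  linear_combination E.r x 0 * e2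

lemma ES.continuousOn_a {E : ES} (hE : E.Reg) (l : ℂ) : ContinuousOn (E.a l) (Icc 0 1) := by
  have e : E.a l = fun y : ℝ => cexp (-(I * l * y)) * (1 - ∑ k, (E.c k : ℂ) * E.sig y k * E.g l y k) := funext (E.a_eq l)
  rw [e]
  refine ContinuousOn.mul (by fun_prop) (continuousOn_const.sub (continuousOn_finsetSum _ fun k _ => ?_))
  refine (continuousOn_const.mul ?_).mul fun x _ => (E.hasDerivAt_g l x k).continuousAt.continuousWithinAt
  unfold ES.sig
  exact (E.continuousOn_rho hE k).mul (continuous_cj.comp (continuous_ex _)).continuousOn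

lemma ES.continuousOn_r0 {E : ES} (hE : E.Reg) (t : ℝ) : ContinuousOn (fun x => E.r x t) (Icc 0 1) := by
  have := (E.continuousOn_r hE).comp (f := fun x : ℝ => (x, t)) (s := Icc 0 1) (by fun_prop) (fun x hx => ⟨hx, mem_univ _⟩)
  exact this

/-- integral equation for `a` -/
lemma ES.a_int {E : ES} (hE : E.Reg) (l : ℂ) {x : ℝ} (hx : x ∈ Icc (0:ℝ) 1) :
    E.a l x = 1 + ∫ y in (0:ℝ)..x, (-(I * l) * E.a l y + E.r y 0 * cj (E.a (cj l) y)) := by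
  have hs : Icc 0 x ⊆ Icc (0:ℝ) 1 := Icc_subset_Icc_right hx.2
  have h := intervalIntegral.integral_eq_sub_of_hasDerivAt_of_le hx.1 ((E.continuousOn_a hE l).mono hs)
    (fun y hy => E.hasDerivAt_a hE l ⟨hy.1, hy.2.trans_le hx.2⟩) (by
      refine ContinuousOn.intervalIntegrable ?_
      rw [uIcc_of_le hx.1]
      refine ContinuousOn.mono ?_ hs
      exact (continuousOn_const.mul (E.continuousOn_a hE l)).add ((E.continuousOn_r0 hE 0).mul (continuous_cj.comp_continuousOn (E.continuousOn_a hE _))))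
  rw [h]
  have : E.a l 0 = 1 := by unfold ES.a; simp
  rw [this]; ring

/-- Minkowski integral inequality -/
lemma minkL {p : ℝ≥0∞} (hp : 1 ≤ p) (hp' : p ≠ ∞) {f : ℝ → ℝ → ℝ≥0∞} (hf : Measurable (Function.uncurry f))
    {η : ℝ → ℝ≥0∞} (hη : Measurable η) {S : ℝ≥0∞} (hS : ∀ v, eLpNorm (fun x => f x v) p volume ≤ S) :
    eLpNorm (fun x => ∫⁻ v, η v * f x v) p volume ≤ (∫⁻ v, η v) * S := by
  have hp0 : p ≠ 0 := (zero_lt_one.trans_le hp).ne'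
  have hq1 : 1 ≤ p.toReal := by
    rw [← ENNReal.toReal_one]; exact ENNReal.toReal_mono hp' hp
  set q := p.toReal with hq
  have hq0 : 0 < q := by linarith
  have hS' : ∀ v, ∫⁻ x, f x v ^ q ≤ S ^ q := by
    intro v
    have := hS v
    rw [eLpNorm_eq_lintegral_rpow_enorm_toReal hp0 hp', ← hq] at this
    rw [one_div, ENNReal.rpow_inv_le_iff hq0] at this
    simpa using this
  rw [eLpNorm_eq_lintegral_rpow_enorm_toReal hp0 hp', ← hq, one_div, ENNReal.rpow_inv_le_iff hq0]
  simp only [enorm_eq_self]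
  set ν := (volume : Measure ℝ).withDensity η with hν
  have hνu : ν univ = ∫⁻ v, η v := by rw [hν, withDensity_apply _ MeasurableSet.univ, Measure.restrict_univ]
  have h1 : ∀ x, (∫⁻ v, η v * f x v) ^ q ≤ (∫⁻ v, η v) ^ (q - 1) * ∫⁻ v, η v * f x v ^ q := by
    intro x
    have hfx : Measurable (f x) := hf.of_uncurry_left
    have e1 : ∫⁻ v, η v * f x v = ∫⁻ v, f x v ∂ν := by
      rw [hν, lintegral_withDensity_eq_lintegral_mul _ hη hfx]; rfl
    have e2 : ∫⁻ v, η v * f x v ^ q = ∫⁻ v, f x v ^ q ∂ν := by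
      rw [hν, lintegral_withDensity_eq_lintegral_mul _ hη (hfx.pow_const q)]; rfl
    rw [e1, e2, ← hνu]
    have h := eLpNorm_le_eLpNorm_mul_rpow_measure_univ (μ := ν) (f := f x) hp hfx.aestronglyMeasurable
    rw [eLpNorm_one_eq_lintegral_enorm, eLpNorm_eq_lintegral_rpow_enorm_toReal hp0 hp', ← hq] at h
    simp only [enorm_eq_self, ENNReal.toReal_one] at h
    have h2 := ENNReal.rpow_le_rpow h hq0.le
    refine h2.trans_eq ?_
    rw [ENNReal.mul_rpow_of_nonneg _ _ hq0.le, ← ENNReal.rpow_mul, ← ENNReal.rpow_mul, one_div_mul_cancel hq0.ne', ENNReal.rpow_one, mul_comm]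
    congr 2
    field_simp
  calc ∫⁻ x, (∫⁻ v, η v * f x v) ^ q ≤ ∫⁻ x, (∫⁻ v, η v) ^ (q - 1) * ∫⁻ v, η v * f x v ^ q := lintegral_mono h1
    _ = (∫⁻ v, η v) ^ (q - 1) * ∫⁻ x, ∫⁻ v, η v * f x v ^ q := by
        refine lintegral_const_mul _ ?_
        exact Measurable.lintegral_prod_right ((hη.comp measurable_snd).mul (hf.pow_const q))
    _ = (∫⁻ v, η v) ^ (q - 1) * ∫⁻ v, η v * ∫⁻ x, f x v ^ q := by
        rw [lintegral_lintegral_swap]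
        · congr 1
          refine lintegral_congr fun v => ?_
          rw [lintegral_const_mul]
          exact (hf.of_uncurry_right).pow_const q
        · exact ((hη.comp measurable_snd).mul (hf.pow_const q)).aemeasurable
    _ ≤ (∫⁻ v, η v) ^ (q - 1) * ∫⁻ v, η v * S ^ q := by
        gcongr with v; exact hS' v
    _ = ((∫⁻ v, η v) * S) ^ q := by
        rw [lintegral_mul_const _ hη, ENNReal.mul_rpow_of_nonneg _ _ hq0.le, ← mul_assoc]
        congr 1
        conv_lhs => rw [← ENNReal.rpow_one (∫⁻ v, η v), ← ENNReal.rpow_mul, one_mul]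
        rw [← ENNReal.rpow_add_of_nonneg _ _ (by linarith) zero_le_one]
        congr 1; ring

lemma eLpNorm_affine {p : ℝ≥0∞} (hp : 1 ≤ p) (hp' : p ≠ ∞) {g : ℝ → ℝ≥0∞} (hg : Measurable g) {c b : ℝ} (hc : 1/2 ≤ |c|) :
    eLpNorm (fun x => g (c * x + b)) p volume ≤ 2 * eLpNorm g p volume := by
  have hp0 : p ≠ 0 := (zero_lt_one.trans_le hp).ne'
  have hq1 : 1 ≤ p.toReal := by
    rw [← ENNReal.toReal_one]; exact ENNReal.toReal_mono hp' hp
  set q := p.toReal with hq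
  have hq0 : 0 < q := by linarith
  have hc0 : c ≠ 0 := by intro h; rw [h] at hc; norm_num at hc
  rw [eLpNorm_eq_lintegral_rpow_enorm_toReal hp0 hp', eLpNorm_eq_lintegral_rpow_enorm_toReal hp0 hp', ← hq]
  simp only [enorm_eq_self]
  set G : ℝ → ℝ≥0∞ := fun x => g x ^ q with hG
  have hGm : Measurable G := hg.pow_const q
  have h1 : ∫⁻ x, G (c * x + b) = ENNReal.ofReal |c⁻¹| * ∫⁻ x, G x := by
    have e1 : ∫⁻ x, G (c * x + b) = ∫⁻ y, G (y + b) ∂(Measure.map (fun x => c * x) volume) := by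
      exact (lintegral_map (f := fun y => G (y + b)) (hGm.comp (measurable_id.add_const b)) (measurable_const_mul c)).symm
    rw [e1, Real.map_volume_mul_left hc0, lintegral_smul_measure, lintegral_add_right_eq_self G b, smul_eq_mul]
  have h2 : ENNReal.ofReal |c⁻¹| ≤ 2 := by
    rw [show (2:ℝ≥0∞) = ENNReal.ofReal 2 by simp]
    refine ENNReal.ofReal_le_ofReal ?_
    rw [abs_inv, inv_le_comm₀ (by positivity) (by norm_num)]
    linarith
  calc (∫⁻ x, G (c * x + b)) ^ (1 / q) = (ENNReal.ofReal |c⁻¹|) ^ (1/q) * (∫⁻ x, G x) ^ (1/q) := by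
        rw [h1, ENNReal.mul_rpow_of_nonneg _ _ (by positivity)]
    _ ≤ 2 * (∫⁻ x, G x) ^ (1/q) := by
        gcongr
        calc (ENNReal.ofReal |c⁻¹|) ^ (1/q) ≤ 2 ^ (1/q) := ENNReal.rpow_le_rpow h2 (by positivity)
          _ ≤ 2 ^ (1:ℝ) := ENNReal.rpow_le_rpow_of_exponent_le (by norm_num) (by rw [div_le_one hq0]; exact hq1)
          _ = 2 := ENNReal.rpow_one _

lemma eLpNorm_sub_left (p : ℝ≥0∞) (g : ℝ → ℝ≥0∞) (s : ℝ) (hg : Measurable g) :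
    eLpNorm (fun t => g (s - t)) p volume = eLpNorm g p volume :=
  eLpNorm_comp_measurePreserving hg.aestronglyMeasurable (Measure.measurePreserving_sub_left volume s)

def Tri : Set (ℝ × ℝ) := {z | 0 ≤ z.2 ∧ z.2 ≤ z.1 ∧ z.1 ≤ 1}

lemma row_est {p : ℝ≥0∞} (hp : 1 ≤ p) (hp' : p ≠ ∞) {d ρ : ℝ → ℝ≥0∞} {g η : ℝ → ℝ≥0∞} (hρ : Measurable ρ) (hd : Measurable d)
    (hg : Measurable g) (hη : Measurable η) {x : ℝ}
    (h : ∀ t, d t ≤ g (x - t) + (∫⁻ s, ρ s * g (s - t)) + ∫⁻ s, d s * η (s - t)) :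
    eLpNorm d p volume ≤ eLpNorm g p volume + (∫⁻ s, ρ s) * eLpNorm g p volume + (∫⁻ s, d s) * eLpNorm η p volume := by
  have m1 : Measurable fun t => g (x - t) := hg.comp (measurable_const.sub measurable_id)
  have mm : ∀ {g : ℝ → ℝ≥0∞}, Measurable g → Measurable (Function.uncurry fun t s : ℝ => g (s - t)) :=
    fun hg => hg.comp (measurable_snd.sub measurable_fst)
  have m2 : Measurable fun t => ∫⁻ s, ρ s * g (s - t) := Measurable.lintegral_prod_right ((hρ.comp measurable_snd).mul (mm hg))
  have m3 : Measurable fun t => ∫⁻ s, d s * η (s - t) := Measurable.lintegral_prod_right ((hd.comp measurable_snd).mul (mm hη))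
  calc eLpNorm d p volume ≤ eLpNorm (((fun t => g (x - t)) + fun t => (∫⁻ s, ρ s * g (s - t))) + fun t => ∫⁻ s, d s * η (s - t)) p volume :=
        eLpNorm_mono_enorm fun t => by simpa using h t
    _ ≤ _ := by
      refine (eLpNorm_add_le (m1.add m2).aestronglyMeasurable m3.aestronglyMeasurable hp).trans ?_
      refine add_le_add ((eLpNorm_add_le m1.aestronglyMeasurable m2.aestronglyMeasurable hp).trans (add_le_add ?_ ?_)) ?_
      · rw [eLpNorm_sub_left _ _ _ hg]
      · exact minkL hp hp' (mm hg) hρ fun s => (eLpNorm_sub_left _ _ _ hg).le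
      · exact minkL hp hp' (mm hη) hd fun s => (eLpNorm_sub_left _ _ _ hη).le

lemma absorb {S X : ℝ≥0∞} (hS : S ≠ ∞) (h : S ≤ X + 2⁻¹ * S) : S ≤ 2 * X := by
  have h1 : S = 2⁻¹ * S + 2⁻¹ * S := by rw [← add_mul, ENNReal.inv_two_add_inv_two, one_mul]
  have h2 : 2⁻¹ * S ≤ X := by
    have hf : 2⁻¹ * S ≠ ∞ := ENNReal.mul_ne_top (by simp) hS
    have : 2⁻¹ * S + 2⁻¹ * S ≤ X + 2⁻¹ * S := by rw [← h1]; exact h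
    exact (ENNReal.add_le_add_iff_right hf).1 this
  calc S = 2 * (2⁻¹ * S) := by rw [← mul_assoc, ENNReal.mul_inv_cancel (by simp) (by simp), one_mul]
    _ ≤ 2 * X := by gcongr

lemma slice_est {p : ℝ≥0∞} (hp : 1 ≤ p) (hp' : p ≠ ∞) {d ρ : ℝ → ℝ → ℝ≥0∞} {g η η' : ℝ → ℝ≥0∞}
    (hρ : Measurable (Function.uncurry ρ)) (hd : Measurable (Function.uncurry d))
    (hg : Measurable g) (hη' : Measurable η') {C B N S : ℝ≥0∞} (hC : C ≠ ∞) (hdC : ∀ x t, d x t ≤ C) (hd0 : ∀ x t, (x,t) ∉ Tri → d x t = 0)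
    (h : ∀ x t, (x,t) ∈ Tri → d x t ≤ g (x - t) + (∫⁻ s, ρ x s * g (s - t)) + ∫⁻ s, d x s * η (s - t))
    (hηη : ∀ u, η u ≤ B + η' u) (hsm : ∫⁻ u, η' u ≤ 2⁻¹) (hN : ∀ x, ∫⁻ s, d x s ≤ N) {a : ℝ} (ha : a ≤ 1/2)
    (hS : ∀ b, eLpNorm (fun x => ρ x (a * x + b)) p volume ≤ S) (b : ℝ) :
    eLpNorm (fun x => d x (a * x + b)) p volume ≤ 2 * (2 * eLpNorm g p volume + (∫⁻ u, g u) * S + B * N) := by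
  have hp0 : p ≠ 0 := (zero_lt_one.trans_le hp).ne'
  have sl : ∀ {f : ℝ → ℝ → ℝ≥0∞}, Measurable (Function.uncurry f) → ∀ b, Measurable (Function.uncurry fun x v : ℝ => f x (v + (a * x + b))) := by
    intro f hf b
    exact hf.comp (measurable_fst.prodMk (measurable_snd.add ((measurable_fst.const_mul a).add_const b)))
  have mone : Measurable ((Icc (0:ℝ) 1).indicator fun _ => B * N) := measurable_const.indicator measurableSet_Icc
  set Sd : ℝ≥0∞ := ⨆ b, eLpNorm (fun x => d x (a * x + b)) p volume with hSd
  have onen : ∀ c : ℝ≥0∞, eLpNorm ((Icc (0:ℝ) 1).indicator fun _ => c) p volume = c := by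
    intro c
    rw [eLpNorm_indicator_const measurableSet_Icc hp0 hp']; simp
  have hfin : Sd ≤ C := by
    refine iSup_le fun b => ?_
    rw [← onen C]
    refine eLpNorm_mono_enorm fun x => ?_
    by_cases hx : x ∈ Icc (0:ℝ) 1
    · rw [indicator_of_mem hx]; exact hdC _ _
    · rw [hd0 x _ fun h => hx ⟨h.1.trans h.2.1, h.2.2⟩]; simp
  have key : Sd ≤ (2 * eLpNorm g p volume + (∫⁻ u, g u) * S + B * N) + 2⁻¹ * Sd := by
    refine iSup_le fun b => ?_
    have shift : ∀ (f : ℝ → ℝ≥0∞) (k : ℝ → ℝ≥0∞) (t : ℝ), ∫⁻ s, f s * k (s - t) = ∫⁻ v, k v * f (v + t) := by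
      intro f k t
      rw [← lintegral_add_right_eq_self _ t]
      simp only [add_sub_cancel_right]
      simp only [mul_comm]
    have m1 : Measurable fun x : ℝ => g ((1 - a) * x + -b) := hg.comp ((measurable_id.const_mul _).add_const _)
    have m2 : Measurable fun x => ∫⁻ v, g v * ρ x (v + (a * x + b)) := Measurable.lintegral_prod_right ((hg.comp measurable_snd).mul (sl hρ b))
    have m4 : Measurable fun x => ∫⁻ v, η' v * d x (v + (a * x + b)) := Measurable.lintegral_prod_right ((hη'.comp measurable_snd).mul (sl hd b))
    calc eLpNorm (fun x => d x (a * x + b)) p volume ≤ eLpNorm ((((fun x => g ((1 - a) * x + -b)) + fun x => ∫⁻ v, g v * ρ x (v + (a * x + b)))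
            + (Icc (0:ℝ) 1).indicator fun _ => B * N) + fun x => ∫⁻ v, η' v * d x (v + (a * x + b))) p volume := by
          refine eLpNorm_mono_enorm fun x => ?_
          simp only [enorm_eq_self, Pi.add_apply]
          by_cases hT : (x, a * x + b) ∈ Tri
          · have hx : x ∈ Icc (0:ℝ) 1 := ⟨hT.1.trans hT.2.1, hT.2.2⟩
            rw [indicator_of_mem hx]
            refine (h _ _ hT).trans ?_
            rw [shift, add_assoc _ (B * N)]
            refine add_le_add (add_le_add (le_of_eq ?_) le_rfl) ?_
            · congr 1; ring
            · rw [← shift (d x) η']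
              calc ∫⁻ s, d x s * η (s - (a * x + b)) ≤ ∫⁻ s, (B * d x s + d x s * η' (s - (a * x + b))) := by
                    refine lintegral_mono fun s => ?_
                    simp only
                    rw [mul_comm B, ← mul_add]; gcongr; exact hηη _
                _ = B * (∫⁻ s, d x s) + ∫⁻ s, d x s * η' (s - (a * x + b)) := by
                    rw [lintegral_add_left ((hd.of_uncurry_left).const_mul B), lintegral_const_mul _ hd.of_uncurry_left]
                _ ≤ _ := by gcongr; exact hN x
          · rw [hd0 _ _ hT]; exact zero_le
      _ ≤ _ := by
          refine (eLpNorm_add_le ((m1.add m2).add mone).aestronglyMeasurable m4.aestronglyMeasurable hp).trans ?_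
          refine add_le_add ((eLpNorm_add_le (m1.add m2).aestronglyMeasurable mone.aestronglyMeasurable hp).trans
            (add_le_add ((eLpNorm_add_le m1.aestronglyMeasurable m2.aestronglyMeasurable hp).trans (add_le_add ?_ ?_)) ?_)) ?_
          · exact eLpNorm_affine hp hp' hg (by rw [abs_of_nonneg (by linarith)]; linarith)
          · refine minkL hp hp' (sl hρ b) hg fun v => ?_
            have := hS (b + v)
            convert this using 4; ring
          · rw [onen]
          · refine (minkL hp hp' (sl hd b) hη' fun v => ?_).trans (mul_le_mul_left hsm Sd)
            refine le_trans (le_of_eq ?_) (le_iSup _ (b + v))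
            congr 1; funext x; congr 1; ring
  exact (le_iSup (fun b => eLpNorm (fun x => d x (a * x + b)) p volume) b).trans (absorb (hfin.trans_lt hC.lt_top).ne key)

lemma measurableSet_Tri : MeasurableSet Tri := by
  have : IsClosed Tri := by
    unfold Tri
    refine (isClosed_le continuous_const continuous_snd).inter ((isClosed_le continuous_snd continuous_fst).inter (isClosed_le continuous_fst continuous_const))
  exact this.measurableSet

lemma isCompact_Tri : IsCompact Tri := by
  have hc : IsClosed Tri := by
    unfold Tri
    refine (isClosed_le continuous_const continuous_snd).inter ((isClosed_le continuous_snd continuous_fst).inter (isClosed_le continuous_fst continuous_const))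
  refine IsCompact.of_isClosed_subset (isCompact_Icc (a := ((0:ℝ),(0:ℝ))) (b := (1,1))) hc ?_
  rintro ⟨x, t⟩ ⟨h1, h2, h3⟩
  simp only at h1 h2 h3
  exact ⟨⟨h1.trans h2, h1⟩, ⟨h3, h2.trans h3⟩⟩

def triI (f : ℝ → ℝ → ℂ) (x t : ℝ) : ℂ := Tri.indicator (fun z => f z.1 z.2) (x, t)

lemma triI_of_mem {f : ℝ → ℝ → ℂ} {x t : ℝ} (h : (x,t) ∈ Tri) : triI f x t = f x t := by
  unfold triI; rw [indicator_of_mem h]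

lemma triI_of_notMem {f : ℝ → ℝ → ℂ} {x t : ℝ} (h : (x,t) ∉ Tri) : triI f x t = 0 := by
  unfold triI; rw [indicator_of_notMem h]

lemma measurable_triI {f : ℝ → ℝ → ℂ} (hf : ContinuousOn (Function.uncurry f) Tri) : Measurable (Function.uncurry (triI f)) := by
  classical
  have h := hf.measurable_piecewise (g := fun _ => (0:ℂ)) continuousOn_const measurableSet_Tri
  convert h using 1
  funext z
  rcases z with ⟨x, t⟩
  by_cases hz : (x,t) ∈ Tri
  · simp [Function.uncurry, triI_of_mem hz, piecewise_eq_of_mem _ _ _ hz]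
  · simp [Function.uncurry, triI_of_notMem hz, piecewise_eq_of_notMem _ _ _ hz]

lemma bdd_triI {f : ℝ → ℝ → ℂ} (hf : ContinuousOn (Function.uncurry f) Tri) : ∃ C : ℝ, 0 ≤ C ∧ ∀ x t, ‖triI f x t‖ ≤ C := by
  obtain ⟨C, hC⟩ := isCompact_Tri.exists_bound_of_continuousOn hf
  refine ⟨max C 0, le_max_right _ _, fun x t => ?_⟩
  by_cases hz : (x,t) ∈ Tri
  · rw [triI_of_mem hz]; exact (hC _ hz).trans (le_max_left _ _)
  · rw [triI_of_notMem hz, norm_zero]; exact le_max_right _ _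

def ES.rk (E : ES) : ℝ → ℝ → ℂ := triI E.r
def ES.hk (E : ES) (u : ℝ) : ℂ := (Icc (-1:ℝ) 1).indicator E.h u

lemma ES.cont_tri {E : ES} (hE : E.Reg) : ContinuousOn (Function.uncurry E.r) Tri :=
  (E.continuousOn_r hE).mono fun _ hz => ⟨⟨hz.1.trans hz.2.1, hz.2.2⟩, mem_univ _⟩

lemma ES.measurable_hk (E : ES) : Measurable E.hk := E.continuous_h.measurable.indicator measurableSet_Icc

lemma ES.hk_eq (E : ES) {u : ℝ} (hu : u ∈ Icc (-1:ℝ) 1) : E.hk u = E.h u := indicator_of_mem hu _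

def zeroES : ES := { ι := Empty, c := fun _ => 0, w := fun _ => 0 }

lemma zeroES_h (u : ℝ) : zeroES.h u = 0 := by
  unfold ES.h
  exact @Finset.sum_of_isEmpty Empty ℂ _ _ _ _

lemma zeroES_r (x t : ℝ) : zeroES.r x t = 0 := by
  unfold ES.r ES.trig
  rw [neg_eq_zero]
  exact @Finset.sum_of_isEmpty Empty ℂ _ _ _ _

lemma zeroES_reg : zeroES.Reg := by
  intro x _
  have : (zeroES.Mx x).det = 1 := @Matrix.det_isEmpty Empty _ _ ℂ _ _ _
  rw [this]; exact one_ne_zero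

lemma LB.lint {E : ES} {M : ℝ} (hM : 0 ≤ M) (h : LB E M) {x : ℝ} (hx : x ∈ Icc (0:ℝ) 1) {f : ℝ → ℂ} (hf : IntervalIntegrable f volume 0 x) :
    ∫⁻ s in Ioc 0 x, ‖f s‖ₑ ≤ ENNReal.ofReal M * ∫⁻ t in Ioc 0 x, ‖f t + ∫ s in (0:ℝ)..x, f s * E.h (s - t)‖ₑ := by
  have h1 := h x hx f hf
  have hG : IntervalIntegrable (fun t => f t + ∫ s in (0:ℝ)..x, f s * E.h (s - t)) volume 0 x := by
    have : (fun t => f t + ∫ s in (0:ℝ)..x, f s * E.h (s - t)) = fun t => f t - E.trig (E.co x f) t := by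
      funext t; rw [E.conv_h hf]; ring
    rw [this]
    exact hf.sub ((E.continuous_trig _).intervalIntegrable _ _)
  rw [intervalIntegrable_iff_integrableOn_Ioc_of_le hx.1] at hf hG
  rw [intervalIntegral.integral_of_le hx.1, intervalIntegral.integral_of_le hx.1] at h1
  rw [← ofReal_integral_norm_eq_lintegral_enorm hf, ← ofReal_integral_norm_eq_lintegral_enorm hG, ← ENNReal.ofReal_mul hM]
  exact ENNReal.ofReal_le_ofReal h1

/-- difference identity -/
lemma diff_id {E₁ E₂ : ES} (h1 : E₁.Reg) (h2 : E₂.Reg) {x : ℝ} (hx : x ∈ Icc (0:ℝ) 1) (t : ℝ) :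
    (E₁.r x t - E₂.r x t) + ∫ s in (0:ℝ)..x, (E₁.r x s - E₂.r x s) * E₂.h (s - t) =
    -((E₁.h (x - t) - E₂.h (x - t)) + ∫ s in (0:ℝ)..x, E₁.r x s * (E₁.h (s - t) - E₂.h (s - t))) := by
  have k1 := E₁.krein h1 hx t
  have k2 := E₂.krein h2 hx t
  have c : ∀ E : ES, Continuous fun s => E.h (s - t) := fun E => E.continuous_h.comp (continuous_id.sub continuous_const)
  have cr : ∀ E : ES, Continuous fun s => E.r x s := fun E => E.continuous_trig _
  have ii : ∀ E E' : ES, IntervalIntegrable (fun s => E.r x s * E'.h (s - t)) volume 0 x := fun E E' => ((cr E).mul (c E')).intervalIntegrable _ _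
  simp only [sub_mul, mul_sub]
  rw [intervalIntegral.integral_sub (ii _ _) (ii _ _), intervalIntegral.integral_sub (ii _ _) (ii _ _)]
  linear_combination k1 - k2

lemma mem_sub_Icc {x s t : ℝ} (hx : x ∈ Icc (0:ℝ) 1) (hs : s ∈ Icc 0 x) (ht : t ∈ Icc 0 x) : s - t ∈ Icc (-1:ℝ) 1 :=
  ⟨by linarith [hs.1, ht.2, hx.2], by linarith [hs.2, ht.1, hx.2]⟩

/-- restricted to full integral comparison -/
lemma enorm_int_le {E₁ : ℝ → ℝ → ℂ} {k : ℝ → ℂ} {k' : ℝ → ℂ} (hk : ∀ u ∈ Icc (-1:ℝ) 1, k u = k' u) {x t : ℝ} (hx : x ∈ Icc (0:ℝ) 1) (ht : t ∈ Icc 0 x) :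
    ‖∫ s in (0:ℝ)..x, E₁ x s * k (s - t)‖ₑ ≤ ∫⁻ s, ‖triI E₁ x s‖ₑ * ‖k' (s - t)‖ₑ := by
  rw [intervalIntegral.integral_of_le hx.1]
  refine (enorm_integral_le_lintegral_enorm _).trans ?_
  refine le_trans (le_of_eq ?_) (setLIntegral_le_lintegral (Ioc 0 x) _)
  refine setLIntegral_congr_fun measurableSet_Ioc fun s hs => ?_
  rw [enorm_mul, triI_of_mem ⟨hs.1.le, hs.2, hx.2⟩, hk _ (mem_sub_Icc hx (Ioc_subset_Icc_self hs) ht)]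

lemma triI_sub (f g : ℝ → ℝ → ℂ) (x t : ℝ) : triI (fun x t => f x t - g x t) x t = triI f x t - triI g x t := by
  by_cases h : (x,t) ∈ Tri
  · simp [triI_of_mem h]
  · simp [triI_of_notMem h]

lemma D_point {E₁ E₂ : ES} (h1 : E₁.Reg) (h2 : E₂.Reg) {x t : ℝ} (h : (x,t) ∈ Tri) :
    ‖E₁.rk x t - E₂.rk x t‖ₑ ≤ ‖E₁.hk (x - t) - E₂.hk (x - t)‖ₑ + (∫⁻ s, ‖E₁.rk x s‖ₑ * ‖E₁.hk (s - t) - E₂.hk (s - t)‖ₑ)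
      + ∫⁻ s, ‖E₁.rk x s - E₂.rk x s‖ₑ * ‖E₂.hk (s - t)‖ₑ := by
  have hx : x ∈ Icc (0:ℝ) 1 := ⟨h.1.trans h.2.1, h.2.2⟩
  have ht : t ∈ Icc 0 x := ⟨h.1, h.2.1⟩
  have hxt := mem_sub_Icc hx (right_mem_Icc.2 hx.1) ht
  have id1 := diff_id h1 h2 hx t
  have e0 : E₁.rk x t - E₂.rk x t = -((E₁.h (x - t) - E₂.h (x - t)) + ∫ s in (0:ℝ)..x, E₁.r x s * (E₁.h (s - t) - E₂.h (s - t))) -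
     ∫ s in (0:ℝ)..x, (E₁.r x s - E₂.r x s) * E₂.h (s - t) := by
    unfold ES.rk
    rw [triI_of_mem h, triI_of_mem h]
    linear_combination id1
  rw [e0]
  refine (enorm_sub_le).trans (add_le_add ?_ ?_)
  · rw [enorm_neg]
    refine (enorm_add_le _ _).trans (add_le_add ?_ ?_)
    · rw [E₁.hk_eq hxt, E₂.hk_eq hxt]
    · exact enorm_int_le (k := fun u => E₁.h u - E₂.h u) (k' := fun u => E₁.hk u - E₂.hk u) (fun u hu => by simp only [E₁.hk_eq hu, E₂.hk_eq hu]) hx ht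
  · have := enorm_int_le (E₁ := fun x t => E₁.r x t - E₂.r x t) (k := E₂.h) (k' := E₂.hk) (fun u hu => (E₂.hk_eq hu).symm) hx ht
    simp only [triI_sub] at this
    exact this

lemma lint_row {f : ℝ → ℝ → ℂ} {x : ℝ} (hx : x ∈ Icc (0:ℝ) 1) : ∫⁻ s, ‖triI f x s‖ₑ = ∫⁻ s in Ioc 0 x, ‖f x s‖ₑ := by
  rw [← setLIntegral_congr_fun (s := Ioc 0 x) (f := fun s => ‖triI f x s‖ₑ) measurableSet_Ioc fun s hs => by simp only [triI_of_mem (f := f) (x := x) (t := s) ⟨hs.1.le, hs.2, hx.2⟩]]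
  rw [← setLIntegral_congr (Ioc_ae_eq_Icc (a := (0:ℝ)) (b := x)).symm]
  symm
  refine setLIntegral_eq_of_support_subset fun s hs => ?_
  by_contra hc
  apply hs
  simp only
  rw [triI_of_notMem, enorm_zero]
  exact fun h => hc ⟨h.1, h.2.1⟩

lemma D_row1 {E₁ E₂ : ES} (h1 : E₁.Reg) (h2 : E₂.Reg) {M : ℝ} (hM : 0 ≤ M) (hLB : LB E₂ M) (x : ℝ) :
    ∫⁻ s, ‖E₁.rk x s - E₂.rk x s‖ₑ ≤ ENNReal.ofReal M * ((1 + ∫⁻ s, ‖E₁.rk x s‖ₑ) * ∫⁻ u, ‖E₁.hk u - E₂.hk u‖ₑ) := by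
  by_cases hx : x ∈ Icc (0:ℝ) 1
  swap
  · have : ∀ s, (x, s) ∉ Tri := fun s h => hx ⟨h.1.trans h.2.1, h.2.2⟩
    simp only [ES.rk, triI_of_notMem (this _)]
    simp
  set k : ℝ → ℝ≥0∞ := fun u => ‖E₁.hk u - E₂.hk u‖ₑ with hk
  have hkm : Measurable k := (E₁.measurable_hk.sub E₂.measurable_hk).enorm
  have hrm : Measurable fun s => ‖E₁.rk x s‖ₑ := (measurable_triI (E₁.cont_tri h1)).of_uncurry_left.enorm
  have e := lint_row (f := fun x t => E₁.r x t - E₂.r x t) hx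
  simp only [triI_sub] at e
  unfold ES.rk
  rw [e]
  have cr : ∀ E : ES, Continuous fun s => E.r x s := fun E => E.continuous_trig _
  refine (hLB.lint hM hx (f := fun s => E₁.r x s - E₂.r x s) (((cr E₁).sub (cr E₂)).intervalIntegrable _ _)).trans ?_
  gcongr
  rw [lintegral_congr fun t => congrArg enorm (diff_id h1 h2 hx t)]
  calc ∫⁻ t in Ioc 0 x, ‖-((E₁.h (x - t) - E₂.h (x - t)) + ∫ s in (0:ℝ)..x, E₁.r x s * (E₁.h (s - t) - E₂.h (s - t)))‖ₑ
      ≤ ∫⁻ t in Ioc 0 x, (k (x - t) + ∫⁻ s, ‖E₁.rk x s‖ₑ * k (s - t)) := by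
        refine setLIntegral_mono' measurableSet_Ioc fun t ht => ?_
        have ht' := Ioc_subset_Icc_self ht
        have hxt := mem_sub_Icc hx (right_mem_Icc.2 hx.1) ht'
        rw [enorm_neg]
        refine (enorm_add_le _ _).trans (add_le_add ?_ ?_)
        · simp only [hk]; rw [E₁.hk_eq hxt, E₂.hk_eq hxt]
        · exact enorm_int_le (k := fun u => E₁.h u - E₂.h u) (k' := fun u => E₁.hk u - E₂.hk u) (fun u hu => by simp only [E₁.hk_eq hu, E₂.hk_eq hu]) hx ht'
    _ ≤ ∫⁻ t, (k (x - t) + ∫⁻ s, ‖E₁.rk x s‖ₑ * k (s - t)) := setLIntegral_le_lintegral _ _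
    _ = (∫⁻ u, k u) + ∫⁻ t, ∫⁻ s, ‖E₁.rk x s‖ₑ * k (s - t) := by
        have hks : Measurable fun t => k (x - t) := hkm.comp (measurable_const.sub measurable_id)
        rw [lintegral_add_left hks, lintegral_sub_left_eq_self k x]
    _ = (1 + ∫⁻ s, ‖E₁.rk x s‖ₑ) * ∫⁻ u, k u := by
        rw [lintegral_lintegral_swap]
        · have : ∀ s, ∫⁻ t, ‖E₁.rk x s‖ₑ * k (s - t) = ‖E₁.rk x s‖ₑ * ∫⁻ u, k u := by
            intro s
            have hks : Measurable fun t => k (s - t) := hkm.comp (measurable_const.sub measurable_id)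
            rw [lintegral_const_mul _ hks, lintegral_sub_left_eq_self k s]
          simp only [this]
          rw [lintegral_mul_const _ hrm, add_mul, one_mul]
        · exact ((hrm.comp measurable_snd).mul (hkm.comp (measurable_snd.sub measurable_fst))).aemeasurable

lemma L1_le_Lp {p : ℝ≥0∞} (hp : 1 ≤ p) {k : ℝ → ℂ} (hk : Measurable k) (h0 : ∀ u ∉ Icc (-1:ℝ) 1, k u = 0) :
    ∫⁻ u, ‖k u‖ₑ ≤ 2 * eLpNorm k p volume := by
  have h1 : ∫⁻ u, ‖k u‖ₑ = eLpNorm k 1 (volume.restrict (Icc (-1) 1)) := by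
    rw [eLpNorm_one_eq_lintegral_enorm]
    symm
    refine setLIntegral_eq_of_support_subset fun s hs => ?_
    by_contra hc
    exact hs (by simp [h0 s hc])
  rw [h1]
  refine (eLpNorm_le_eLpNorm_mul_rpow_measure_univ hp hk.aestronglyMeasurable).trans ?_
  rw [mul_comm]
  refine mul_le_mul' ?_ (eLpNorm_restrict_le _ _ _ _)
  rw [Measure.restrict_apply_univ, Real.volume_Icc]
  norm_num
  calc (2:ℝ≥0∞) ^ (1 - p.toReal⁻¹) ≤ 2 ^ (1:ℝ) := ENNReal.rpow_le_rpow_of_exponent_le (by norm_num) (by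
        have : 0 ≤ p.toReal⁻¹ := by positivity
        linarith)
    _ = 2 := ENNReal.rpow_one _

structure Good (p : ℝ≥0∞) (E : ES) (M B : ℝ) (Λ : ℝ≥0∞) : Prop where
  reg : E.Reg
  lb : LB E M
  ref : ∃ E' : ES, (∀ u, ‖E'.h u‖ ≤ B) ∧ ∫ u in (-1:ℝ)..1, ‖E.h u - E'.h u‖ ≤ 1/2
  lp : eLpNorm E.hk p volume ≤ Λ

lemma zeroES_rk (x t : ℝ) : zeroES.rk x t = 0 := by
  unfold ES.rk triI
  by_cases h : (x,t) ∈ Tri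
  · rw [indicator_of_mem h]; exact zeroES_r _ _
  · rw [indicator_of_notMem h]

lemma zeroES_hk (u : ℝ) : zeroES.hk u = 0 := by
  unfold ES.hk
  by_cases h : u ∈ Icc (-1:ℝ) 1
  · rw [indicator_of_mem h]; exact zeroES_h _
  · rw [indicator_of_notMem h]

lemma ES.hk_out (E : ES) : ∀ u ∉ Icc (-1:ℝ) 1, E.hk u = 0 := fun _ hu => indicator_of_notMem hu _

lemma D_slice {p : ℝ≥0∞} (hp : 1 ≤ p) (hp' : p ≠ ∞) {E₁ E₂ : ES} {M B : ℝ} {Λ : ℝ≥0∞} (h1 : E₁.Reg) (h2 : Good p E₂ M B Λ)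
    {N S : ℝ≥0∞} (hN : ∀ x, ∫⁻ s, ‖E₁.rk x s - E₂.rk x s‖ₑ ≤ N) {a : ℝ} (ha : a ≤ 1/2)
    (hS : ∀ b, eLpNorm (fun x => E₁.rk x (a * x + b)) p volume ≤ S) (b : ℝ) :
    eLpNorm (fun x => E₁.rk x (a * x + b) - E₂.rk x (a * x + b)) p volume ≤
      2 * (2 * eLpNorm (fun u => E₁.hk u - E₂.hk u) p volume + (∫⁻ u, ‖E₁.hk u - E₂.hk u‖ₑ) * S + ENNReal.ofReal B * N) := by
  obtain ⟨E', hB, hE'⟩ := h2.ref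
  obtain ⟨C1, hC1, hb1⟩ := bdd_triI (E₁.cont_tri h1)
  obtain ⟨C2, hC2, hb2⟩ := bdd_triI (E₂.cont_tri h2.reg)
  have m1 := measurable_triI (E₁.cont_tri h1)
  have m2 := measurable_triI (E₂.cont_tri h2.reg)
  have key := slice_est hp hp' (d := fun x t => ‖E₁.rk x t - E₂.rk x t‖ₑ) (ρ := fun x t => ‖E₁.rk x t‖ₑ)
    (g := fun u => ‖E₁.hk u - E₂.hk u‖ₑ) (η := fun u => ‖E₂.hk u‖ₑ) (η' := fun u => ‖E₂.hk u - E'.hk u‖ₑ)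
    (C := ENNReal.ofReal (C1 + C2)) (B := ENNReal.ofReal B) (N := N) (S := S) m1.enorm (m1.sub m2).enorm
    (E₁.measurable_hk.sub E₂.measurable_hk).enorm (E₂.measurable_hk.sub E'.measurable_hk).enorm ENNReal.ofReal_ne_top
    (fun x t => by
      rw [← ofReal_norm]
      exact ENNReal.ofReal_le_ofReal ((norm_sub_le _ _).trans (add_le_add (hb1 _ _) (hb2 _ _))))
    (fun x t h => by simp [ES.rk, triI_of_notMem h])
    (fun x t h => D_point h1 h2.reg h)
    (fun u => by
      have : ‖E₂.hk u‖ₑ ≤ ‖E'.hk u‖ₑ + ‖E₂.hk u - E'.hk u‖ₑ := by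
        calc ‖E₂.hk u‖ₑ = ‖E'.hk u + (E₂.hk u - E'.hk u)‖ₑ := by congr 1; ring
          _ ≤ _ := enorm_add_le _ _
      refine this.trans (add_le_add ?_ le_rfl)
      by_cases hu : u ∈ Icc (-1:ℝ) 1
      · rw [E'.hk_eq hu, ← ofReal_norm]; exact ENNReal.ofReal_le_ofReal (hB u)
      · rw [E'.hk_out u hu]; simp)
    (by
      have e : ∫⁻ u, ‖E₂.hk u - E'.hk u‖ₑ = ∫⁻ u in Ioc (-1) 1, ‖E₂.h u - E'.h u‖ₑ := by
        rw [setLIntegral_congr (Ioc_ae_eq_Icc (a := (-1:ℝ)) (b := 1))]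
        rw [← setLIntegral_congr_fun (s := Icc (-1:ℝ) 1) (f := fun u => ‖E₂.hk u - E'.hk u‖ₑ) measurableSet_Icc
          fun u hu => by simp only [E₂.hk_eq hu, E'.hk_eq hu]]
        symm
        refine setLIntegral_eq_of_support_subset fun s hs => ?_
        by_contra hc
        exact hs (by simp [E₂.hk_out s hc, E'.hk_out s hc])
      have hi : IntegrableOn (fun u => E₂.h u - E'.h u) (Ioc (-1) 1) := by
        rw [← intervalIntegrable_iff_integrableOn_Ioc_of_le (by norm_num)]
        exact (E₂.continuous_h.sub E'.continuous_h).intervalIntegrable _ _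
      rw [e, ← ofReal_integral_norm_eq_lintegral_enorm hi, ← intervalIntegral.integral_of_le (by norm_num)]
      refine (ENNReal.ofReal_le_ofReal hE').trans_eq ?_
      rw [one_div, ENNReal.ofReal_inv_of_pos (by norm_num)]; simp)
    hN ha (fun b => by rw [eLpNorm_enorm]; exact hS b) b
  rw [eLpNorm_enorm, eLpNorm_enorm] at key
  exact key

lemma D_rowp {p : ℝ≥0∞} (hp : 1 ≤ p) (hp' : p ≠ ∞) {E₁ E₂ : ES} (h1 : E₁.Reg) (h2 : E₂.Reg) (x : ℝ) :
    eLpNorm (fun t => E₁.rk x t - E₂.rk x t) p volume ≤ eLpNorm (fun u => E₁.hk u - E₂.hk u) p volume +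
      (∫⁻ s, ‖E₁.rk x s‖ₑ) * eLpNorm (fun u => E₁.hk u - E₂.hk u) p volume + (∫⁻ s, ‖E₁.rk x s - E₂.rk x s‖ₑ) * eLpNorm E₂.hk p volume := by
  have m1 := measurable_triI (E₁.cont_tri h1)
  have m2 := measurable_triI (E₂.cont_tri h2)
  have key := row_est hp hp' (d := fun t => ‖E₁.rk x t - E₂.rk x t‖ₑ) (ρ := fun t => ‖E₁.rk x t‖ₑ)
    (g := fun u => ‖E₁.hk u - E₂.hk u‖ₑ) (η := fun u => ‖E₂.hk u‖ₑ) m1.of_uncurry_left.enorm (m1.of_uncurry_left.sub m2.of_uncurry_left).enorm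
    (E₁.measurable_hk.sub E₂.measurable_hk).enorm E₂.measurable_hk.enorm (x := x) (fun t => by
      by_cases h : (x,t) ∈ Tri
      · exact D_point h1 h2 h
      · simp [ES.rk, triI_of_notMem h])
  rw [eLpNorm_enorm, eLpNorm_enorm, eLpNorm_enorm] at key
  exact key

/-- main Cauchy estimate -/
lemma cauchy_est {p : ℝ≥0∞} (hp : 1 ≤ p) (hp' : p ≠ ∞) {M B : ℝ} (hM : 0 ≤ M) {Λ : ℝ≥0∞} (hΛ : Λ ≠ ∞) :
    ∃ C : ℝ≥0∞, C ≠ ∞ ∧ ∀ E₁ E₂ : ES, Good p E₁ M B Λ → Good p E₂ M B Λ →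
      (∀ x, eLpNorm (fun t => E₁.rk x t - E₂.rk x t) p volume ≤ C * eLpNorm (fun u => E₁.hk u - E₂.hk u) p volume) ∧
      (∀ a ≤ (1/2:ℝ), ∀ b, eLpNorm (fun x => E₁.rk x (a * x + b) - E₂.rk x (a * x + b)) p volume ≤ C * eLpNorm (fun u => E₁.hk u - E₂.hk u) p volume) := by
  set m := ENNReal.ofReal M with hm
  set β := ENNReal.ofReal B with hβ
  set ρ1 : ℝ≥0∞ := m * (2 * Λ) with hρ1
  set Sr : ℝ≥0∞ := 2 * (2 * Λ + β * ρ1) with hSr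
  set n1 : ℝ≥0∞ := m * ((1 + ρ1) * 2) with hn1
  have fm : m ≠ ∞ := ENNReal.ofReal_ne_top
  have fβ : β ≠ ∞ := ENNReal.ofReal_ne_top
  have fρ : ρ1 ≠ ∞ := by simp only [hρ1]; finiteness
  have fS : Sr ≠ ∞ := by simp only [hSr]; finiteness
  have fn : n1 ≠ ∞ := by simp only [hn1]; finiteness
  refine ⟨(1 + ρ1 + n1 * Λ) + 2 * (2 + 2 * Sr + β * n1), by finiteness, ?_⟩
  have neg_fix : ∀ (f : ℝ → ℂ), eLpNorm (fun x => 0 - f x) p volume = eLpNorm f p volume := fun f => by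
    simp only [zero_sub]; exact eLpNorm_neg f p volume
  have r1 : ∀ E : ES, Good p E M B Λ → ∀ x, ∫⁻ s, ‖E.rk x s‖ₑ ≤ ρ1 := by
    intro E hE x
    have h := D_row1 zeroES_reg hE.reg hM hE.lb x
    simp only [zeroES_rk, zeroES_hk, zero_sub, enorm_neg, enorm_zero, lintegral_zero, add_zero, one_mul] at h
    refine h.trans ?_
    rw [hρ1]
    gcongr
    exact (L1_le_Lp hp E.measurable_hk E.hk_out).trans (mul_le_mul_right hE.lp 2)
  have rS : ∀ E : ES, Good p E M B Λ → ∀ a ≤ (1/2:ℝ), ∀ b, eLpNorm (fun x => E.rk x (a * x + b)) p volume ≤ Sr := by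
    intro E hE a ha b
    have h := D_slice hp hp' zeroES_reg hE (N := ρ1) (S := 0) (fun x => by simpa [zeroES_rk] using r1 E hE x) ha (fun b => by simp [zeroES_rk]) b
    simp only [zeroES_rk, zeroES_hk, neg_fix, mul_zero, add_zero] at h
    refine h.trans ?_
    rw [hSr]
    gcongr
    exact hE.lp
  intro E₁ E₂ h1 h2
  set δ := eLpNorm (fun u => E₁.hk u - E₂.hk u) p volume with hδ
  have l1 : ∫⁻ u, ‖E₁.hk u - E₂.hk u‖ₑ ≤ 2 * δ := L1_le_Lp hp (E₁.measurable_hk.sub E₂.measurable_hk) fun u hu => by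
    rw [E₁.hk_out u hu, E₂.hk_out u hu, sub_zero]
  have d1 : ∀ x, ∫⁻ s, ‖E₁.rk x s - E₂.rk x s‖ₑ ≤ n1 * δ := by
    intro x
    refine (D_row1 h1.reg h2.reg hM h2.lb x).trans ?_
    rw [hn1, mul_assoc, mul_assoc]
    gcongr
    exact r1 E₁ h1 x
  constructor
  · intro x
    refine (D_rowp hp hp' h1.reg h2.reg x).trans ?_
    calc δ + (∫⁻ s, ‖E₁.rk x s‖ₑ) * δ + (∫⁻ s, ‖E₁.rk x s - E₂.rk x s‖ₑ) * eLpNorm E₂.hk p volume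
        ≤ δ + ρ1 * δ + (n1 * δ) * Λ := by
          gcongr
          · exact r1 E₁ h1 x
          · exact d1 x
          · exact h2.lp
      _ = (1 + ρ1 + n1 * Λ) * δ := by ring
      _ ≤ _ := mul_le_mul' le_self_add le_rfl
  · intro a ha b
    refine (D_slice hp hp' h1.reg h2 d1 ha (rS E₁ h1 a ha) b).trans ?_
    calc 2 * (2 * δ + (∫⁻ u, ‖E₁.hk u - E₂.hk u‖ₑ) * Sr + β * (n1 * δ)) ≤ 2 * (2 * δ + (2 * δ) * Sr + β * (n1 * δ)) := by gcongr
      _ = (2 * (2 + 2 * Sr + β * n1)) * δ := by ring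
      _ ≤ _ := mul_le_mul' le_add_self le_rfl

def PhiF (z : ℂ) : M2 := !![(z.re : ℂ), (z.im : ℂ); -(z.im : ℂ), (z.re : ℂ)]

def PhiL : ℂ →L[ℝ] M2 := LinearMap.toContinuousLinearMap
  { toFun := PhiF
    map_add' := fun a b => by
      ext i j; fin_cases i <;> fin_cases j <;> simp [PhiF]; ring
    map_smul' := fun c a => by
      ext i j; fin_cases i <;> fin_cases j <;> simp [PhiF] }

lemma PhiL_apply (z : ℂ) : PhiL z = PhiF z := rfl

lemma enorm_Phi_le (L : ℂ →L[ℝ] M2) (z : ℂ) : ‖L z‖ ≤ ‖L‖ * ‖z‖ := L.le_opNorm z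

instance : IsFiniteMeasure μ01 := inferInstance

/-- bounded convergence in `L_p` -/
lemma bdd_conv {p : ℝ≥0∞} (hp : 1 ≤ p) (hp' : p ≠ ∞) {F : Type*} [NormedAddCommGroup F] {ι : Type*} {l : Filter ι} [l.IsCountablyGenerated]
    {f : ι → ℝ → F} (hm : ∀ i, AEStronglyMeasurable (f i) μ01) {C : ℝ} (hC : ∀ i x, ‖f i x‖ ≤ C)
    (h0 : ∀ᵐ x ∂μ01, Tendsto (fun i => f i x) l (nhds 0)) : Tendsto (fun i => eLpNorm (f i) p μ01) l (nhds 0) := by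
  have hp0 : p ≠ 0 := (lt_of_lt_of_le one_pos hp).ne'
  have hpr : 0 < p.toReal := ENNReal.toReal_pos hp0 hp'
  simp only [eLpNorm_eq_lintegral_rpow_enorm_toReal hp0 hp']
  have key : Tendsto (fun i => ∫⁻ x, ‖f i x‖ₑ ^ p.toReal ∂μ01) l (nhds (∫⁻ _, 0 ∂μ01)) := by
    refine tendsto_lintegral_filter_of_dominated_convergence' (fun _ => (ENNReal.ofReal C) ^ p.toReal) ?_ ?_ ?_ ?_
    · exact Eventually.of_forall fun i => (hm i).enorm.pow_const _
    · refine Eventually.of_forall fun i => Eventually.of_forall fun x => ?_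
      rw [← ofReal_norm]
      gcongr
      exact hC i x
    · rw [lintegral_const]
      exact ENNReal.mul_ne_top (ENNReal.rpow_ne_top_of_nonneg hpr.le ENNReal.ofReal_ne_top) (measure_ne_top _ _)
    · filter_upwards [h0] with x hx
      have h1 : Tendsto (fun i => ‖f i x‖ₑ) l (nhds 0) := by simpa using hx.enorm
      have h2 := (ENNReal.continuous_rpow_const (y := p.toReal)).tendsto 0
      rw [ENNReal.zero_rpow_of_pos hpr] at h2
      exact h2.comp h1
  rw [lintegral_zero] at key
  have h2 := (ENNReal.continuous_rpow_const (y := 1 / p.toReal)).tendsto 0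
  rw [ENNReal.zero_rpow_of_pos (by positivity)] at h2
  exact h2.comp key

lemma eps_form {f : ℝ → ℝ≥0∞} {x₀ : ℝ} (h : Tendsto f (nhdsWithin x₀ (Icc 0 1)) (nhds 0)) :
    ∀ ε > (0:ℝ), ∃ δ > (0:ℝ), ∀ x ∈ Set.Icc (0:ℝ) 1, |x - x₀| < δ → f x < ENNReal.ofReal ε := by
  intro ε hε
  have h1 := h.eventually_lt_const (ENNReal.ofReal_pos.2 hε)
  rw [eventually_nhdsWithin_iff, Metric.eventually_nhds_iff] at h1
  obtain ⟨δ, hδ, h1⟩ := h1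
  exact ⟨δ, hδ, fun x hx hd => h1 (by rwa [Real.dist_eq]) hx⟩

lemma cont_off_diag {P : ℝ → ℝ → M2} (hP : ContinuousOn (Function.uncurry P) Tri)
    (h0 : ∀ x t, (x,t) ∉ Tri → P x t = 0) {x t : ℝ} (hx : x ∈ Icc (0:ℝ) 1) (ht : t ∈ Icc (0:ℝ) 1) (hxt : x ≠ t) :
    ContinuousWithinAt (Function.uncurry P) (Icc (0:ℝ) 1 ×ˢ Icc (0:ℝ) 1) (x, t) := by
  rcases lt_or_gt_of_ne hxt with h | h
  · have h1 : ∀ᶠ z : ℝ × ℝ in nhds (x,t), z.1 < z.2 := (isOpen_lt continuous_fst continuous_snd).mem_nhds h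
    have h2 : Function.uncurry P =ᶠ[nhds (x,t)] fun _ => 0 := by
      filter_upwards [h1] with z hz
      exact h0 z.1 z.2 fun hc => absurd hc.2.1 (not_le.2 hz)
    exact (continuousAt_const.congr h2.symm).continuousWithinAt
  · have h1 : ∀ᶠ z : ℝ × ℝ in nhds (x,t), z.2 < z.1 := (isOpen_lt continuous_snd continuous_fst).mem_nhds h
    refine (hP (x,t) ⟨ht.1, h.le, hx.2⟩).mono_of_mem_nhdsWithin ?_
    filter_upwards [mem_nhdsWithin_of_mem_nhds h1, self_mem_nhdsWithin] with z hz hz'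
    exact ⟨hz'.2.1, le_of_lt hz, hz'.1.2⟩

lemma memGp_of_cont {p : ℝ≥0∞} (hp : 1 ≤ p) (hp' : p ≠ ∞) {P : ℝ → ℝ → M2} (hP : ContinuousOn (Function.uncurry P) Tri)
    (h0 : ∀ x t, (x,t) ∉ Tri → P x t = 0) : StronglyMeasurable (Function.uncurry P) ∧ MemGp p P := by
  have hm : StronglyMeasurable (Function.uncurry P) := by
    classical
    borelize M2
    have h := hP.measurable_piecewise (g := fun _ => (0:M2)) continuousOn_const measurableSet_Tri
    have h1 : Function.uncurry P = Tri.piecewise (Function.uncurry P) (fun _ => 0) := by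
      funext z
      by_cases hz : z ∈ Tri
      · rw [piecewise_eq_of_mem _ _ _ hz]
      · rw [piecewise_eq_of_notMem _ _ _ hz]; exact h0 _ _ hz
    rw [h1]
    exact h.stronglyMeasurable
  have hr : ∀ x, StronglyMeasurable (P x) := fun x => hm.comp_measurable measurable_prodMk_left
  have hc : ∀ t, StronglyMeasurable (fun x => P x t) := fun t => hm.comp_measurable (measurable_id.prodMk measurable_const)
  obtain ⟨C, hC⟩ : ∃ C : ℝ, ∀ x t, ‖P x t‖ ≤ C := by
    obtain ⟨C, hC⟩ := isCompact_Tri.exists_bound_of_continuousOn hP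
    refine ⟨max C 0, fun x t => ?_⟩
    by_cases hz : (x,t) ∈ Tri
    · exact (hC _ hz).trans (le_max_left _ _)
    · rw [h0 _ _ hz, norm_zero]; exact le_max_right _ _
  have hne : ∀ y : ℝ, ∀ᵐ t ∂μ01, t ≠ y := fun y => ae_restrict_of_ae (by simp [ae_iff])
  have hin : ∀ᵐ t ∂μ01, t ∈ Icc (0:ℝ) 1 := by
    filter_upwards [ae_restrict_mem measurableSet_Ioo] with t ht using Ioo_subset_Icc_self ht
  refine ⟨hm, fun x _ => ?_, fun t _ => ?_, fun x₀ hx₀ => ?_, fun t₀ ht₀ => ?_⟩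
  · exact MemLp.of_bound (hr x).aestronglyMeasurable C (Eventually.of_forall fun t => hC x t)
  · exact MemLp.of_bound (hc t).aestronglyMeasurable C (Eventually.of_forall fun x => hC x t)
  · refine eps_form (f := fun x => eLpNorm (fun t => P x t - P x₀ t) p μ01) (bdd_conv hp hp' (fun x => ((hr x).sub (hr x₀)).aestronglyMeasurable)
      (C := C + C) (fun x t => (norm_sub_le _ _).trans (add_le_add (hC _ _) (hC _ _))) ?_)
    filter_upwards [hne x₀, hin] with t ht ht'
    have h1 := cont_off_diag hP h0 hx₀ ht' ht.symm
    have h2 : Tendsto (fun x : ℝ => (x, t)) (nhdsWithin x₀ (Icc 0 1)) (nhdsWithin (x₀, t) (Icc (0:ℝ) 1 ×ˢ Icc (0:ℝ) 1)) := by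
      refine tendsto_nhdsWithin_iff.2 ⟨(Continuous.prodMk_left t).continuousAt.tendsto.mono_left nhdsWithin_le_nhds, ?_⟩
      filter_upwards [self_mem_nhdsWithin] with x hx using ⟨hx, ht'⟩
    have h3 : Tendsto (fun x => P x t) (nhdsWithin x₀ (Icc 0 1)) (nhds (P x₀ t)) := h1.tendsto.comp h2
    simpa using h3.sub_const (P x₀ t)
  · refine eps_form (f := fun t => eLpNorm (fun x => P x t - P x t₀) p μ01) (bdd_conv hp hp' (fun t => ((hc t).sub (hc t₀)).aestronglyMeasurable)
      (C := C + C) (fun x t => (norm_sub_le _ _).trans (add_le_add (hC _ _) (hC _ _))) ?_)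
    filter_upwards [hne t₀, hin] with x hx hx'
    have h1 := cont_off_diag hP h0 hx' ht₀ hx
    have h2 : Tendsto (fun t : ℝ => (x, t)) (nhdsWithin t₀ (Icc 0 1)) (nhdsWithin (x, t₀) (Icc (0:ℝ) 1 ×ˢ Icc (0:ℝ) 1)) := by
      refine tendsto_nhdsWithin_iff.2 ⟨(Continuous.prodMk_right x).continuousAt.tendsto.mono_left nhdsWithin_le_nhds, ?_⟩
      filter_upwards [self_mem_nhdsWithin] with t ht using ⟨hx', ht⟩
    have h3 : Tendsto (fun t => P x t) (nhdsWithin t₀ (Icc 0 1)) (nhds (P x t₀)) := h1.tendsto.comp h2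
    simpa using h3.sub_const (P x t₀)

/-- abstract limit of slices -/
lemma lim_slice {p : ℝ≥0∞} (hp : 1 ≤ p) {f : ℕ → ℝ → M2} {g : ℝ → M2} (hf : ∀ n, MemLp (f n) p μ01) {ε : ℕ → ℝ≥0∞} (hε : ∀ n, ε n ≠ ∞) (hs : ∑' n, ε n ≠ ∞)
    (hc : ∀ N n m, N ≤ n → N ≤ m → eLpNorm (fun t => f n t - f m t) p μ01 < ε N)
    (hg : ∀ t, (∃ l, Tendsto (fun n => f n t) atTop (nhds l)) → Tendsto (fun n => f n t) atTop (nhds (g t))) :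
    MemLp g p μ01 ∧ ∀ n, eLpNorm (fun t => f n t - g t) p μ01 ≤ ε n := by
  have hae : ∀ᵐ t ∂μ01, Tendsto (fun n => f n t) atTop (nhds (g t)) := by
    filter_upwards [Lp.ae_tendsto_of_cauchy_eLpNorm (fun n => (hf n).1) hp hs hc] with t ht using hg t ht
  have hgm : AEStronglyMeasurable g μ01 := aestronglyMeasurable_of_tendsto_ae atTop (fun n => (hf n).1) hae
  have hb : ∀ n, eLpNorm (fun t => f n t - g t) p μ01 ≤ ε n := by
    intro n
    refine (Lp.eLpNorm_lim_le_liminf_eLpNorm (f := fun m t => f n t - f m t) (fun m => (hf n).1.sub (hf m).1) _ ?_).trans ?_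
    · filter_upwards [hae] with t ht using ht.const_sub _
    · refine liminf_le_of_frequently_le' (Eventually.frequently ?_)
      filter_upwards [eventually_ge_atTop n] with m hm using (hc n n m le_rfl hm).le
  refine ⟨?_, hb⟩
  have h1 : MemLp (fun t => f 0 t - g t) p μ01 := ⟨(hf 0).1.sub hgm, (hb 0).trans_lt (hε 0).lt_top⟩
  have h2 := (hf 0).sub h1
  refine h2.ae_eq (Eventually.of_forall fun t => ?_)
  simp

open Classical in
def limK (P : ℕ → ℝ → ℝ → M2) (x t : ℝ) : M2 :=
  if h : ∃ l, Tendsto (fun n => P n x t) atTop (nhds l) then h.choose else 0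

lemma limK_tendsto (P : ℕ → ℝ → ℝ → M2) (x t : ℝ) (h : ∃ l, Tendsto (fun n => P n x t) atTop (nhds l)) :
    Tendsto (fun n => P n x t) atTop (nhds (limK P x t)) := by
  unfold limK
  rw [dif_pos h]; exact h.choose_spec

lemma limK_mem {P : ℕ → ℝ → ℝ → M2} {x t : ℝ} {S : Set M2} (hS : IsClosed S) (h0 : (0:M2) ∈ S) (h : ∀ n, P n x t ∈ S) : limK P x t ∈ S := by
  by_cases hl : ∃ l, Tendsto (fun n => P n x t) atTop (nhds l)
  · exact hS.mem_of_tendsto (limK_tendsto P x t hl) (Eventually.of_forall h)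
  · unfold limK; rwa [dif_neg hl]

lemma cont_pass {p : ℝ≥0∞} (hp : 1 ≤ p) {f : ℕ → ℝ → ℝ → M2} {g : ℝ → ℝ → M2} {ε : ℕ → ℝ≥0∞} (hε : Tendsto ε atTop (nhds 0))
    (hf : ∀ n, ∀ x ∈ Icc (0:ℝ) 1, MemLp (f n x) p μ01) (hg : ∀ x ∈ Icc (0:ℝ) 1, MemLp (g x) p μ01)
    (hfg : ∀ n, ∀ x ∈ Icc (0:ℝ) 1, eLpNorm (fun t => f n x t - g x t) p μ01 ≤ ε n)
    (hc : ∀ n, ∀ x₀ ∈ Set.Icc (0:ℝ) 1, ∀ ε > (0:ℝ), ∃ δ > (0:ℝ), ∀ x ∈ Set.Icc (0:ℝ) 1,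
      |x - x₀| < δ → eLpNorm (fun t => f n x t - f n x₀ t) p μ01 < ENNReal.ofReal ε) :
    ∀ x₀ ∈ Set.Icc (0:ℝ) 1, ∀ ε > (0:ℝ), ∃ δ > (0:ℝ), ∀ x ∈ Set.Icc (0:ℝ) 1,
      |x - x₀| < δ → eLpNorm (fun t => g x t - g x₀ t) p μ01 < ENNReal.ofReal ε := by
  intro x₀ hx₀ e he
  obtain ⟨n, hn⟩ := (hε.eventually_lt_const (ENNReal.ofReal_pos.2 (show 0 < e/3 by positivity))).exists
  obtain ⟨δ, hδ, h⟩ := hc n x₀ hx₀ (e/3) (by positivity)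
  refine ⟨δ, hδ, fun x hx hd => ?_⟩
  have e1 : (fun t => g x t - g x₀ t) = (fun t => -(f n x t - g x t)) + ((fun t => f n x t - f n x₀ t) + fun t => f n x₀ t - g x₀ t) := by
    funext t; simp only [Pi.add_apply]; abel
  have m1 : AEStronglyMeasurable (fun t => -(f n x t - g x t)) μ01 := ((hf n x hx).1.sub (hg x hx).1).neg
  have m2 : AEStronglyMeasurable (fun t => f n x t - f n x₀ t) μ01 := (hf n x hx).1.sub (hf n x₀ hx₀).1
  have m3 : AEStronglyMeasurable (fun t => f n x₀ t - g x₀ t) μ01 := (hf n x₀ hx₀).1.sub (hg x₀ hx₀).1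
  have e2 : eLpNorm (fun t => -(f n x t - g x t)) p μ01 = eLpNorm (fun t => f n x t - g x t) p μ01 := eLpNorm_neg (fun t => f n x t - g x t) p μ01
  rw [e1]
  refine (eLpNorm_add_le m1 (m2.add m3) hp).trans_lt ?_
  have e3 : ENNReal.ofReal e = ENNReal.ofReal (e/3) + (ENNReal.ofReal (e/3) + ENNReal.ofReal (e/3)) := by
    rw [← ENNReal.ofReal_add (by positivity) (by positivity), ← ENNReal.ofReal_add (by positivity) (by positivity)]
    congr 1; ring
  rw [e2, e3]
  refine ENNReal.add_lt_add ((hfg n x hx).trans_lt hn) ((eLpNorm_add_le m2 m3 hp).trans_lt ?_)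
  exact ENNReal.add_lt_add (h x hx hd) ((hfg n x₀ hx₀).trans_lt hn)

/-- limit of kernels in `G_p` -/
lemma limK_Gp {p : ℝ≥0∞} (hp : 1 ≤ p) {P : ℕ → ℝ → ℝ → M2} (hP : ∀ n, MemGp p (P n)) {ε : ℕ → ℝ≥0∞} (hε : ∀ n, ε n ≠ ∞) (hs : ∑' n, ε n ≠ ∞)
    (hr : ∀ N n m, N ≤ n → N ≤ m → ∀ x ∈ Icc (0:ℝ) 1, eLpNorm (fun t => P n x t - P m x t) p μ01 < ε N)
    (hc : ∀ N n m, N ≤ n → N ≤ m → ∀ t ∈ Icc (0:ℝ) 1, eLpNorm (fun x => P n x t - P m x t) p μ01 < ε N) :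
    MemGp p (limK P) ∧ (∀ n, ∀ x ∈ Icc (0:ℝ) 1, eLpNorm (fun t => P n x t - limK P x t) p μ01 ≤ ε n) ∧
      (∀ n, ∀ t ∈ Icc (0:ℝ) 1, eLpNorm (fun x => P n x t - limK P x t) p μ01 ≤ ε n) := by
  have R := fun x (hx : x ∈ Icc (0:ℝ) 1) => lim_slice hp (f := fun n => P n x) (g := limK P x) (fun n => (hP n).1 x hx) hε hs
    (fun N n m h1 h2 => hr N n m h1 h2 x hx) (fun t h => limK_tendsto P x t h)
  have C := fun t (ht : t ∈ Icc (0:ℝ) 1) => lim_slice hp (f := fun n x => P n x t) (g := fun x => limK P x t) (fun n => (hP n).2.1 t ht) hε hs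
    (fun N n m h1 h2 => hc N n m h1 h2 t ht) (fun x h => limK_tendsto P x t h)
  have h0 : Tendsto ε atTop (nhds 0) := ENNReal.tendsto_atTop_zero_of_tsum_ne_top hs
  refine ⟨⟨fun x hx => (R x hx).1, fun t ht => (C t ht).1, ?_, ?_⟩, fun n x hx => (R x hx).2 n, fun n t ht => (C t ht).2 n⟩
  · exact cont_pass hp h0 (fun n x hx => (hP n).1 x hx) (fun x hx => (R x hx).1) (fun n x hx => (R x hx).2 n) (fun n => (hP n).2.2.1)
  · exact cont_pass hp h0 (f := fun n t x => P n x t) (g := fun t x => limK P x t) (fun n x hx => (hP n).2.1 x hx) (fun x hx => (C x hx).1) (fun n x hx => (C x hx).2 n) (fun n => (hP n).2.2.2)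

def ES.RK (E : ES) (x t : ℝ) : M2 := PhiL (E.rk x t)
def ES.kk (E : ES) (σ : ℝ) : ℝ → ℝ → ℂ := triI (fun x t => E.r x ((x + σ * t)/2))
def ES.KK (E : ES) (x t : ℝ) : M2 := (2:ℂ)⁻¹ • (PhiL (E.kk 1 x t) + PhiL (E.kk (-1) x t) * Jmat)

lemma ES.cont_kk {E : ES} (hE : E.Reg) (σ : ℝ) : ContinuousOn (Function.uncurry fun x t => E.r x ((x + σ * t)/2)) Tri := by
  refine (E.continuousOn_r hE).comp (f := fun z : ℝ × ℝ => (z.1, (z.1 + σ * z.2)/2)) (Continuous.continuousOn (by fun_prop)) ?_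
  intro z hz
  exact ⟨⟨hz.1.trans hz.2.1, hz.2.2⟩, mem_univ _⟩

lemma ES.contOn_triI {f : ℝ → ℝ → ℂ} (hf : ContinuousOn (Function.uncurry f) Tri) : ContinuousOn (Function.uncurry (triI f)) Tri :=
  hf.congr fun z hz => triI_of_mem (x := z.1) (t := z.2) hz

lemma ES.RK_Gp {p : ℝ≥0∞} (hp : 1 ≤ p) (hp' : p ≠ ∞) {E : ES} (hE : E.Reg) : StronglyMeasurable (Function.uncurry E.RK) ∧ MemGp p E.RK := by
  refine memGp_of_cont hp hp' ?_ ?_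
  · exact PhiL.continuous.comp_continuousOn (ES.contOn_triI (E.cont_tri hE))
  · intro x t h
    simp [ES.RK, ES.rk, triI_of_notMem h]

lemma ES.KK_Gp {p : ℝ≥0∞} (hp : 1 ≤ p) (hp' : p ≠ ∞) {E : ES} (hE : E.Reg) : StronglyMeasurable (Function.uncurry E.KK) ∧ MemGp p E.KK := by
  refine memGp_of_cont hp hp' ?_ ?_
  · have h1 := PhiL.continuous.comp_continuousOn (ES.contOn_triI (ES.cont_kk hE 1))
    have h2 := PhiL.continuous.comp_continuousOn (ES.contOn_triI (ES.cont_kk hE (-1)))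
    exact (h1.add (h2.mul continuousOn_const)).const_smul ((2:ℂ)⁻¹)
  · intro x t h
    simp [ES.KK, ES.kk, triI_of_notMem h]

lemma kk_eq (E : ES) {σ : ℝ} (hσ : σ = 1 ∨ σ = -1) {x t : ℝ} (ht : t ∈ Icc (0:ℝ) 1) : E.kk σ x t = E.rk x ((x + σ * t)/2) := by
  unfold ES.kk ES.rk
  by_cases h : (x,t) ∈ Tri
  · rw [triI_of_mem h, triI_of_mem]
    obtain ⟨h1, h2, h3⟩ := h
    simp only at h1 h2 h3
    refine ⟨?_, ?_, h3⟩ <;> rcases hσ with rfl | rfl <;> simp only <;> linarith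
  · rw [triI_of_notMem h, triI_of_notMem]
    intro hc
    obtain ⟨h1, h2, h3⟩ := hc
    simp only at h1 h2 h3
    refine h ⟨ht.1, ?_, h3⟩
    rcases hσ with rfl | rfl <;> simp only <;> linarith

lemma ae_in01 : ∀ᵐ t ∂μ01, t ∈ Icc (0:ℝ) 1 := by
  filter_upwards [ae_restrict_mem measurableSet_Ioo] with t ht using Ioo_subset_Icc_self ht

lemma kk_cauchy {p : ℝ≥0∞} (hp : 1 ≤ p) (hp' : p ≠ ∞) {E₁ E₂ : ES} (h1 : E₁.Reg) (h2 : E₂.Reg) {δ : ℝ≥0∞}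
    (hr : ∀ x, eLpNorm (fun t => E₁.rk x t - E₂.rk x t) p volume ≤ δ)
    (hc : ∀ a ≤ (1/2:ℝ), ∀ b, eLpNorm (fun x => E₁.rk x (a * x + b) - E₂.rk x (a * x + b)) p volume ≤ δ) {σ : ℝ} (hσ : σ = 1 ∨ σ = -1) :
    (∀ x, eLpNorm (fun t => E₁.kk σ x t - E₂.kk σ x t) p μ01 ≤ 2 * δ) ∧ (∀ t ∈ Icc (0:ℝ) 1, eLpNorm (fun x => E₁.kk σ x t - E₂.kk σ x t) p μ01 ≤ 2 * δ) := by
  have m1 := measurable_triI (E₁.cont_tri h1)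
  have m2 := measurable_triI (E₂.cont_tri h2)
  constructor
  · intro x
    have e : eLpNorm (fun t => E₁.kk σ x t - E₂.kk σ x t) p μ01 = eLpNorm (fun t => E₁.rk x ((x + σ * t)/2) - E₂.rk x ((x + σ * t)/2)) p μ01 := by
      refine eLpNorm_congr_ae ?_
      filter_upwards [ae_in01] with t ht
      rw [kk_eq E₁ hσ ht, kk_eq E₂ hσ ht]
    rw [e]
    refine (eLpNorm_restrict_le _ _ _ _).trans ?_
    have := eLpNorm_affine hp hp' (g := fun u => ‖E₁.rk x u - E₂.rk x u‖ₑ) (m1.of_uncurry_left.sub m2.of_uncurry_left).enorm (c := σ/2) (b := x/2)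
      (by rcases hσ with rfl | rfl <;> norm_num [abs_div])
    have e2 : (fun t => ‖E₁.rk x (σ/2 * t + x/2) - E₂.rk x (σ/2 * t + x/2)‖ₑ) = fun t => ‖(fun t => E₁.rk x ((x + σ * t)/2) - E₂.rk x ((x + σ * t)/2)) t‖ₑ := by
      funext t; congr 3 <;> ring
    rw [e2, eLpNorm_enorm, eLpNorm_enorm] at this
    exact this.trans (mul_le_mul_right (hr x) 2)
  · intro t ht
    have e : (fun x => E₁.kk σ x t - E₂.kk σ x t) = fun x => E₁.rk x (1/2 * x + σ * t/2) - E₂.rk x (1/2 * x + σ * t/2) := by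
      funext x
      rw [kk_eq E₁ hσ ht, kk_eq E₂ hσ ht]
      congr 2 <;> ring
    rw [e]
    refine (eLpNorm_restrict_le _ _ _ _).trans ((hc _ le_rfl _).trans ?_)
    rw [two_mul]; exact le_self_add

lemma Phi_lp {p : ℝ≥0∞} (f : ℝ → ℂ) : eLpNorm (fun t => PhiL (f t)) p μ01 ≤ ENNReal.ofReal ‖PhiL‖ * eLpNorm f p μ01 :=
  eLpNorm_le_mul_eLpNorm_of_ae_le_mul (Eventually.of_forall fun t => PhiL.le_opNorm (f t)) p

lemma KK_lp {p : ℝ≥0∞} (hp : 1 ≤ p) {f g : ℝ → ℂ} (hf : Measurable f) (hg : Measurable g) {δ : ℝ≥0∞} (h1 : eLpNorm f p μ01 ≤ δ) (h2 : eLpNorm g p μ01 ≤ δ) :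
    eLpNorm (fun t => (2:ℂ)⁻¹ • (PhiL (f t) + PhiL (g t) * Jmat)) p μ01 ≤ (ENNReal.ofReal ‖PhiL‖ + ENNReal.ofReal (‖PhiL‖ * ‖Jmat‖)) * δ := by
  have mf : AEStronglyMeasurable (fun t => PhiL (f t)) μ01 := (PhiL.continuous.comp_stronglyMeasurable hf.stronglyMeasurable).aestronglyMeasurable
  have mg : AEStronglyMeasurable (fun t => PhiL (g t) * Jmat) μ01 := ((PhiL.continuous.comp_stronglyMeasurable hg.stronglyMeasurable).mul_const _).aestronglyMeasurable
  have e1 : eLpNorm (fun t => (2:ℂ)⁻¹ • (PhiL (f t) + PhiL (g t) * Jmat)) p μ01 ≤ eLpNorm ((fun t => PhiL (f t)) + fun t => PhiL (g t) * Jmat) p μ01 := by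
    refine eLpNorm_mono fun t => ?_
    rw [norm_smul, norm_inv, Complex.norm_two]
    simp only [Pi.add_apply]
    have := norm_nonneg (PhiL (f t) + PhiL (g t) * Jmat)
    linarith
  refine e1.trans ((eLpNorm_add_le mf mg hp).trans ?_)
  rw [add_mul]
  refine add_le_add ((Phi_lp f).trans (mul_le_mul_right h1 _)) ?_
  refine (eLpNorm_le_mul_eLpNorm_of_ae_le_mul (g := g) (c := ‖PhiL‖ * ‖Jmat‖) (Eventually.of_forall fun t => ?_) p).trans (mul_le_mul_right h2 _)
  calc ‖PhiL (g t) * Jmat‖ ≤ ‖PhiL (g t)‖ * ‖Jmat‖ := norm_mul_le _ _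
    _ ≤ (‖PhiL‖ * ‖g t‖) * ‖Jmat‖ := by gcongr; exact PhiL.le_opNorm _
    _ = _ := by ring

lemma ker_cauchy {p : ℝ≥0∞} (hp : 1 ≤ p) (hp' : p ≠ ∞) {M B : ℝ} (hM : 0 ≤ M) {Λ : ℝ≥0∞} (hΛ : Λ ≠ ∞) :
    ∃ C : ℝ≥0∞, C ≠ ∞ ∧ ∀ E₁ E₂ : ES, Good p E₁ M B Λ → Good p E₂ M B Λ →
      (∀ x ∈ Icc (0:ℝ) 1, eLpNorm (fun t => E₁.RK x t - E₂.RK x t) p μ01 ≤ C * eLpNorm (fun u => E₁.hk u - E₂.hk u) p volume) ∧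
      (∀ t ∈ Icc (0:ℝ) 1, eLpNorm (fun x => E₁.RK x t - E₂.RK x t) p μ01 ≤ C * eLpNorm (fun u => E₁.hk u - E₂.hk u) p volume) ∧
      (∀ x ∈ Icc (0:ℝ) 1, eLpNorm (fun t => E₁.KK x t - E₂.KK x t) p μ01 ≤ C * eLpNorm (fun u => E₁.hk u - E₂.hk u) p volume) ∧
      (∀ t ∈ Icc (0:ℝ) 1, eLpNorm (fun x => E₁.KK x t - E₂.KK x t) p μ01 ≤ C * eLpNorm (fun u => E₁.hk u - E₂.hk u) p volume) := by
  obtain ⟨C, hC, H⟩ := cauchy_est hp hp' hM hΛ (B := B)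
  set D : ℝ≥0∞ := ENNReal.ofReal ‖PhiL‖ + ENNReal.ofReal (‖PhiL‖ * ‖Jmat‖) with hD
  refine ⟨D * (2 * C), by finiteness, fun E₁ E₂ h1 h2 => ?_⟩
  obtain ⟨hr, hc⟩ := H E₁ E₂ h1 h2
  set δ := eLpNorm (fun u => E₁.hk u - E₂.hk u) p volume
  have k1 := kk_cauchy hp hp' h1.reg h2.reg hr hc (Or.inl rfl)
  have k2 := kk_cauchy hp hp' h1.reg h2.reg hr hc (Or.inr rfl)
  have b : C * δ ≤ 2 * C * δ := by rw [mul_assoc, two_mul]; exact le_self_add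
  have m : ∀ E : ES, E.Reg → Measurable (Function.uncurry E.rk) := fun E hE => measurable_triI (E.cont_tri hE)
  have mk : ∀ E : ES, E.Reg → ∀ σ, Measurable (Function.uncurry (E.kk σ)) := fun E hE σ => measurable_triI (ES.cont_kk hE σ)
  have ePhi : ∀ f : ℝ → ℂ, eLpNorm f p μ01 ≤ C * δ → eLpNorm (fun t => PhiL (f t)) p μ01 ≤ D * (2 * C) * δ := by
    intro f hf
    refine (Phi_lp f).trans ?_
    rw [mul_assoc]
    exact mul_le_mul' le_self_add (hf.trans b)
  refine ⟨fun x hx => ?_, fun t ht => ?_, fun x hx => ?_, fun t ht => ?_⟩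
  · simp only [ES.RK, ← map_sub]
    exact ePhi _ ((eLpNorm_restrict_le _ _ _ _).trans (hr x))
  · simp only [ES.RK, ← map_sub]
    have := hc 0 (by norm_num) t
    simp only [zero_mul, zero_add] at this
    exact ePhi _ ((eLpNorm_restrict_le _ _ _ _).trans this)
  · have e : (fun t => E₁.KK x t - E₂.KK x t) = fun t => (2:ℂ)⁻¹ • (PhiL (E₁.kk 1 x t - E₂.kk 1 x t) + PhiL (E₁.kk (-1) x t - E₂.kk (-1) x t) * Jmat) := by
      funext t
      simp only [ES.KK, ← smul_sub, map_sub, sub_mul]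
      congr 1; abel
    rw [e, mul_assoc]
    refine KK_lp hp ((mk _ h1.reg _).of_uncurry_left.sub (mk _ h2.reg _).of_uncurry_left) ((mk _ h1.reg _).of_uncurry_left.sub (mk _ h2.reg _).of_uncurry_left) ?_ ?_
    · rw [mul_assoc]; exact k1.1 x
    · rw [mul_assoc]; exact k2.1 x
  · have e : (fun x => E₁.KK x t - E₂.KK x t) = fun x => (2:ℂ)⁻¹ • (PhiL (E₁.kk 1 x t - E₂.kk 1 x t) + PhiL (E₁.kk (-1) x t - E₂.kk (-1) x t) * Jmat) := by
      funext x
      simp only [ES.KK, ← smul_sub, map_sub, sub_mul]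
      congr 1; abel
    rw [e, mul_assoc]
    refine KK_lp hp ((mk _ h1.reg _).of_uncurry_right.sub (mk _ h2.reg _).of_uncurry_right) ((mk _ h1.reg _).of_uncurry_right.sub (mk _ h2.reg _).of_uncurry_right) ?_ ?_
    · rw [mul_assoc]; exact k1.2 t ht
    · rw [mul_assoc]; exact k2.2 t ht

lemma Phi_mul (z w : ℂ) : PhiL (z * w) = PhiL z * PhiL w := by
  simp only [PhiL_apply, PhiF, Matrix.mul_fin_two]
  ext i j; fin_cases i <;> fin_cases j <;> simp <;> ring

lemma J_Phi (z : ℂ) : Jmat * PhiL z = PhiL (cj z) * Jmat := by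
  simp only [PhiL_apply, PhiF, Jmat, Matrix.mul_fin_two]
  ext i j; fin_cases i <;> fin_cases j <;> simp

lemma J_J : Jmat * Jmat = 1 := by
  simp only [Jmat, Matrix.mul_fin_two]
  ext i j; fin_cases i <;> fin_cases j <;> simp

/-- row functionals -/
def ell (i : Fin 2) (e : ℂ) : M2 →L[ℂ] ℂ := LinearMap.toContinuousLinearMap
  { toFun := fun A => A i 0 + e * I * A i 1
    map_add' := fun a b => by simp; ring
    map_smul' := fun c a => by simp; ring }

lemma ell_apply (i : Fin 2) (e : ℂ) (A : M2) : ell i e A = A i 0 + e * I * A i 1 := rfl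

lemma ell_Phi (i : Fin 2) (A : M2) (z : ℂ) : ell i 1 (A * PhiL z) = ell i 1 A * z := by
  have hz : (z.re : ℂ) + z.im * I = z := re_add_im z
  simp only [ell_apply, PhiL_apply, PhiF, Matrix.mul_apply, Fin.sum_univ_two]
  simp
  linear_combination (A i 0 + I * A i 1) * hz - (z.im : ℂ) * A i 1 * I_mul_I

lemma ell_Phi' (i : Fin 2) (A : M2) (z : ℂ) : ell i (-1) (A * PhiL z) = ell i (-1) A * cj z := by
  have hz : (z.re : ℂ) - z.im * I = cj z := by
    apply Complex.ext <;> simp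
  simp only [ell_apply, PhiL_apply, PhiF, Matrix.mul_apply, Fin.sum_univ_two]
  simp
  linear_combination (A i 0 - I * A i 1) * hz - (z.im : ℂ) * A i 1 * I_mul_I

lemma ell_J (i : Fin 2) (e : ℂ) (A : M2) : ell i e (A * Jmat) = ell i (-e) A := by
  simp [ell_apply, Jmat, Matrix.mul_apply, Fin.sum_univ_two]

lemma ell_bound : ∃ C : ℝ, 0 ≤ C ∧ ∀ A : M2, ‖A‖ ≤ C * ∑ i, (‖ell i 1 A‖ + ‖ell i (-1) A‖) := by
  obtain ⟨C, hC0, hC⟩ : ∃ C : ℝ, 0 ≤ C ∧ ∀ i j, ‖(Matrix.single i j 1 : M2)‖ ≤ C := by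
    refine ⟨∑ i, ∑ j, ‖(Matrix.single i j 1 : M2)‖, by positivity, fun i j => ?_⟩
    refine (Finset.single_le_sum (f := fun j => ‖(Matrix.single i j 1 : M2)‖) (fun _ _ => norm_nonneg _) (Finset.mem_univ j)).trans ?_
    exact Finset.single_le_sum (f := fun i => ∑ j, ‖(Matrix.single i j 1 : M2)‖) (fun _ _ => by positivity) (Finset.mem_univ i)
  have h0 : ∀ (A : M2) i, ‖A i 0‖ ≤ ‖ell i 1 A‖ + ‖ell i (-1) A‖ := by
    intro A i
    have : (2:ℂ) * A i 0 = ell i 1 A + ell i (-1) A := by simp [ell_apply]; ring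
    have h2 := congrArg norm this
    rw [norm_mul, Complex.norm_two] at h2
    have h3 := norm_add_le (ell i 1 A) (ell i (-1) A)
    have := norm_nonneg (A i 0)
    linarith
  have h1 : ∀ (A : M2) i, ‖A i 1‖ ≤ ‖ell i 1 A‖ + ‖ell i (-1) A‖ := by
    intro A i
    have : (2:ℂ) * I * A i 1 = ell i 1 A - ell i (-1) A := by simp [ell_apply]; ring
    have h2 := congrArg norm this
    rw [norm_mul, norm_mul, Complex.norm_two, norm_I, mul_one] at h2
    have h3 := norm_sub_le (ell i 1 A) (ell i (-1) A)
    have := norm_nonneg (A i 1)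
    linarith
  refine ⟨2 * C, by positivity, fun A => ?_⟩
  have hA := Matrix.matrix_eq_sum_single A
  have e : ∀ i j, ‖Matrix.single i j (A i j)‖ ≤ C * ‖A i j‖ := by
    intro i j
    have : Matrix.single i j (A i j) = A i j • (Matrix.single i j 1 : M2) := by rw [Matrix.smul_single]; simp
    rw [this, norm_smul, mul_comm]
    exact mul_le_mul_of_nonneg_right (hC i j) (norm_nonneg _)
  calc ‖A‖ = ‖∑ i, ∑ j, Matrix.single i j (A i j)‖ := by rw [← hA]
    _ ≤ ∑ i, ∑ j, C * ‖A i j‖ := (norm_sum_le _ _).trans (Finset.sum_le_sum fun i _ => (norm_sum_le _ _).trans (Finset.sum_le_sum fun j _ => e i j))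
    _ ≤ ∑ i, 2 * C * (‖ell i 1 A‖ + ‖ell i (-1) A‖) := by
        refine Finset.sum_le_sum fun i _ => ?_
        rw [Fin.sum_univ_two]
        have a0 := mul_le_mul_of_nonneg_left (h0 A i) hC0
        have a1 := mul_le_mul_of_nonneg_left (h1 A i) hC0
        linarith
    _ = _ := by rw [Finset.mul_sum]

lemma fold_ii {F : Type*} [NormedAddCommGroup F] [NormedSpace ℝ F] [CompleteSpace F] {g : ℝ → F} {x : ℝ} (hx : 0 ≤ x) (hg : IntervalIntegrable g volume 0 x) :
    IntervalIntegrable (fun s => g ((x + s)/2)) volume 0 x ∧ IntervalIntegrable (fun s => g ((x - s)/2)) volume 0 x := by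
  have hh : x/2 ∈ Icc 0 x := ⟨by linarith, by linarith⟩
  have g1 : IntervalIntegrable g volume 0 (x/2) := hg.mono_set (by rw [uIcc_of_le hh.1, uIcc_of_le hx]; exact Icc_subset_Icc_right hh.2)
  have g2 : IntervalIntegrable g volume (x/2) x := hg.mono_set (by rw [uIcc_of_le hh.2, uIcc_of_le hx]; exact Icc_subset_Icc_left hh.1)
  have e1 : (fun s => g ((x + s)/2)) = fun s => g ((1/2) * s + x/2) := by funext s; congr 1; ring
  have e2 : (fun s => g ((x - s)/2)) = fun s => g (x/2 - (1/2) * s) := by funext s; congr 1; ring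
  have i1 : IntervalIntegrable (fun s => g ((x + s)/2)) volume 0 x := by
    have a := (g2.comp_add_right (x/2)).comp_mul_left (c := 1/2)
    rw [e1]
    convert a using 1 <;> ring
  have i2 : IntervalIntegrable (fun s => g ((x - s)/2)) volume 0 x := by
    have a := ((g1.comp_sub_left (x/2)).comp_mul_left (c := 1/2)).symm
    rw [e2]
    convert a using 1 <;> ring
  exact ⟨i1, i2⟩

lemma fold {F : Type*} [NormedAddCommGroup F] [NormedSpace ℝ F] [CompleteSpace F] {g : ℝ → F} {x : ℝ} (hx : 0 ≤ x) (hg : IntervalIntegrable g volume 0 x) :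
    ∫ s in (0:ℝ)..x, (g ((x + s)/2) + g ((x - s)/2)) = (2:ℝ) • ∫ y in (0:ℝ)..x, g y := by
  have hh : x/2 ∈ Icc 0 x := ⟨by linarith, by linarith⟩
  have g1 : IntervalIntegrable g volume 0 (x/2) := hg.mono_set (by rw [uIcc_of_le hh.1, uIcc_of_le hx]; exact Icc_subset_Icc_right hh.2)
  have g2 : IntervalIntegrable g volume (x/2) x := hg.mono_set (by rw [uIcc_of_le hh.2, uIcc_of_le hx]; exact Icc_subset_Icc_left hh.1)
  have e1 : (fun s => g ((x + s)/2)) = fun s => g ((1/2) * s + x/2) := by funext s; congr 1; ring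
  have e2 : (fun s => g ((x - s)/2)) = fun s => g (x/2 - (1/2) * s) := by funext s; congr 1; ring
  obtain ⟨i1, i2⟩ := fold_ii hx hg
  rw [intervalIntegral.integral_add i1 i2, e1, e2, intervalIntegral.integral_comp_mul_add _ (by norm_num), intervalIntegral.integral_comp_sub_mul _ (by norm_num),
    ← smul_add]
  have a1 : (1/2:ℝ) * 0 + x/2 = x/2 := by ring
  have a2 : (1/2:ℝ) * x + x/2 = x := by ring
  have a3 : x/2 - (1/2:ℝ) * x = 0 := by ring
  have a4 : x/2 - (1/2:ℝ) * 0 = x/2 := by ring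
  rw [a1, a2, a3, a4, add_comm, intervalIntegral.integral_add_adjacent_intervals g1 g2]
  norm_num

lemma RK_krein {E : ES} (hE : E.Reg) {x t : ℝ} (hx : x ∈ Icc (0:ℝ) 1) (ht : t ∈ Icc 0 x) :
    E.RK x t + PhiL (E.h (x - t)) + ∫ s in (0:ℝ)..x, E.RK x s * PhiL (E.h (s - t)) = 0 := by
  have e : ∫ s in (0:ℝ)..x, E.RK x s * PhiL (E.h (s - t)) = ∫ s in (0:ℝ)..x, PhiL (E.r x s * E.h (s - t)) := by
    refine intervalIntegral.integral_congr fun s hs => ?_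
    rw [uIcc_of_le hx.1] at hs
    simp only [ES.RK, ES.rk]
    rw [triI_of_mem ⟨hs.1, hs.2, hx.2⟩, Phi_mul]
  have cr : Continuous fun s => E.r x s := E.continuous_trig _
  have c : Continuous fun s => E.h (s - t) := E.continuous_h.comp (continuous_id.sub continuous_const)
  have ci : IntervalIntegrable (fun s => E.r x s * E.h (s - t)) volume 0 x := (cr.mul c).intervalIntegrable _ _
  rw [e, PhiL.intervalIntegral_comp_comm ci]
  simp only [ES.RK, ES.rk]
  rw [triI_of_mem ⟨ht.1, ht.2, hx.2⟩, ← map_add, ← map_add, E.krein hE hx t, map_zero]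

def ES.HM (E : ES) (u : ℝ) : M2 := PhiL (E.h u)

lemma KF_prod (p m a b : ℂ) : ((2:ℂ)⁻¹ • (PhiL p + PhiL m * Jmat)) * ((2:ℂ)⁻¹ • (PhiL a + PhiL b * Jmat)) =
    (4:ℂ)⁻¹ • (PhiL (p * a + m * cj b) + PhiL (p * b + m * cj a) * Jmat) := by
  have h : (PhiL p + PhiL m * Jmat) * (PhiL a + PhiL b * Jmat) = PhiL (p * a + m * cj b) + PhiL (p * b + m * cj a) * Jmat := by
    have h1 : PhiL m * Jmat * PhiL a = PhiL (m * cj a) * Jmat := by rw [mul_assoc, J_Phi, ← mul_assoc, Phi_mul]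
    have h2 : PhiL m * Jmat * (PhiL b * Jmat) = PhiL (m * cj b) := by
      rw [mul_assoc, ← mul_assoc Jmat, J_Phi, mul_assoc, J_J, mul_one, Phi_mul]
    rw [add_mul, mul_add, mul_add, h1, h2, map_add, map_add, ← mul_assoc, ← Phi_mul, ← Phi_mul, add_mul]
    abel
  rw [smul_mul_assoc, mul_smul_comm, smul_smul, h]
  congr 1; norm_num

lemma KK_glm {E : ES} (hE : E.Reg) {x t : ℝ} (hx : x ∈ Icc (0:ℝ) 1) (ht : t ∈ Icc 0 x) :
    E.KK x t + Fker E.HM x t + ∫ s in (0:ℝ)..x, E.KK x s * Fker E.HM s t = 0 := by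
  have cr : Continuous fun s => E.r x s := E.continuous_trig _
  have ch : ∀ τ, Continuous fun s => E.h (s - τ) := fun τ => E.continuous_h.comp (continuous_id.sub continuous_const)
  obtain ⟨W, hW⟩ : ∃ W : ℝ → ℝ → ℂ, ∀ τ s, W τ s = E.r x ((x+s)/2) * E.h ((x+s)/2 - τ) + E.r x ((x-s)/2) * E.h ((x-s)/2 - τ) := ⟨_, fun _ _ => rfl⟩
  have e : ∫ s in (0:ℝ)..x, E.KK x s * Fker E.HM s t = ∫ s in (0:ℝ)..x, (4:ℂ)⁻¹ • (
      PhiL (W ((x+t)/2) s) + PhiL (W ((x-t)/2) s) * Jmat) := by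
    refine intervalIntegral.integral_congr fun s hs => ?_
    rw [uIcc_of_le hx.1] at hs
    simp only [ES.KK, ES.kk, Fker, ES.HM]
    rw [triI_of_mem ⟨hs.1, hs.2, hx.2⟩, triI_of_mem ⟨hs.1, hs.2, hx.2⟩, KF_prod, E.conj_h, E.conj_h, hW, hW]
    congr 5 <;> ring_nf
  have c1 : ∀ τ, Continuous fun y => E.r x y * E.h (y - τ) := fun τ => cr.mul (ch τ)
  have c2 : ∀ τ, Continuous (W τ) := by
    intro τ
    have := ((c1 τ).comp (by fun_prop : Continuous fun s : ℝ => (x+s)/2)).add ((c1 τ).comp (by fun_prop : Continuous fun s : ℝ => (x-s)/2))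
    exact this.congr fun s => (hW τ s).symm
  have c3 : ∀ τ, IntervalIntegrable (fun s => PhiL (W τ s)) volume 0 x := fun τ => (PhiL.continuous.comp (c2 τ)).intervalIntegrable (μ := volume) 0 x
  have c4 : ∀ τ, IntervalIntegrable (fun s => PhiL (W τ s) * Jmat) volume 0 x := fun τ => ((PhiL.continuous.comp (c2 τ)).mul (continuous_const (y := Jmat))).intervalIntegrable (μ := volume) 0 x
  have f : ∀ τ, ∫ s in (0:ℝ)..x, W τ s = (2:ℝ) • ∫ y in (0:ℝ)..x, E.r x y * E.h (y - τ) := fun τ => by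
    rw [← fold hx.1 ((c1 τ).intervalIntegrable 0 x)]
    simp only [hW]
  have c5 : ∀ τ, ∫ s in (0:ℝ)..x, PhiL (W τ s) = PhiL ((2:ℝ) • ∫ y in (0:ℝ)..x, E.r x y * E.h (y - τ)) := fun τ => by
    rw [← f τ]; exact PhiL.intervalIntegral_comp_comm ((c2 τ).intervalIntegrable (μ := volume) 0 x)
  have k1 := E.krein hE hx ((x+t)/2)
  have k2 := E.krein hE hx ((x-t)/2)
  have c6 : ∀ τ, ∫ s in (0:ℝ)..x, PhiL (W τ s) * Jmat =
      PhiL ((2:ℝ) • ∫ y in (0:ℝ)..x, E.r x y * E.h (y - τ)) * Jmat := by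
    intro τ
    rw [← c5 τ]
    exact ((ContinuousLinearMap.mul ℝ M2).flip Jmat).intervalIntegral_comp_comm (c3 τ)
  rw [e, intervalIntegral.integral_smul, intervalIntegral.integral_add (c3 _) (c4 _), c5, c6]
  simp only [ES.KK, ES.kk, Fker, ES.HM]
  rw [triI_of_mem ⟨ht.1, ht.2, hx.2⟩, triI_of_mem ⟨ht.1, ht.2, hx.2⟩]
  have q1 : ∫ y in (0:ℝ)..x, E.r x y * E.h (y - (x+t)/2) = -(E.r x ((x+1*t)/2) + E.h ((x-t)/2)) := by
    have a : x - (x+t)/2 = (x-t)/2 := by ring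
    rw [a] at k1
    rw [one_mul]
    linear_combination k1
  have q2 : ∫ y in (0:ℝ)..x, E.r x y * E.h (y - (x-t)/2) = -(E.r x ((x+(-1)*t)/2) + E.h ((x+t)/2)) := by
    have a : x - (x-t)/2 = (x+t)/2 := by ring
    have b : (x+(-1)*t)/2 = (x-t)/2 := by ring
    rw [a] at k2
    rw [b]
    linear_combination k2
  rw [q1, q2, map_smul, map_smul, map_neg, map_neg, map_add, map_add]
  have two : ∀ A : M2, (2:ℝ) • A = (2:ℂ) • A := fun A => by
    rw [← Complex.coe_smul]; norm_num
  rw [two, two]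
  simp only [neg_mul, add_mul, smul_mul_assoc]
  module

lemma fold_lint {g : ℝ → ℂ} {x : ℝ} (hx : 0 ≤ x) (hg : IntervalIntegrable g volume 0 x) :
    (∫⁻ s in Ioc 0 x, ‖g ((x + s)/2)‖ₑ) + ∫⁻ s in Ioc 0 x, ‖g ((x - s)/2)‖ₑ = 2 * ∫⁻ s in Ioc 0 x, ‖g s‖ₑ := by
  obtain ⟨i1, i2⟩ := fold_ii hx hg
  have f := fold hx hg.norm
  have a1 := i1.norm
  have a2 := i2.norm
  rw [intervalIntegral.integral_add a1 a2] at f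
  rw [intervalIntegrable_iff_integrableOn_Ioc_of_le hx] at hg i1 i2
  rw [← ofReal_integral_norm_eq_lintegral_enorm hg, ← ofReal_integral_norm_eq_lintegral_enorm i1, ← ofReal_integral_norm_eq_lintegral_enorm i2,
    ← ENNReal.ofReal_add (by positivity) (by positivity)]
  simp only [intervalIntegral.integral_of_le hx] at f
  rw [f, smul_eq_mul, ENNReal.ofReal_mul (by norm_num)]
  simp

lemma lint_ell (i : Fin 2) (e : ℂ) (G : ℝ → M2) (x : ℝ) : ∫⁻ t in Ioc 0 x, ‖ell i e (G t)‖ₑ ≤ ‖ell i e‖ₑ * ∫⁻ t in Ioc 0 x, ‖G t‖ₑ := by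
  rw [← lintegral_const_mul' _ _ (by finiteness)]
  exact lintegral_mono fun t => (ell i e).le_opENorm (G t)

lemma mlb_of_ell : ∃ C : ℝ≥0∞, C ≠ ∞ ∧ ∀ (D G : ℝ → M2) (x : ℝ) (M : ℝ≥0∞), 0 ≤ x → IntervalIntegrable D volume 0 x →
    (∀ i, ∫⁻ t in Ioc 0 x, ‖ell i 1 (D t)‖ₑ ≤ M * ∫⁻ t in Ioc 0 x, ‖G t‖ₑ) →
    (∀ i, ∫⁻ t in Ioc 0 x, ‖ell i (-1) (D t)‖ₑ ≤ M * ∫⁻ t in Ioc 0 x, ‖G t‖ₑ) →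
    ∫⁻ t in Ioc 0 x, ‖D t‖ₑ ≤ C * M * ∫⁻ t in Ioc 0 x, ‖G t‖ₑ := by
  obtain ⟨C, hC0, hC⟩ := ell_bound
  refine ⟨ENNReal.ofReal C * 4, by finiteness, fun D G x M hx hD h1 h2 => ?_⟩
  rw [intervalIntegrable_iff_integrableOn_Ioc_of_le hx] at hD
  have m : ∀ i e, AEMeasurable (fun t => ‖ell i e (D t)‖ₑ) (volume.restrict (Ioc 0 x)) := fun i e =>
    ((ell i e).continuous.comp_aestronglyMeasurable hD.1).enorm
  calc ∫⁻ t in Ioc 0 x, ‖D t‖ₑ ≤ ∫⁻ t in Ioc 0 x, ENNReal.ofReal C * ∑ i, (‖ell i 1 (D t)‖ₑ + ‖ell i (-1) (D t)‖ₑ) := by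
        refine lintegral_mono fun t => ?_
        rw [← ofReal_norm]
        refine (ENNReal.ofReal_le_ofReal (hC (D t))).trans_eq ?_
        rw [ENNReal.ofReal_mul hC0, ENNReal.ofReal_sum_of_nonneg fun i _ => by positivity]
        congr 1
        refine Finset.sum_congr rfl fun i _ => ?_
        rw [ENNReal.ofReal_add (norm_nonneg _) (norm_nonneg _), ofReal_norm, ofReal_norm]
    _ = ENNReal.ofReal C * ∑ i, ((∫⁻ t in Ioc 0 x, ‖ell i 1 (D t)‖ₑ) + ∫⁻ t in Ioc 0 x, ‖ell i (-1) (D t)‖ₑ) := by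
        have m2 : ∀ i, AEMeasurable (fun t => ‖ell i 1 (D t)‖ₑ + ‖ell i (-1) (D t)‖ₑ) (volume.restrict (Ioc 0 x)) := fun i => (m i 1).add (m i (-1))
        rw [lintegral_const_mul' _ _ (by finiteness), lintegral_finsetSum' _ fun i _ => m2 i]
        congr 1
        refine Finset.sum_congr rfl fun i _ => ?_
        rw [lintegral_add_left' (m i 1)]
    _ ≤ ENNReal.ofReal C * ∑ i : Fin 2, ((M * ∫⁻ t in Ioc 0 x, ‖G t‖ₑ) + M * ∫⁻ t in Ioc 0 x, ‖G t‖ₑ) := by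
        gcongr with i
        · exact h1 i
        · exact h2 i
    _ = _ := by rw [Fin.sum_univ_two]; ring

/-- matrix lower bound -/
def MLB (F : ℝ → ℝ → M2) (x : ℝ) (C : ℝ≥0∞) : Prop := ∀ D : ℝ → M2, IntervalIntegrable D volume 0 x →
  ∫⁻ t in Ioc 0 x, ‖D t‖ₑ ≤ C * ∫⁻ t in Ioc 0 x, ‖D t + ∫ s in (0:ℝ)..x, D s * F s t‖ₑ

lemma ell_int {D : ℝ → M2} {x : ℝ} (hD : IntervalIntegrable D volume 0 x) {f : ℝ → M2} (hf : Continuous f) (i : Fin 2) (e : ℂ) :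
    ell i e (∫ s in (0:ℝ)..x, D s * f s) = ∫ s in (0:ℝ)..x, ell i e (D s * f s) :=
  ((ell i e).intervalIntegral_comp_comm (hD.mul_continuousOn hf.continuousOn)).symm

lemma ES.continuous_HM (E : ES) : Continuous E.HM := PhiL.continuous.comp E.continuous_h

lemma mlb_krein : ∃ C : ℝ≥0∞, C ≠ ∞ ∧ ∀ (E : ES) (M : ℝ), 0 ≤ M → LB E M → ∀ x ∈ Icc (0:ℝ) 1, MLB (fun s t => E.HM (s - t)) x (C * ENNReal.ofReal M) := by
  obtain ⟨C, hC, H⟩ := mlb_of_ell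
  set L : ℝ≥0∞ := ∑ i, (‖ell i 1‖ₑ + ‖ell i (-1)‖ₑ) with hL
  have l1 : ∀ i, ‖ell i 1‖ₑ ≤ L := fun i => le_self_add.trans (Finset.single_le_sum (f := fun i => ‖ell i 1‖ₑ + ‖ell i (-1)‖ₑ) (fun _ _ => zero_le) (Finset.mem_univ i))
  have l2 : ∀ i, ‖ell i (-1)‖ₑ ≤ L := fun i => le_add_self.trans (Finset.single_le_sum (f := fun i => ‖ell i 1‖ₑ + ‖ell i (-1)‖ₑ) (fun _ _ => zero_le) (Finset.mem_univ i))
  have hLt : L ≠ ∞ := by rw [hL]; exact ENNReal.sum_ne_top.2 fun i _ => by finiteness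
  refine ⟨C * L, by finiteness, fun E M hM hE x hx D hD => ?_⟩
  have hf : ∀ t, Continuous fun s => E.HM (s - t) := fun t => E.continuous_HM.comp (continuous_id.sub continuous_const)
  refine (H D _ x (ENNReal.ofReal M * L) hx.1 hD (fun i => ?_) (fun i => ?_)).trans_eq (by ring)
  · have h := hE.lint hM hx (f := fun t => ell i 1 (D t)) ((ell i 1).integrable_comp hD.1 |> fun a => ⟨a, (ell i 1).integrable_comp hD.2⟩)
    refine h.trans ?_
    rw [mul_assoc]
    gcongr
    refine le_trans (le_of_eq (lintegral_congr fun t => congrArg enorm ?_)) ((lint_ell i 1 _ x).trans (mul_le_mul' (l1 i) le_rfl))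
    rw [map_add, ell_int hD (hf t)]
    simp only [ES.HM, ell_Phi]
  · have h := hE.lint hM hx (f := fun t => cj (ell i (-1) (D t))) (ii_cj ((ell i (-1)).integrable_comp hD.1 |> fun a => ⟨a, (ell i (-1)).integrable_comp hD.2⟩))
    have e0 : ∫⁻ t in Ioc 0 x, ‖ell i (-1) (D t)‖ₑ = ∫⁻ t in Ioc 0 x, ‖cj (ell i (-1) (D t))‖ₑ :=
      lintegral_congr fun t => by rw [← ofReal_norm, ← ofReal_norm, RCLike.norm_conj]
    rw [e0]
    refine h.trans ?_
    rw [mul_assoc]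
    gcongr
    refine le_trans (le_of_eq (lintegral_congr fun t => ?_)) ((lint_ell i (-1) _ x).trans (mul_le_mul' (l2 i) le_rfl))
    rw [map_add, ell_int hD (hf t)]
    simp only [ES.HM, ell_Phi']
    rw [← ofReal_norm, ← ofReal_norm, ← RCLike.norm_conj (ell i (-1) (D t) + _), map_add, ← int_cj]
    simp only [map_mul, conj_conj]

lemma unfold_fn {x : ℝ} (hx : 0 ≤ x) {d e : ℝ → ℂ} (hd : IntervalIntegrable d volume 0 x) (he : IntervalIntegrable e volume 0 x) :
    ∃ f : ℝ → ℂ, IntervalIntegrable f volume 0 x ∧ (∀ s ∈ Ioc 0 x, f ((x+s)/2) = d s) ∧ (∀ s ∈ Ioc 0 x, f ((x-s)/2) = e s) := by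
  refine ⟨fun y => if x/2 < y then d (2*y-x) else e (x-2*y), ?_, fun s hs => ?_, fun s hs => ?_⟩
  · have g1 : IntervalIntegrable (fun y => e (x - 2*y)) volume 0 (x/2) := by
      have := ((he.comp_sub_left x).comp_mul_left (c := 2)).symm
      convert this using 1 <;> ring
    have g2 : IntervalIntegrable (fun y => d (2*y - x)) volume (x/2) x := by
      have := ((hd.comp_sub_right x).comp_mul_left (c := 2))
      convert this using 1 <;> ring
    refine IntervalIntegrable.trans (b := x/2) (g1.congr ?_) (g2.congr ?_)
    · intro y hy
      rw [uIoc_of_le (by linarith)] at hy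
      simp only [not_lt.2 hy.2, if_false]
    · intro y hy
      rw [uIoc_of_le (by linarith)] at hy
      simp only [hy.1, if_true]
  · have : x/2 < (x+s)/2 := by linarith [hs.1]
    simp only [this, if_true]; congr 1; ring
  · have : ¬ x/2 < (x-s)/2 := by linarith [hs.1]
    simp only [this, if_false]; congr 1; ring

lemma ES.continuous_Fker (E : ES) (t : ℝ) : Continuous fun s => Fker E.HM s t := by
  unfold Fker
  have c1 := E.continuous_HM.comp (by fun_prop : Continuous fun s : ℝ => (s-t)/2)
  have c2 := E.continuous_HM.comp (by fun_prop : Continuous fun s : ℝ => (s+t)/2)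
  exact ((c1.add (c2.mul (continuous_const (y := Jmat)))).const_smul (2:ℂ)⁻¹)

lemma ell_ii {D : ℝ → M2} {x : ℝ} (hD : IntervalIntegrable D volume 0 x) (i : Fin 2) (e : ℂ) :
    IntervalIntegrable (fun t => ell i e (D t)) volume 0 x := ⟨(ell i e).integrable_comp hD.1, (ell i e).integrable_comp hD.2⟩

lemma mlb_glm : ∃ C : ℝ≥0∞, C ≠ ∞ ∧ ∀ (E : ES) (M : ℝ), 0 ≤ M → LB E M → ∀ x ∈ Icc (0:ℝ) 1, MLB (Fker E.HM) x (C * ENNReal.ofReal M) := by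
  obtain ⟨C, hC, H⟩ := mlb_of_ell
  set L : ℝ≥0∞ := ∑ i, (‖ell i 1‖ₑ + ‖ell i (-1)‖ₑ) with hL
  have l1 : ∀ i, ‖ell i 1‖ₑ + ‖ell i (-1)‖ₑ ≤ L := fun i => (Finset.single_le_sum (f := fun i => ‖ell i 1‖ₑ + ‖ell i (-1)‖ₑ) (fun _ _ => zero_le) (Finset.mem_univ i))
  have hLt : L ≠ ∞ := by rw [hL]; exact ENNReal.sum_ne_top.2 fun i _ => by finiteness
  refine ⟨C * L, by finiteness, fun E M hM hE x hx D hD => ?_⟩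
  have key : ∀ i, (∫⁻ t in Ioc 0 x, ‖ell i 1 (D t)‖ₑ) + (∫⁻ t in Ioc 0 x, ‖ell i (-1) (D t)‖ₑ) ≤
      ENNReal.ofReal M * L * ∫⁻ t in Ioc 0 x, ‖D t + ∫ s in (0:ℝ)..x, D s * Fker E.HM s t‖ₑ := by
    intro i
    obtain ⟨f, hf, fp, fm⟩ := unfold_fn hx.1 (ell_ii hD i 1) (ell_ii hD i (-1))
    have h := hE.lint hM hx hf
    obtain ⟨w, hw⟩ : ∃ w : ℝ → ℂ, ∀ t, w t = f t + ∫ s in (0:ℝ)..x, f s * E.h (s - t) := ⟨_, fun _ => rfl⟩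
    have wi : IntervalIntegrable w volume 0 x := by
      have : w = fun t => f t - E.trig (E.co x f) t := by
        funext t; rw [hw, E.conv_h hf]; ring
      rw [this]
      exact hf.sub ((E.continuous_trig _).intervalIntegrable _ _)
    simp only [← hw] at h
    have e1 := fold_lint hx.1 hf
    have e2 := fold_lint hx.1 wi
    have wf : ∀ t, w t = f t + (2:ℂ)⁻¹ * ∫ s in (0:ℝ)..x, (ell i 1 (D s) * E.h ((x+s)/2 - t) + ell i (-1) (D s) * E.h ((x-s)/2-t)) := by
      intro t
      have fi : IntervalIntegrable (fun s => f s * E.h (s - t)) volume 0 x := hf.mul_continuousOn (E.continuous_h.comp (continuous_id.sub continuous_const)).continuousOn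
      have := fold hx.1 fi
      have c : ∫ s in (0:ℝ)..x, (ell i 1 (D s) * E.h ((x+s)/2 - t) + ell i (-1) (D s) * E.h ((x-s)/2-t)) = ∫ s in (0:ℝ)..x, (f ((x+s)/2) * E.h ((x+s)/2-t) + f ((x-s)/2) * E.h ((x-s)/2-t)) := by
        refine intervalIntegral.integral_congr_ae (Eventually.of_forall fun s hs => ?_)
        rw [uIoc_of_le hx.1] at hs
        simp only [fp s hs, fm s hs]
      rw [hw, c, this, Complex.real_smul]; push_cast; ring
    have gi : ∀ t e, ell i e (D t + ∫ s in (0:ℝ)..x, D s * Fker E.HM s t) = ell i e (D t) + (2:ℂ)⁻¹ * ∫ s in (0:ℝ)..x,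
        (ell i e (D s * PhiL (E.h ((s-t)/2))) + ell i (-e) (D s * PhiL (E.h ((s+t)/2)))) := by
      intro t e
      rw [map_add, ell_int hD (E.continuous_Fker t), ← intervalIntegral.integral_const_mul]
      congr 2; funext s
      simp only [Fker, ES.HM, mul_smul_comm, map_smul, mul_add, ← mul_assoc, map_add, ell_J, smul_eq_mul]
    have wp : ∀ t ∈ Ioc 0 x, w ((x+t)/2) = ell i 1 (D t + ∫ s in (0:ℝ)..x, D s * Fker E.HM s t) := by
      intro t ht
      rw [wf, fp t ht, gi]
      congr 3; funext s
      rw [ell_Phi, ell_Phi', E.conj_h]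
      congr 3 <;> ring
    have wm : ∀ t ∈ Ioc 0 x, w ((x-t)/2) = ell i (-1) (D t + ∫ s in (0:ℝ)..x, D s * Fker E.HM s t) := by
      intro t ht
      rw [wf, fm t ht, gi]
      congr 3; funext s
      rw [neg_neg, ell_Phi, ell_Phi', E.conj_h, add_comm]
      congr 3 <;> ring
    have cg : ∀ u v : ℝ → ℂ, (∀ t ∈ Ioc 0 x, u t = v t) → ∫⁻ t in Ioc 0 x, ‖u t‖ₑ = ∫⁻ t in Ioc 0 x, ‖v t‖ₑ := fun u v huv =>
      setLIntegral_congr_fun measurableSet_Ioc (fun t ht => by simp only [huv t ht])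
    rw [cg _ _ fp, cg _ _ fm] at e1
    rw [cg _ _ wp, cg _ _ wm] at e2
    calc _ = 2 * ∫⁻ s in Ioc 0 x, ‖f s‖ₑ := e1
      _ ≤ 2 * (ENNReal.ofReal M * ∫⁻ s in Ioc 0 x, ‖w s‖ₑ) := by gcongr
      _ = ENNReal.ofReal M * (2 * ∫⁻ s in Ioc 0 x, ‖w s‖ₑ) := by ring
      _ ≤ ENNReal.ofReal M * ((‖ell i 1‖ₑ * ∫⁻ t in Ioc 0 x, ‖D t + ∫ s in (0:ℝ)..x, D s * Fker E.HM s t‖ₑ) + ‖ell i (-1)‖ₑ * ∫⁻ t in Ioc 0 x, ‖D t + ∫ s in (0:ℝ)..x, D s * Fker E.HM s t‖ₑ) := by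
        rw [← e2]
        gcongr
        · exact lint_ell i 1 _ x
        · exact lint_ell i (-1) _ x
      _ ≤ _ := by
        rw [← add_mul, mul_assoc]
        gcongr
        exact l1 i
  refine (H D _ x (ENNReal.ofReal M * L) hx.1 hD (fun i => le_self_add.trans (key i)) (fun i => le_add_self.trans (key i))).trans_eq (by ring)

lemma conv_bound {ν : Measure ℝ} [SFinite ν] {k : ℝ → M2} (hk : Integrable k ν) {G : ℝ → ℝ → M2}
    (hG : StronglyMeasurable (Function.uncurry G)) {A : ℝ≥0∞} (hA : A ≠ ∞) (hGA : ∀ s, ∫⁻ t, ‖G s t‖ₑ ∂ν ≤ A) :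
    (∫⁻ t, ‖∫ s, k s * G s t ∂ν‖ₑ ∂ν ≤ A * ∫⁻ s, ‖k s‖ₑ ∂ν) ∧ (∀ᵐ t ∂ν, Integrable (fun s => k s * G s t) ν) ∧
    AEStronglyMeasurable (fun t => ∫ s, k s * G s t ∂ν) ν := by
  have m1 : AEStronglyMeasurable (fun z : ℝ × ℝ => k z.2 * G z.2 z.1) (ν.prod ν) := by
    have a : AEStronglyMeasurable (fun z : ℝ × ℝ => k z.2) (ν.prod ν) := hk.1.comp_snd
    have b : StronglyMeasurable (fun z : ℝ × ℝ => G z.2 z.1) := hG.comp_measurable measurable_swap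
    exact a.mul b.aestronglyMeasurable
  have bd : ∫⁻ t, ∫⁻ s, ‖k s * G s t‖ₑ ∂ν ∂ν ≤ A * ∫⁻ s, ‖k s‖ₑ ∂ν := by
    rw [lintegral_lintegral_swap m1.enorm]
    calc ∫⁻ s, ∫⁻ t, ‖k s * G s t‖ₑ ∂ν ∂ν ≤ ∫⁻ s, A * ‖k s‖ₑ ∂ν := by
          refine lintegral_mono fun s => ?_
          calc ∫⁻ t, ‖k s * G s t‖ₑ ∂ν ≤ ∫⁻ t, ‖k s‖ₑ * ‖G s t‖ₑ ∂ν := lintegral_mono fun t => by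
                rw [← ofReal_norm, ← ofReal_norm, ← ofReal_norm, ← ENNReal.ofReal_mul (norm_nonneg _)]
                exact ENNReal.ofReal_le_ofReal (norm_mul_le _ _)
            _ = ‖k s‖ₑ * ∫⁻ t, ‖G s t‖ₑ ∂ν := lintegral_const_mul' _ _ (by finiteness)
            _ ≤ A * ‖k s‖ₑ := by rw [mul_comm]; gcongr; exact hGA s
      _ = _ := lintegral_const_mul' _ _ hA
  have fin : A * ∫⁻ s, ‖k s‖ₑ ∂ν ≠ ∞ := ENNReal.mul_ne_top hA hk.2.ne
  refine ⟨(lintegral_mono fun t => enorm_integral_le_lintegral_enorm _).trans bd, ?_, m1.integral_prod_right'⟩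
  have I : Integrable (fun z : ℝ × ℝ => k z.2 * G z.2 z.1) (ν.prod ν) := by
    refine ⟨m1, ?_⟩
    rw [HasFiniteIntegral, lintegral_prod _ m1.enorm]
    exact lt_of_le_of_lt bd fin.lt_top
  exact I.prod_right_ae

lemma krein_lim {ν : Measure ℝ} [SFinite ν] {k f : ℝ → M2} {kn fn : ℕ → ℝ → M2} {F : ℝ → ℝ → M2} {Fn : ℕ → ℝ → ℝ → M2}
    (hk : Integrable k ν) (hkn : ∀ n, Integrable (kn n) ν) (hF : StronglyMeasurable (Function.uncurry F))
    (hFn : ∀ n, StronglyMeasurable (Function.uncurry (Fn n))) {A : ℝ≥0∞} (hA : A ≠ ∞) (hFA : ∀ s, ∫⁻ t, ‖F s t‖ₑ ∂ν ≤ A)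
    {η : ℕ → ℝ≥0∞} (hη : ∀ n, η n ≠ ∞) (hη0 : Tendsto η atTop (nhds 0)) (hd : ∀ n s, ∫⁻ t, ‖F s t - Fn n s t‖ₑ ∂ν ≤ η n)
    (hf : AEStronglyMeasurable f ν) (hfn : ∀ n, AEStronglyMeasurable (fn n) ν)
    (hfl : ∀ n, ∫⁻ t, ‖f t - fn n t‖ₑ ∂ν ≤ η n)
    (hkl : Tendsto (fun n => ∫⁻ t, ‖k t - kn n t‖ₑ ∂ν) atTop (nhds 0))
    (he : ∀ n, ∀ᵐ t ∂ν, kn n t + fn n t + ∫ s, kn n s * Fn n s t ∂ν = 0) :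
    ∀ᵐ t ∂ν, k t + f t + ∫ s, k s * F s t ∂ν = 0 := by
  have X : ∫⁻ t, ‖k t + f t + ∫ s, k s * F s t ∂ν‖ₑ ∂ν = 0 := by
    obtain ⟨δ, hδ⟩ : ∃ δ : ℕ → ℝ≥0∞, ∀ n, δ n = ∫⁻ t, ‖k t - kn n t‖ₑ ∂ν := ⟨_, fun _ => rfl⟩
    simp only [← hδ] at hkl
    have B : ∀ n, ∫⁻ t, ‖k t + f t + ∫ s, k s * F s t ∂ν‖ₑ ∂ν ≤ δ n + η n + (A * δ n + η n * ((∫⁻ t, ‖k t‖ₑ ∂ν) + δ n)) := by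
      intro n
      have dk : Integrable (fun t => k t - kn n t) ν := hk.sub (hkn n)
      have dF : StronglyMeasurable (Function.uncurry fun s t => F s t - Fn n s t) := hF.sub (hFn n)
      obtain ⟨a1, b1, c1⟩ := conv_bound dk hF hA hFA
      obtain ⟨a2, b2, c2⟩ := conv_bound (hkn n) dF (hη n) (hd n)
      obtain ⟨-, b3, -⟩ := conv_bound (hkn n) hF hA hFA
      have e : ∀ᵐ t ∂ν, k t + f t + ∫ s, k s * F s t ∂ν = (k t - kn n t) + (f t - fn n t) +
          ((∫ s, (k s - kn n s) * F s t ∂ν) + ∫ s, kn n s * (F s t - Fn n s t) ∂ν) := by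
        filter_upwards [he n, b1, b2, b3] with t e1 b1 b2 b3
        have i4 : Integrable (fun s => kn n s * Fn n s t) ν := by
          have := b3.sub b2
          refine this.congr (Eventually.of_forall fun s => ?_)
          simp only [Pi.sub_apply, mul_sub, sub_sub_cancel]
        have q1 : ∫ s, (k s - kn n s) * F s t ∂ν = ∫ s, k s * F s t ∂ν - ∫ s, kn n s * F s t ∂ν := by
          rw [← integral_sub _ b3]
          · simp only [sub_mul]
          · refine (b1.add b3).congr (Eventually.of_forall fun s => ?_)
            simp only [Pi.add_apply, sub_mul, sub_add_cancel]
        have q2 : ∫ s, kn n s * (F s t - Fn n s t) ∂ν = ∫ s, kn n s * F s t ∂ν - ∫ s, kn n s * Fn n s t ∂ν := by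
          rw [← integral_sub b3 i4]
          simp only [mul_sub]
        rw [q1, q2]
        have := sub_eq_zero.1 ((sub_zero _).trans e1)
        rw [← sub_eq_zero]
        rw [← e1]
        abel
      have kb : ∫⁻ t, ‖kn n t‖ₑ ∂ν ≤ (∫⁻ t, ‖k t‖ₑ ∂ν) + δ n := by
        rw [hδ, ← lintegral_add_left' hk.1.enorm]
        refine lintegral_mono fun t => ?_
        have : kn n t = k t - (k t - kn n t) := by abel
        conv_lhs => rw [this]
        exact enorm_sub_le
      rw [lintegral_congr_ae (e.mono fun t ht => congrArg enorm ht)]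
      calc _ ≤ ∫⁻ t, ((‖k t - kn n t‖ₑ + ‖f t - fn n t‖ₑ) + (‖∫ s, (k s - kn n s) * F s t ∂ν‖ₑ + ‖∫ s, kn n s * (F s t - Fn n s t) ∂ν‖ₑ)) ∂ν :=
            lintegral_mono fun t => (enorm_add_le _ _).trans (add_le_add (enorm_add_le _ _) (enorm_add_le _ _))
        _ = ((∫⁻ t, ‖k t - kn n t‖ₑ ∂ν) + ∫⁻ t, ‖f t - fn n t‖ₑ ∂ν) + ((∫⁻ t, ‖∫ s, (k s - kn n s) * F s t ∂ν‖ₑ ∂ν) + ∫⁻ t, ‖∫ s, kn n s * (F s t - Fn n s t) ∂ν‖ₑ ∂ν) := by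
            have m1 : AEMeasurable (fun t => ‖k t - kn n t‖ₑ + ‖f t - fn n t‖ₑ) ν := dk.1.enorm.add (hf.sub (hfn n)).enorm
            rw [lintegral_add_left' m1, lintegral_add_left' dk.1.enorm, lintegral_add_left' c1.enorm]
        _ ≤ _ := by
            rw [hδ n]
            refine add_le_add (add_le_add le_rfl (hfl n)) (add_le_add a1 (a2.trans ?_))
            gcongr
            rw [← hδ n]; exact kb
    have L : Tendsto (fun n => δ n + η n + (A * δ n + η n * ((∫⁻ t, ‖k t‖ₑ ∂ν) + δ n))) atTop (nhds (0 + 0 + (A * 0 + 0 * ((∫⁻ t, ‖k t‖ₑ ∂ν) + 0)))) := by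
      refine (hkl.add hη0).add (Tendsto.add (ENNReal.Tendsto.const_mul hkl (Or.inr hA)) (ENNReal.Tendsto.mul hη0 (Or.inr ?_) (tendsto_const_nhds.add hkl) (Or.inr (by simp))))
      rw [add_zero]; exact hk.2.ne
    simp only [mul_zero, add_zero, zero_mul] at L
    exact le_antisymm (ge_of_tendsto' L B) zero_le
  have m : AEMeasurable (fun t => ‖k t + f t + ∫ s, k s * F s t ∂ν‖ₑ) ν :=
    ((hk.1.add hf).add (conv_bound hk hF hA hFA).2.2).enorm
  rw [lintegral_eq_zero_iff' m] at X
  filter_upwards [X] with t ht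
  simpa using ht

lemma krein_uniq {x : ℝ} (hx : 0 ≤ x) {D : ℝ → M2} {F : ℝ → ℝ → M2} {Fn : ℕ → ℝ → ℝ → M2}
    (hD : IntervalIntegrable D volume 0 x) (hF : StronglyMeasurable (Function.uncurry F))
    (hFn : ∀ n, StronglyMeasurable (Function.uncurry (Fn n))) {A : ℝ≥0∞} (hA : A ≠ ∞) (hFA : ∀ s, ∫⁻ t in Ioc 0 x, ‖F s t‖ₑ ≤ A)
    {η : ℕ → ℝ≥0∞} (hη : ∀ n, η n ≠ ∞) (hη0 : Tendsto η atTop (nhds 0)) (hd : ∀ n s, ∫⁻ t in Ioc 0 x, ‖F s t - Fn n s t‖ₑ ≤ η n)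
    {C : ℝ≥0∞} (hC : C ≠ ∞) (hM : ∀ n, MLB (Fn n) x C) (he : ∀ᵐ t ∂(volume.restrict (Ioc 0 x)), D t + ∫ s in (0:ℝ)..x, D s * F s t = 0) :
    ∀ᵐ t ∂(volume.restrict (Ioc 0 x)), D t = 0 := by
  have hD' := hD
  rw [intervalIntegrable_iff_integrableOn_Ioc_of_le hx] at hD'
  have hD'' : Integrable D (volume.restrict (Ioc 0 x)) := hD'
  have X : ∫⁻ t in Ioc 0 x, ‖D t‖ₑ = 0 := by
    have B : ∀ n, ∫⁻ t in Ioc 0 x, ‖D t‖ₑ ≤ C * (η n * ∫⁻ t in Ioc 0 x, ‖D t‖ₑ) := by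
      intro n
      have dF : StronglyMeasurable (Function.uncurry fun s t => F s t - Fn n s t) := hF.sub (hFn n)
      obtain ⟨a2, b2, c2⟩ := conv_bound hD'' dF (hη n) (hd n)
      obtain ⟨-, b3, -⟩ := conv_bound hD'' hF hA hFA
      refine (hM n D hD).trans ?_
      gcongr
      refine le_trans (le_of_eq (lintegral_congr_ae ?_)) a2
      filter_upwards [he, b2, b3] with t he b2 b3
      have i4 : Integrable (fun s => D s * Fn n s t) (volume.restrict (Ioc 0 x)) := by
        have := b3.sub b2
        refine this.congr (Eventually.of_forall fun s => ?_)
        simp only [Pi.sub_apply, mul_sub, sub_sub_cancel]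
      rw [intervalIntegral.integral_of_le hx] at he ⊢
      simp only [mul_sub]
      rw [integral_sub b3 i4, ← enorm_neg]
      congr 1
      rw [← sub_eq_zero, ← neg_eq_zero, ← he]
      abel
    have L : Tendsto (fun n => C * (η n * ∫⁻ t in Ioc 0 x, ‖D t‖ₑ)) atTop (nhds (C * (0 * ∫⁻ t in Ioc 0 x, ‖D t‖ₑ))) :=
      ENNReal.Tendsto.const_mul (ENNReal.Tendsto.mul_const hη0 (Or.inr hD''.2.ne)) (Or.inr hC)
    rw [zero_mul, mul_zero] at L
    exact le_antisymm (ge_of_tendsto' L B) zero_le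
  rw [lintegral_eq_zero_iff' hD''.1.enorm] at X
  filter_upwards [X] with t ht
  simpa using ht

lemma rIoo (x : ℝ) : (volume.restrict (Ioo 0 x) : Measure ℝ) = volume.restrict (Ioc 0 x) := Measure.restrict_congr_set Ioo_ae_eq_Ioc

instance : IsProbabilityMeasure μ01 := ⟨by rw [mu01_eq]; simp⟩

lemma row_part {x : ℝ} (hx : 0 ≤ x) {F Ft : ℝ → ℝ → M2} {Fn : ℕ → ℝ → ℝ → M2} {k : ℝ → M2} {kn : ℕ → ℝ → M2}
    (hk : IntervalIntegrable k volume 0 x) (hkn : ∀ n, IntervalIntegrable (kn n) volume 0 x)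
    (hF : StronglyMeasurable (Function.uncurry Ft))
    (hFn : ∀ n, StronglyMeasurable (Function.uncurry (Fn n))) {A : ℝ≥0∞} (hA : A ≠ ∞) (hFA : ∀ s, ∫⁻ t in Ioc 0 x, ‖Ft s t‖ₑ ≤ A)
    {η : ℕ → ℝ≥0∞} (hη : ∀ n, η n ≠ ∞) (hη0 : Tendsto η atTop (nhds 0)) (hd : ∀ n s, ∫⁻ t in Ioc 0 x, ‖Ft s t - Fn n s t‖ₑ ≤ η n)
    (tr1 : ∀ᵐ t ∂(volume.restrict (Ioc 0 x)), F x t = Ft x t)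
    (tr2 : ∀ᵐ t ∂(volume.restrict (Ioc 0 x)), ∀ᵐ s ∂(volume.restrict (Ioc 0 x)), F s t = Ft s t)
    {C : ℝ≥0∞} (hC : C ≠ ∞) (hM : ∀ n, MLB (Fn n) x C)
    (he : ∀ n, ∀ t ∈ Ioc 0 x, kn n t + Fn n x t + ∫ s in (0:ℝ)..x, kn n s * Fn n s t = 0)
    (hkl : Tendsto (fun n => ∫⁻ t in Ioc 0 x, ‖k t - kn n t‖ₑ) atTop (nhds 0)) :
    (∀ᵐ t ∂(volume.restrict (Ioo 0 x)), k t + F x t + ∫ s in (0:ℝ)..x, k s * F s t = 0) ∧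
    ∀ k' : ℝ → M2, IntervalIntegrable k' volume 0 x → (∀ᵐ t ∂(volume.restrict (Ioo 0 x)), k' t + F x t + ∫ s in (0:ℝ)..x, k' s * F s t = 0) →
      ∀ᵐ t ∂(volume.restrict (Ioc 0 x)), k' t = k t := by
  rw [rIoo]
  have toI : ∀ {k : ℝ → M2}, IntervalIntegrable k volume 0 x → Integrable k (volume.restrict (Ioc 0 x)) := fun h => by
    rw [intervalIntegrable_iff_integrableOn_Ioc_of_le hx] at h; exact h
  have e0 := krein_lim (toI hk) (fun n => toI (hkn n)) hF hFn hA hFA hη hη0 hd (f := Ft x) (fn := fun n => Fn n x)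
    (hF.comp_measurable measurable_prodMk_left).aestronglyMeasurable (fun n => ((hFn n).comp_measurable measurable_prodMk_left).aestronglyMeasurable)
    (fun n => hd n x) hkl (fun n => by
      filter_upwards [ae_restrict_mem measurableSet_Ioc] with t ht
      rw [← intervalIntegral.integral_of_le hx]; exact he n t ht)
  have sw : ∀ᵐ t ∂(volume.restrict (Ioc 0 x)), F x t = Ft x t ∧ ∀ k : ℝ → M2, ∫ s in (0:ℝ)..x, k s * F s t = ∫ s in Ioc 0 x, k s * Ft s t := by
    filter_upwards [tr1, tr2] with t h1 h2
    refine ⟨h1, fun k => ?_⟩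
    rw [intervalIntegral.integral_of_le hx]
    refine integral_congr_ae ?_
    filter_upwards [h2] with s hs
    rw [hs]
  refine ⟨?_, fun k' hk' hek' => ?_⟩
  · filter_upwards [e0, sw] with t h1 h2
    rw [h2.1, h2.2]; exact h1
  · have := krein_uniq hx (D := fun t => k' t - k t) (hk'.sub hk) hF hFn hA hFA hη hη0 hd hC hM ?_
    · filter_upwards [this] with t ht
      exact sub_eq_zero.1 ht
    · filter_upwards [e0, sw, hek', (conv_bound (toI hk) hF hA hFA).2.1, (conv_bound (toI hk') hF hA hFA).2.1] with t h1 h2 h3 i1 i2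
      rw [h2.1, h2.2] at h3
      rw [intervalIntegral.integral_of_le hx]
      simp only [sub_mul]
      rw [integral_sub i2 i1]
      have := h3.trans h1.symm
      rw [← sub_eq_zero] at this
      rw [← this]; abel

lemma MemLp.ii01 {p : ℝ≥0∞} (hp : 1 ≤ p) {k : ℝ → M2} (h : MemLp k p μ01) {x : ℝ} (hx : x ∈ Icc (0:ℝ) 1) : IntervalIntegrable k volume 0 x := by
  have h1 : Integrable k μ01 := h.integrable hp
  rw [mu01_eq] at h1
  rw [intervalIntegrable_iff_integrableOn_Ioc_of_le hx.1]
  exact IntegrableOn.mono_set h1 (Ioc_subset_Ioc_right hx.2)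

lemma L1_row {p : ℝ≥0∞} (hp : 1 ≤ p) {k : ℝ → M2} (h : AEStronglyMeasurable k μ01) {x : ℝ} (hx : x ∈ Icc (0:ℝ) 1) :
    ∫⁻ t in Ioc 0 x, ‖k t‖ₑ ≤ eLpNorm k p μ01 := by
  refine le_trans ?_ (eLpNorm_le_eLpNorm_of_exponent_le hp h)
  rw [eLpNorm_one_eq_lintegral_enorm, mu01_eq]
  exact lintegral_mono_set (Ioc_subset_Ioc_right hx.2)

/-- generic solution and uniqueness statement -/
lemma gen_part {p : ℝ≥0∞} (hp : 1 ≤ p) {F Ft : ℝ → ℝ → M2} {Fn : ℕ → ℝ → ℝ → M2} {K : ℝ → ℝ → M2} {Kn : ℕ → ℝ → ℝ → M2}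
    (hK : MemGp p K) (hKn : ∀ n, MemGp p (Kn n)) (hs : ∀ x t : ℝ, ¬ (0 ≤ t ∧ t ≤ x ∧ x ≤ 1) → K x t = 0)
    (hF : StronglyMeasurable (Function.uncurry Ft))
    (hFn : ∀ n, StronglyMeasurable (Function.uncurry (Fn n))) {A : ℝ≥0∞} (hA : A ≠ ∞) (hFA : ∀ s, ∫⁻ t, ‖Ft s t‖ₑ ≤ A)
    {η : ℕ → ℝ≥0∞} (hη : ∀ n, η n ≠ ∞) (hη0 : Tendsto η atTop (nhds 0)) (hd : ∀ n s, ∫⁻ t, ‖Ft s t - Fn n s t‖ₑ ≤ η n)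
    (tr1 : ∀ x ∈ Icc (0:ℝ) 1, ∀ᵐ t ∂(volume.restrict (Ioc 0 x)), F x t = Ft x t)
    (tr2 : ∀ x ∈ Icc (0:ℝ) 1, ∀ᵐ t ∂(volume.restrict (Ioc 0 x)), ∀ᵐ s ∂(volume.restrict (Ioc 0 x)), F s t = Ft s t)
    {C : ℝ≥0∞} (hC : C ≠ ∞) (hM : ∀ n, ∀ x ∈ Icc (0:ℝ) 1, MLB (Fn n) x C)
    (he : ∀ n, ∀ x ∈ Icc (0:ℝ) 1, ∀ t ∈ Ioc 0 x, Kn n x t + Fn n x t + ∫ s in (0:ℝ)..x, Kn n x s * Fn n s t = 0)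
    (hkl : ∀ x ∈ Icc (0:ℝ) 1, Tendsto (fun n => eLpNorm (fun t => Kn n x t - K x t) p μ01) atTop (nhds 0)) :
    SolvesGLMwith F K ∧ ∀ K' : ℝ → ℝ → M2, MemGp p K' → SolvesGLMwith F K' →
      ∀ x ∈ Icc (0:ℝ) 1, (fun t => K' x t) =ᵐ[μ01] (fun t => K x t) := by
  have main := fun x (hx : x ∈ Icc (0:ℝ) 1) => row_part hx.1 (MemLp.ii01 hp (hK.1 x hx) hx) (fun n => MemLp.ii01 hp ((hKn n).1 x hx) hx) hF hFn hA
    (fun s => (setLIntegral_le_lintegral _ _).trans (hFA s)) hη hη0 (fun n s => (setLIntegral_le_lintegral _ _).trans (hd n s)) (tr1 x hx) (tr2 x hx) hC (fun n => hM n x hx)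
    (fun n => he n x hx) (by
      refine tendsto_of_tendsto_of_tendsto_of_le_of_le tendsto_const_nhds (hkl x hx) (fun _ => zero_le) (fun n => ?_)
      have := L1_row hp (k := fun t => Kn n x t - K x t) (((hKn n).1 x hx).1.sub (hK.1 x hx).1) hx
      refine le_trans (le_of_eq ?_) this
      exact lintegral_congr fun t => enorm_sub_rev _ _)
  refine ⟨⟨hs, fun x hx => (main x hx).1⟩, fun K' hK' hsK' x hx => ?_⟩
  have h1 := (main x hx).2 (K' x) (MemLp.ii01 hp (hK'.1 x hx) hx) (hsK'.2 x hx)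
  rw [ae_restrict_iff' measurableSet_Ioc] at h1
  rw [mu01_eq]
  filter_upwards [ae_restrict_of_ae h1, ae_restrict_mem measurableSet_Ioc] with t ht hm
  by_cases htx : t ≤ x
  · exact ht ⟨hm.1, htx⟩
  · rw [hs x t (fun h => htx h.2.1), hsK'.1 x t (fun h => htx h.2.1)]

lemma ae_affine {P : ℝ → Prop} (h : ∀ᵐ u : ℝ, P u) (a b : ℝ) (ha : a ≠ 0) : ∀ᵐ t : ℝ, P (a * t + b) := by
  have h1 : ∀ᵐ u : ℝ, P (u + b) := (measurePreserving_add_right volume b).quasiMeasurePreserving.ae h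
  rw [ae_iff] at h1 ⊢
  have := Real.volume_preimage_mul_left ha {u | ¬ P (u + b)}
  rw [h1, mul_zero] at this
  exact this

lemma MLB.congr {F F' : ℝ → ℝ → M2} {x : ℝ} (hx : 0 ≤ x) {C : ℝ≥0∞} (h : MLB F x C) (hF : ∀ s ∈ Icc 0 x, ∀ t ∈ Icc 0 x, F s t = F' s t) : MLB F' x C := by
  intro D hD
  have e : ∀ t ∈ Icc 0 x, ∫ s in (0:ℝ)..x, D s * F s t = ∫ s in (0:ℝ)..x, D s * F' s t := by
    intro t ht
    refine intervalIntegral.integral_congr fun s hs => ?_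
    rw [uIcc_of_le hx] at hs
    exact congrArg (fun A => D s * A) (hF s hs t ht)
  have e2 : ∫⁻ t in Ioc 0 x, ‖D t + ∫ s in (0:ℝ)..x, D s * F s t‖ₑ = ∫⁻ t in Ioc 0 x, ‖D t + ∫ s in (0:ℝ)..x, D s * F' s t‖ₑ :=
    setLIntegral_congr_fun measurableSet_Ioc fun t ht => congrArg (fun A => ‖D t + A‖ₑ) (e t (Ioc_subset_Icc_self ht))
  rw [← e2]
  exact h D hD

/-- truncated matrix function -/
def ES.HT (E : ES) (u : ℝ) : M2 := PhiL (E.hk u)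

lemma ES.HT_eq (E : ES) {u : ℝ} (hu : u ∈ Icc (-1:ℝ) 1) : E.HT u = E.HM u := by
  unfold ES.HT ES.HM; rw [E.hk_eq hu]

lemma ES.sm_HT (E : ES) : StronglyMeasurable E.HT := PhiL.continuous.comp_stronglyMeasurable E.measurable_hk.stronglyMeasurable

lemma krein_part {p : ℝ≥0∞} (hp : 1 ≤ p) (hp' : p ≠ ∞) {H Ht : ℝ → M2} (hm : StronglyMeasurable Ht) (hA : ∫⁻ u, ‖Ht u‖ₑ ≠ ∞)
    (hHt : ∀ᵐ u : ℝ, u ∈ Ioo (-1:ℝ) 1 → H u = Ht u) {E : ℕ → ES} (hreg : ∀ n, (E n).Reg) {M : ℝ} (hM : 0 ≤ M) (hlb : ∀ n, LB (E n) M)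
    (hη1 : ∀ n, ∫⁻ u, ‖Ht u - (E n).HT u‖ₑ ≠ ∞)
    (hη : Tendsto (fun n => ∫⁻ u, ‖Ht u - (E n).HT u‖ₑ) atTop (nhds 0)) {R : ℝ → ℝ → M2} (hR : MemGp p R)
    (hs : ∀ x t : ℝ, ¬ (0 ≤ t ∧ t ≤ x ∧ x ≤ 1) → R x t = 0)
    (hkl : ∀ x ∈ Icc (0:ℝ) 1, Tendsto (fun n => eLpNorm (fun t => (E n).RK x t - R x t) p μ01) atTop (nhds 0)) :
    SolvesKrein H R ∧ ∀ R' : ℝ → ℝ → M2, MemGp p R' → SolvesKrein H R' →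
      ∀ x ∈ Icc (0:ℝ) 1, (fun t => R' x t) =ᵐ[μ01] (fun t => R x t) := by
  obtain ⟨C, hC, hCM⟩ := mlb_krein
  have sm : ∀ {G : ℝ → M2}, StronglyMeasurable G → StronglyMeasurable (Function.uncurry fun s t : ℝ => G (s - t)) := fun hG =>
    hG.comp_measurable (measurable_fst.sub measurable_snd)
  have mE : ∀ n, Measurable fun u => ‖Ht u - (E n).HT u‖ₑ := fun n => (hm.sub (E n).sm_HT).enorm
  refine gen_part hp (F := fun x t => H (x - t)) (Ft := fun x t => Ht (x - t)) (Fn := fun n x t => (E n).HT (x - t)) (K := R) (Kn := fun n => (E n).RK) hR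
    (fun n => ((E n).RK_Gp hp hp' (hreg n)).2) hs (sm hm) (fun n => sm (E n).sm_HT) hA
    (fun s => (lintegral_sub_left_eq_self (fun u => ‖Ht u‖ₑ) s).le) hη1 hη
    (fun n s => (lintegral_sub_left_eq_self (fun u => ‖Ht u - (E n).HT u‖ₑ) s).le) ?_ ?_ (C := C * ENNReal.ofReal M) (by finiteness) ?_ ?_ hkl
  · intro x hx
    rw [← rIoo, ae_restrict_iff' measurableSet_Ioo]
    filter_upwards [ae_affine hHt (-1) x (by norm_num)] with t ht hti
    have e : -1 * t + x = x - t := by ring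
    rw [e] at ht
    exact ht ⟨by linarith [hti.2, hx.1], by linarith [hti.1, hx.2]⟩
  · intro x hx
    rw [← rIoo, ae_restrict_iff' measurableSet_Ioo]
    refine Eventually.of_forall fun t ht => ?_
    rw [ae_restrict_iff' measurableSet_Ioo]
    filter_upwards [ae_affine hHt 1 (-t) (by norm_num)] with s hs hsi
    have e : 1 * s + -t = s - t := by ring
    rw [e] at hs
    exact hs ⟨by linarith [ht.2, hsi.1, hx.2], by linarith [ht.1, hsi.2, hx.2]⟩
  · intro n x hx
    exact (hCM (E n) M hM (hlb n) x hx).congr hx.1 fun s hs t ht => ((E n).HT_eq (mem_sub_Icc hx hs ht)).symm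
  · intro n x hx t ht
    have ht' := Ioc_subset_Icc_self ht
    have k := RK_krein (hreg n) hx ht'
    rw [(E n).HT_eq (mem_sub_Icc hx (right_mem_Icc.2 hx.1) ht')]
    rw [intervalIntegral.integral_congr (g := fun s => (E n).RK x s * PhiL ((E n).h (s - t)))]
    · exact k
    · intro s hs
      rw [uIcc_of_le hx.1] at hs
      exact congrArg (fun A => (E n).RK x s * A) ((E n).HT_eq (mem_sub_Icc hx hs ht'))

lemma Fker_sub (A B : ℝ → M2) (s t : ℝ) : Fker A s t - Fker B s t = Fker (fun u => A u - B u) s t := by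
  unfold Fker
  rw [← smul_sub]
  congr 1
  rw [sub_mul, add_sub_add_comm]

lemma lint_half {g : ℝ → ℝ≥0∞} (hg : Measurable g) {c : ℝ} (hc : |c| = 1/2) (b : ℝ) : ∫⁻ t, g (c * t + b) ≤ 2 * ∫⁻ t, g t := by
  have := eLpNorm_affine le_rfl (by simp) hg (c := c) (b := b) (by rw [hc])
  rwa [eLpNorm_one_eq_lintegral_enorm, eLpNorm_one_eq_lintegral_enorm] at this

lemma Fker_lint {A : ℝ → M2} (hA : StronglyMeasurable A) (s : ℝ) : ∫⁻ t, ‖Fker A s t‖ₑ ≤ (2 + 2 * ‖Jmat‖ₑ) * ∫⁻ u, ‖A u‖ₑ := by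
  have e1 : ∀ t, (-1/2) * t + s/2 = (s - t)/2 := fun t => by ring
  have e2 : ∀ t, (1/2) * t + s/2 = (s + t)/2 := fun t => by ring
  have h1 := lint_half hA.enorm (c := -1/2) (by norm_num [abs_div]) (s/2)
  have h2 := lint_half hA.enorm (c := 1/2) (by norm_num [abs_div]) (s/2)
  simp only [e1, e2] at h1 h2
  have h : ∀ t, ‖Fker A s t‖ₑ ≤ ‖A ((s-t)/2)‖ₑ + ‖Jmat‖ₑ * ‖A ((s+t)/2)‖ₑ := by
    intro t
    unfold Fker
    rw [enorm_smul]
    have q : ‖(2:ℂ)⁻¹‖ₑ ≤ 1 := by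
      rw [← ofReal_norm, norm_inv, Complex.norm_two]
      exact (ENNReal.ofReal_le_ofReal (by norm_num : (2:ℝ)⁻¹ ≤ 1)).trans_eq ENNReal.ofReal_one
    have q2 : ‖A ((s+t)/2) * Jmat‖ₑ ≤ ‖Jmat‖ₑ * ‖A ((s+t)/2)‖ₑ := by
      rw [← ofReal_norm, ← ofReal_norm, ← ofReal_norm, ← ENNReal.ofReal_mul (norm_nonneg _), mul_comm ‖Jmat‖]
      exact ENNReal.ofReal_le_ofReal (norm_mul_le _ _)
    calc _ ≤ 1 * (‖A ((s-t)/2)‖ₑ + ‖A ((s+t)/2) * Jmat‖ₑ) := mul_le_mul' q (enorm_add_le _ _)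
      _ ≤ _ := by rw [one_mul]; gcongr
  refine (lintegral_mono h).trans ?_
  have mm : Measurable fun t : ℝ => ‖A ((s-t)/2)‖ₑ := hA.enorm.comp (by fun_prop : Measurable fun t : ℝ => (s-t)/2)
  rw [lintegral_add_left mm, lintegral_const_mul' _ _ (by finiteness)]
  calc _ ≤ 2 * (∫⁻ u, ‖A u‖ₑ) + ‖Jmat‖ₑ * (2 * ∫⁻ u, ‖A u‖ₑ) := by gcongr
    _ = _ := by ring

lemma sm_Fker {A : ℝ → M2} (hA : StronglyMeasurable A) : StronglyMeasurable (Function.uncurry (Fker A)) := by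
  have a1 : StronglyMeasurable (fun z : ℝ × ℝ => A ((z.1 - z.2)/2)) := hA.comp_measurable (by fun_prop)
  have a2 : StronglyMeasurable (fun z : ℝ × ℝ => A ((z.1 + z.2)/2)) := hA.comp_measurable (by fun_prop)
  have a3 : StronglyMeasurable (fun z : ℝ × ℝ => A ((z.1 + z.2)/2) * Jmat) := a2.mul stronglyMeasurable_const
  have a4 : StronglyMeasurable (fun z : ℝ × ℝ => (2:ℂ)⁻¹ • (A ((z.1 - z.2)/2) + A ((z.1 + z.2)/2) * Jmat)) := (a1.add a3).const_smul (2:ℂ)⁻¹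
  exact a4

lemma glm_part {p : ℝ≥0∞} (hp : 1 ≤ p) (hp' : p ≠ ∞) {H Ht : ℝ → M2} (hm : StronglyMeasurable Ht) (hA : ∫⁻ u, ‖Ht u‖ₑ ≠ ∞)
    (hHt : ∀ᵐ u : ℝ, u ∈ Ioo (-1:ℝ) 1 → H u = Ht u) {E : ℕ → ES} (hreg : ∀ n, (E n).Reg) {M : ℝ} (hM : 0 ≤ M) (hlb : ∀ n, LB (E n) M)
    (hη1 : ∀ n, ∫⁻ u, ‖Ht u - (E n).HT u‖ₑ ≠ ∞)
    (hη : Tendsto (fun n => ∫⁻ u, ‖Ht u - (E n).HT u‖ₑ) atTop (nhds 0)) {K : ℝ → ℝ → M2} (hK : MemGp p K)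
    (hs : ∀ x t : ℝ, ¬ (0 ≤ t ∧ t ≤ x ∧ x ≤ 1) → K x t = 0)
    (hkl : ∀ x ∈ Icc (0:ℝ) 1, Tendsto (fun n => eLpNorm (fun t => (E n).KK x t - K x t) p μ01) atTop (nhds 0)) :
    SolvesGLMwith (Fker H) K ∧ ∀ K' : ℝ → ℝ → M2, MemGp p K' → SolvesGLMwith (Fker H) K' →
      ∀ x ∈ Icc (0:ℝ) 1, (fun t => K' x t) =ᵐ[μ01] (fun t => K x t) := by
  obtain ⟨C, hC, hCM⟩ := mlb_glm
  have hη' : Tendsto (fun n => (2 + 2 * ‖Jmat‖ₑ) * ∫⁻ u, ‖Ht u - (E n).HT u‖ₑ) atTop (nhds 0) := by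
    have := ENNReal.Tendsto.const_mul (a := 2 + 2 * ‖Jmat‖ₑ) hη (Or.inr (by finiteness))
    rwa [mul_zero] at this
  have FE : ∀ n s t : ℝ, ∀ m, s ∈ Icc (0:ℝ) 1 → t ∈ Icc (0:ℝ) 1 → Fker (E m).HT s t = Fker (E m).HM s t := by
    intro _ s t m hs ht
    unfold Fker
    rw [(E m).HT_eq ⟨by linarith [hs.1, ht.2], by linarith [hs.2, ht.1]⟩, (E m).HT_eq ⟨by linarith [hs.1, ht.1], by linarith [hs.2, ht.2]⟩]
  have sub : ∀ {x t : ℝ}, x ∈ Icc (0:ℝ) 1 → t ∈ Icc 0 x → t ∈ Icc (0:ℝ) 1 := fun hx ht => ⟨ht.1, ht.2.trans hx.2⟩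
  refine gen_part hp (F := Fker H) (Ft := Fker Ht) (Fn := fun n => Fker (E n).HT) (K := K) (Kn := fun n => (E n).KK) hK
    (fun n => ((E n).KK_Gp hp hp' (hreg n)).2) hs (sm_Fker hm) (fun n => sm_Fker (E n).sm_HT) (A := (2 + 2 * ‖Jmat‖ₑ) * ∫⁻ u, ‖Ht u‖ₑ) (by finiteness)
    (fun s => Fker_lint hm s) (fun n => ENNReal.mul_ne_top (by finiteness) (hη1 n)) hη'
    (fun n s => ?_) ?_ ?_ (C := C * ENNReal.ofReal M) (by finiteness) ?_ ?_ hkl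
  · simp only [Fker_sub]
    exact Fker_lint (hm.sub (E n).sm_HT) s
  · intro x hx
    rw [← rIoo, ae_restrict_iff' measurableSet_Ioo]
    filter_upwards [ae_affine hHt (-1/2) (x/2) (by norm_num), ae_affine hHt (1/2) (x/2) (by norm_num)] with t h1 h2 hti
    have e1 : (-1/2) * t + x/2 = (x - t)/2 := by ring
    have e2 : (1/2) * t + x/2 = (x + t)/2 := by ring
    rw [e1] at h1; rw [e2] at h2
    unfold Fker
    rw [h1 ⟨by linarith [hti.2, hx.1], by linarith [hti.1, hx.2]⟩, h2 ⟨by linarith [hti.1, hx.1], by linarith [hti.2, hx.2]⟩]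
  · intro x hx
    rw [← rIoo, ae_restrict_iff' measurableSet_Ioo]
    refine Eventually.of_forall fun t ht => ?_
    rw [ae_restrict_iff' measurableSet_Ioo]
    filter_upwards [ae_affine hHt (1/2) (-t/2) (by norm_num), ae_affine hHt (1/2) (t/2) (by norm_num)] with s h1 h2 hsi
    have e1 : (1/2) * s + -t/2 = (s - t)/2 := by ring
    have e2 : (1/2) * s + t/2 = (s + t)/2 := by ring
    rw [e1] at h1; rw [e2] at h2
    unfold Fker
    rw [h1 ⟨by linarith [ht.2, hsi.1, hx.2], by linarith [ht.1, hsi.2, hx.2]⟩, h2 ⟨by linarith [ht.1, hsi.1, hx.2], by linarith [ht.2, hsi.2, hx.2]⟩]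
  · intro n x hx
    exact (hCM (E n) M hM (hlb n) x hx).congr hx.1 fun s hs t ht => (FE 0 s t n (sub hx hs) (sub hx ht)).symm
  · intro n x hx t ht
    have ht' := Ioc_subset_Icc_self ht
    have k := KK_glm (hreg n) hx ht'
    rw [FE 0 x t n hx (sub hx ht')]
    rw [intervalIntegral.integral_congr (g := fun s => (E n).KK x s * Fker (E n).HM s t)]
    · exact k
    · intro s hs
      rw [uIcc_of_le hx.1] at hs
      exact congrArg (fun A => (E n).KK x s * A) (FE 0 s t n (sub hx hs) (sub hx ht'))

def vp : Fin 2 → ℂ := ![1, I]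
def vm : Fin 2 → ℂ := ![1, -I]

lemma Phi_vp (z : ℂ) : (PhiL z).mulVec vp = z • vp := by
  have hz : (z.re : ℂ) + z.im * I = z := re_add_im z
  rw [PhiL_apply]
  ext i; fin_cases i
  · simp [PhiF, vp, Matrix.mulVec, dotProduct, Fin.sum_univ_two]
  · simp [PhiF, vp, Matrix.mulVec, dotProduct, Fin.sum_univ_two]
    linear_combination I * hz - (z.im:ℂ) * I_mul_I

lemma Phi_vm (z : ℂ) : (PhiL z).mulVec vm = cj z • vm := by
  have hz : (z.re : ℂ) - z.im * I = cj z := by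
    apply Complex.ext <;> simp
  rw [PhiL_apply]
  ext i; fin_cases i
  · simp [PhiF, vm, Matrix.mulVec, dotProduct, Fin.sum_univ_two]
    linear_combination hz
  · simp [PhiF, vm, Matrix.mulVec, dotProduct, Fin.sum_univ_two]
    linear_combination -I * hz - (z.im:ℂ) * I_mul_I

lemma J_vp : Jmat.mulVec vp = vm := by
  ext i; fin_cases i <;> simp [Jmat, vp, vm, Matrix.mulVec, dotProduct, Fin.sum_univ_two]
lemma J_vm : Jmat.mulVec vm = vp := by
  ext i; fin_cases i <;> simp [Jmat, vp, vm, Matrix.mulVec, dotProduct, Fin.sum_univ_two]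
lemma B_vp : Bmat.mulVec vp = I • vp := by
  ext i; fin_cases i <;> simp [Bmat, vp, Matrix.mulVec, dotProduct, Fin.sum_univ_two]
lemma B_vm : Bmat.mulVec vm = (-I) • vm := by
  ext i; fin_cases i <;> simp [Bmat, vm, Matrix.mulVec, dotProduct, Fin.sum_univ_two]

lemma c0_eq (l : ℂ) (t : ℝ) : c0 l t = (2:ℂ)⁻¹ • (cexp (-(I*l*t)) • vp + cexp (I*l*t) • vm) := by
  have e1 : l * t * I = I*l*t := by ring
  have e2 : -(l * t) * I = -(I*l*t) := by ring
  ext i; fin_cases i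
  · simp [c0, vp, vm, Complex.cos, e1]; ring
  · simp [c0, vp, vm, Complex.sin, e1]; ring

lemma KK_c0 (E : ES) (l : ℂ) {x t : ℝ} (h : (x,t) ∈ Tri) : (E.KK x t).mulVec (c0 l t) =
    (4:ℂ)⁻¹ • ((E.r x ((x+t)/2) * cexp (-(I*l*t)) + E.r x ((x-t)/2) * cexp (I*l*t)) • vp +
      (cj (E.r x ((x+t)/2)) * cexp (I*l*t) + cj (E.r x ((x-t)/2)) * cexp (-(I*l*t))) • vm) := by
  have e : (x + -1 * t)/2 = (x-t)/2 := by ring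
  simp only [ES.KK, ES.kk, c0_eq]
  rw [triI_of_mem h, triI_of_mem h, one_mul, e]
  simp only [Matrix.smul_mulVec, Matrix.mulVec_smul, Matrix.add_mulVec, Matrix.mulVec_add, ← Matrix.mulVec_mulVec, J_vp, J_vm, Phi_vp, Phi_vm]
  module

lemma ES.u_eq (E : ES) (l : ℂ) {x : ℝ} (hx : x ∈ Icc (0:ℝ) 1) : c0 l x + ∫ t in (0:ℝ)..x, (E.KK x t).mulVec (c0 l t) =
    (2:ℂ)⁻¹ • (E.a l x • vp + cj (E.a (cj l) x) • vm) := by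
  have cr : Continuous fun s => E.r x s := E.continuous_trig _
  have ccr : Continuous fun s => cj (E.r x s) := continuous_cj.comp cr
  obtain ⟨g, hg⟩ : ∃ g : ℝ → ℂ, ∀ y, g y = E.r x y * cexp (-(I*l*(2*y - x))) := ⟨_, fun _ => rfl⟩
  obtain ⟨k, hk⟩ : ∃ k : ℝ → ℂ, ∀ y, k y = cj (E.r x y) * cexp (I*l*(2*y - x)) := ⟨_, fun _ => rfl⟩
  have cg : Continuous g := (by fun_prop : Continuous fun y : ℝ => E.r x y * cexp (-(I*l*(2*y - x)))).congr fun y => (hg y).symm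
  have ck : Continuous k := (by fun_prop : Continuous fun y : ℝ => cj (E.r x y) * cexp (I*l*(2*y - x))).congr fun y => (hk y).symm
  have e : ∫ t in (0:ℝ)..x, (E.KK x t).mulVec (c0 l t) = ∫ t in (0:ℝ)..x, (4:ℂ)⁻¹ • ((g ((x+t)/2) + g ((x-t)/2)) • vp + (k ((x+t)/2) + k ((x-t)/2)) • vm) := by
    refine intervalIntegral.integral_congr fun t ht => ?_
    rw [uIcc_of_le hx.1] at ht
    rw [KK_c0 E l ⟨ht.1, ht.2, hx.2⟩, hg, hg, hk, hk]
    congr 6 <;> congr 2 <;> push_cast <;> ring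
  have f1 := fold hx.1 (cg.intervalIntegrable (μ := volume) 0 x)
  have f2 := fold hx.1 (ck.intervalIntegrable (μ := volume) 0 x)
  have i1 : IntervalIntegrable (fun t => (g ((x+t)/2) + g ((x-t)/2)) • vp) volume 0 x := Continuous.intervalIntegrable (by fun_prop) _ _
  have i2 : IntervalIntegrable (fun t => (k ((x+t)/2) + k ((x-t)/2)) • vm) volume 0 x := Continuous.intervalIntegrable (by fun_prop) _ _
  rw [e, intervalIntegral.integral_smul, intervalIntegral.integral_add i1 i2, intervalIntegral.integral_smul_const,
    intervalIntegral.integral_smul_const, f1, f2, c0_eq, E.cj_a]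
  simp only [ES.a, ← hg, ← hk, Complex.real_smul]
  push_cast
  module

def mv : M2 →L[ℂ] (Fin 2 → ℂ) →L[ℂ] (Fin 2 → ℂ) :=
  LinearMap.toContinuousLinearMap (LinearMap.toContinuousLinearMap.toLinearMap ∘ₗ Matrix.toLin'.toLinearMap)

lemma mv_apply (A : M2) (v : Fin 2 → ℂ) : mv A v = A.mulVec v := rfl

def ES.u (E : ES) (l : ℂ) (x : ℝ) : Fin 2 → ℂ := (2:ℂ)⁻¹ • (E.a l x • vp + cj (E.a (cj l) x) • vm)

lemma ES.contOn_u {E : ES} (hE : E.Reg) (l : ℂ) : ContinuousOn (E.u l) (Icc 0 1) := by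
  have h1 := E.continuousOn_a hE l
  have h2 : ContinuousOn (fun x => cj (E.a (cj l) x)) (Icc 0 1) := continuous_cj.comp_continuousOn (E.continuousOn_a hE (cj l))
  exact ((h1.smul (continuousOn_const (c := vp))).add (h2.smul (continuousOn_const (c := vm)))).const_smul (2:ℂ)⁻¹

lemma w_alg (l q a b : ℂ) : -Bmat.mulVec (l • ((2:ℂ)⁻¹ • (a • vp + b • vm)) - (PhiL q * Jmat * Bmat).mulVec ((2:ℂ)⁻¹ • (a • vp + b • vm))) =
    (2:ℂ)⁻¹ • ((-(I*l) * a + q * b) • vp + ((I*l)*b + cj q * a) • vm) := by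
  simp only [Matrix.mulVec_sub, Matrix.mulVec_smul, Matrix.mulVec_add, ← Matrix.mulVec_mulVec, J_vp, J_vm, Phi_vp, Phi_vm, B_vp, B_vm]
  ext i
  simp only [Pi.neg_apply, Pi.sub_apply, Pi.add_apply, Pi.smul_apply, smul_eq_mul]
  linear_combination (2:ℂ)⁻¹ * (b * q * vp i + a * cj q * vm i) * (-I_mul_I)

lemma ES.u_int {E : ES} (hE : E.Reg) (l : ℂ) {x : ℝ} (hx : x ∈ Icc (0:ℝ) 1) :
    E.u l x = ![1, 0] + ∫ y in (0:ℝ)..x, -Bmat.mulVec (l • E.u l y - (E.RK y 0 * Jmat * Bmat).mulVec (E.u l y)) := by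
  have sub : uIcc 0 x ⊆ Icc (0:ℝ) 1 := by rw [uIcc_of_le hx.1]; exact Icc_subset_Icc_right hx.2
  have h1 := E.continuousOn_a hE l
  have h1' := E.continuousOn_a hE (cj l)
  have h2 : ContinuousOn (fun x => cj (E.a (cj l) x)) (Icc 0 1) := continuous_cj.comp_continuousOn h1'
  have h3 := E.continuousOn_r0 hE 0
  have h4 : ContinuousOn (fun x => cj (E.r x 0)) (Icc 0 1) := continuous_cj.comp_continuousOn h3
  have e : ∫ y in (0:ℝ)..x, -Bmat.mulVec (l • E.u l y - (E.RK y 0 * Jmat * Bmat).mulVec (E.u l y)) =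
     ∫ y in (0:ℝ)..x, (2:ℂ)⁻¹ • ((-(I*l) * E.a l y + E.r y 0 * cj (E.a (cj l) y)) • vp + ((I*l)* cj (E.a (cj l) y) + cj (E.r y 0) * E.a l y) • vm) := by
    refine intervalIntegral.integral_congr fun y hy => ?_
    rw [uIcc_of_le hx.1] at hy
    simp only [ES.u, ES.RK, ES.rk]
    rw [triI_of_mem ⟨le_rfl, hy.1, hy.2.trans hx.2⟩, w_alg]
  have i1 : IntervalIntegrable (fun y => -(I*l) * E.a l y + E.r y 0 * cj (E.a (cj l) y)) volume 0 x :=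
    (((continuousOn_const.mul h1).add (h3.mul h2)).mono sub).intervalIntegrable
  have i2 : IntervalIntegrable (fun y => (I*l)* cj (E.a (cj l) y) + cj (E.r y 0) * E.a l y) volume 0 x :=
    (((continuousOn_const.mul h2).add (h4.mul h1)).mono sub).intervalIntegrable
  have hb : cj (E.a (cj l) x) = 1 + ∫ y in (0:ℝ)..x, ((I*l)* cj (E.a (cj l) y) + cj (E.r y 0) * E.a l y) := by
    rw [E.a_int hE (cj l) hx, map_add, map_one, ← int_cj]
    congr 1
    refine intervalIntegral.integral_congr fun y _ => ?_
    simp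
  have j1 : IntervalIntegrable (fun y => (-(I*l) * E.a l y + E.r y 0 * cj (E.a (cj l) y)) • vp) volume 0 x :=
    ⟨i1.1.smul_const vp, i1.2.smul_const vp⟩
  have j2 : IntervalIntegrable (fun y => ((I*l)* cj (E.a (cj l) y) + cj (E.r y 0) * E.a l y) • vm) volume 0 x :=
    ⟨i2.1.smul_const vm, i2.2.smul_const vm⟩
  rw [e, intervalIntegral.integral_smul, intervalIntegral.integral_add j1 j2, intervalIntegral.integral_smul_const,
    intervalIntegral.integral_smul_const]
  unfold ES.u
  rw [E.a_int hE l hx, hb]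
  have e1 : (![1, 0] : Fin 2 → ℂ) = (2:ℂ)⁻¹ • (vp + vm) := by
    ext i; fin_cases i
    · simp [vp, vm]; norm_num
    · simp [vp, vm]
  rw [e1]
  module

lemma JB_bound (A : M2) : ‖A * Jmat * Bmat‖ₑ ≤ (‖Jmat‖ₑ * ‖Bmat‖ₑ) * ‖A‖ₑ := by
  rw [← ofReal_norm, ← ofReal_norm, ← ofReal_norm, ← ofReal_norm, ← ENNReal.ofReal_mul (norm_nonneg _), ← ENNReal.ofReal_mul (by positivity)]
  refine ENNReal.ofReal_le_ofReal ?_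
  calc _ ≤ ‖A * Jmat‖ * ‖Bmat‖ := norm_mul_le _ _
    _ ≤ ‖A‖ * ‖Jmat‖ * ‖Bmat‖ := by gcongr; exact norm_mul_le _ _
    _ = _ := by ring

lemma BB_neg (v : Fin 2 → ℂ) : Bmat.mulVec (-Bmat.mulVec v) = v := by
  have : Bmat * Bmat = -1 := by
    simp only [Bmat, Matrix.mul_fin_two]
    ext i j; fin_cases i <;> fin_cases j <;> simp
  rw [Matrix.mulVec_neg, Matrix.mulVec_mulVec, this, Matrix.neg_mulVec, Matrix.one_mulVec, neg_neg]

lemma ode_part {p : ℝ≥0∞} (hp : 1 ≤ p) (hp' : p ≠ ∞) {E : ℕ → ES} (hreg : ∀ n, (E n).Reg) {R K : ℝ → ℝ → M2} (hR : MemGp p R) (hK : MemGp p K)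
    {ε : ℕ → ℝ≥0∞} (hε : Tendsto ε atTop (nhds 0)) (hε' : ∀ n, ε n ≠ ∞)
    (hrow : ∀ n, ∀ x ∈ Icc (0:ℝ) 1, eLpNorm (fun t => (E n).KK x t - K x t) p μ01 ≤ ε n)
    (hcol : ∀ n, eLpNorm (fun x => (E n).RK x 0 - R x 0) p μ01 ≤ ε n) (l : ℂ) :
    IsVecSolution (fun x => R x 0 * Jmat * Bmat) l (fun x => c0 l x + ∫ t in (0:ℝ)..x, (K x t).mulVec (c0 l t)) ∧
    (fun x : ℝ => c0 l x + ∫ t in (0:ℝ)..x, (K x t).mulVec (c0 l t)) 0 = ![1, 0] := by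
  have z01 : (0:ℝ) ∈ Icc (0:ℝ) 1 := ⟨le_rfl, zero_le_one⟩
  obtain ⟨u, hu⟩ : ∃ u : ℝ → Fin 2 → ℂ, u = fun x => c0 l x + ∫ t in (0:ℝ)..x, (K x t).mulVec (c0 l t) := ⟨_, rfl⟩
  rw [← hu]
  have hu0 : u 0 = ![1, 0] := by rw [hu]; simp [c0]
  refine ⟨?_, hu0⟩
  have cc : Continuous (c0 l) := by
    have : c0 l = fun t : ℝ => (2:ℂ)⁻¹ • (cexp (-(I*l*t)) • vp + cexp (I*l*t) • vm) := funext (c0_eq l)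
    rw [this]; fun_prop
  obtain ⟨c, hc⟩ := isCompact_Icc.exists_bound_of_continuousOn (s := Icc (0:ℝ) 1) cc.continuousOn
  have hc0 : 0 ≤ c := (norm_nonneg _).trans (hc 0 z01)
  have dl : Tendsto (fun n => (ε n).toReal) atTop (nhds 0) := by
    have := (ENNReal.tendsto_toReal ENNReal.zero_ne_top).comp hε
    rw [ENNReal.toReal_zero] at this
    exact this
  -- uniform convergence
  have iK : ∀ {k : ℝ → M2} {x : ℝ}, x ∈ Icc (0:ℝ) 1 → MemLp k p μ01 → IntervalIntegrable (fun t => (k t).mulVec (c0 l t)) volume 0 x := by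
    intro k x hx hk
    have h1 := MemLp.ii01 hp hk hx
    rw [intervalIntegrable_iff_integrableOn_Ioc_of_le hx.1] at h1 ⊢
    have h2 : AEStronglyMeasurable (fun t => mv (k t) (c0 l t)) (volume.restrict (Ioc 0 x)) :=
      mv.aestronglyMeasurable_comp₂ h1.aestronglyMeasurable cc.aestronglyMeasurable
    refine Integrable.mono' (g := fun t => ‖mv‖ * c * ‖k t‖) (h1.norm.const_mul _) h2 ?_
    rw [ae_restrict_iff' measurableSet_Ioc]
    refine Eventually.of_forall fun t ht => ?_
    refine (mv.le_opNorm₂ _ _).trans ?_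
    have := hc t ⟨ht.1.le, ht.2.trans hx.2⟩
    calc ‖mv‖ * ‖k t‖ * ‖c0 l t‖ ≤ ‖mv‖ * ‖k t‖ * c := by gcongr
      _ = _ := by ring
  have L1 : ∀ {k : ℝ → M2} {x : ℝ} {e : ℝ≥0∞}, x ∈ Icc (0:ℝ) 1 → MemLp k p μ01 → e ≠ ∞ → eLpNorm k p μ01 ≤ e → ∫ t in (0:ℝ)..x, ‖k t‖ ≤ e.toReal := by
    intro k x e hx hk he hke
    have h1 := MemLp.ii01 hp hk hx
    rw [intervalIntegrable_iff_integrableOn_Ioc_of_le hx.1] at h1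
    rw [intervalIntegral.integral_of_le hx.1, integral_norm_eq_lintegral_enorm h1.aestronglyMeasurable]
    exact ENNReal.toReal_mono he ((L1_row hp hk.1 hx).trans hke)
  have Kn := fun n => ((E n).KK_Gp hp hp' (hreg n)).2
  have Rn := fun n => ((E n).RK_Gp hp hp' (hreg n)).2
  have ub : ∀ n, ∀ x ∈ Icc (0:ℝ) 1, ‖(E n).u l x - u x‖ ≤ ‖mv‖ * c * (ε n).toReal := by
    intro n x hx
    have dm : MemLp (fun t => (E n).KK x t - K x t) p μ01 := ((Kn n).1 x hx).sub (hK.1 x hx)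
    have e : (E n).u l x - u x = ∫ t in (0:ℝ)..x, mv ((E n).KK x t - K x t) (c0 l t) := by
      rw [hu]
      unfold ES.u
      rw [← (E n).u_eq l hx]
      simp only [mv_apply, Matrix.sub_mulVec]
      rw [intervalIntegral.integral_sub (iK hx ((Kn n).1 x hx)) (iK hx (hK.1 x hx))]
      abel
    rw [e]
    refine (intervalIntegral.norm_integral_le_of_norm_le (g := fun t => ‖mv‖ * c * ‖(E n).KK x t - K x t‖) hx.1 ?_ ((MemLp.ii01 hp dm hx).norm.const_mul _)).trans ?_
    · refine Eventually.of_forall fun t ht => ?_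
      refine (mv.le_opNorm₂ _ _).trans ?_
      have := hc t ⟨ht.1.le, ht.2.trans hx.2⟩
      calc _ ≤ ‖mv‖ * ‖(E n).KK x t - K x t‖ * c := by gcongr
        _ = _ := by ring
    · rw [intervalIntegral.integral_const_mul]
      exact mul_le_mul_of_nonneg_left (L1 hx dm (hε' n) (hrow n x hx)) (by positivity)
  have uu : TendstoUniformlyOn (fun n => (E n).u l) u atTop (Icc 0 1) := by
    rw [Metric.tendstoUniformlyOn_iff]
    intro η hη
    have : Tendsto (fun n => ‖mv‖ * c * (ε n).toReal) atTop (nhds 0) := by simpa using dl.const_mul (‖mv‖ * c)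
    filter_upwards [this.eventually_lt_const hη] with n hn x hx
    rw [dist_comm, dist_eq_norm]
    exact (ub n x hx).trans_lt hn
  have cu : ContinuousOn u (Icc 0 1) := uu.continuousOn (Frequently.of_forall fun n => (E n).contOn_u (hreg n) l)
  obtain ⟨U, hU⟩ := isCompact_Icc.exists_bound_of_continuousOn (s := Icc (0:ℝ) 1) cu
  have hU0 : 0 ≤ U := (norm_nonneg _).trans (hU 0 z01)
  have b1 : ∀ v : Fin 2 → ℂ, ‖Bmat.mulVec v‖ ≤ ‖mv Bmat‖ * ‖v‖ := fun v => (mv Bmat).le_opNorm v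
  have b2 : ∀ (A : M2) (v : Fin 2 → ℂ), ‖A.mulVec v‖ ≤ ‖mv‖ * ‖A‖ * ‖v‖ := fun A v => mv.le_opNorm₂ A v
  obtain ⟨Q, hQ⟩ : ∃ Q : ℝ → M2, Q = fun x => R x 0 * Jmat * Bmat := ⟨_, rfl⟩
  obtain ⟨Qn, hQn⟩ : ∃ Qn : ℕ → ℝ → M2, Qn = fun n x => (E n).RK x 0 * Jmat * Bmat := ⟨_, rfl⟩
  rw [← hQ]
  have JBmem : ∀ {k : ℝ → M2}, MemLp k p μ01 → MemLp (fun x => k x * Jmat * Bmat) p μ01 := by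
    intro k hk
    have h1 : AEStronglyMeasurable (fun x => k x * Jmat * Bmat) μ01 := (hk.1.mul aestronglyMeasurable_const).mul aestronglyMeasurable_const
    refine hk.of_le_mul (c := ‖Jmat‖ * ‖Bmat‖) h1 (Eventually.of_forall fun x => ?_)
    calc _ ≤ ‖k x * Jmat‖ * ‖Bmat‖ := norm_mul_le _ _
      _ ≤ ‖k x‖ * ‖Jmat‖ * ‖Bmat‖ := by gcongr; exact norm_mul_le _ _
      _ = _ := by ring
  have mQ : MemLp Q p μ01 := by rw [hQ]; exact JBmem (hR.2.1 0 z01)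
  have mQn : ∀ n, MemLp (Qn n) p μ01 := fun n => by rw [hQn]; exact JBmem ((Rn n).2.1 0 z01)
  have dQ : ∀ n, ∀ x ∈ Icc (0:ℝ) 1, ∫ t in (0:ℝ)..x, ‖Qn n t - Q t‖ ≤ ‖Jmat‖ * ‖Bmat‖ * (ε n).toReal := by
    intro n x hx
    have dm : MemLp (fun t => (E n).RK t 0 - R t 0) p μ01 := ((Rn n).2.1 0 z01).sub (hR.2.1 0 z01)
    refine le_trans ?_ (mul_le_mul_of_nonneg_left (L1 hx dm (hε' n) (hcol n)) (by positivity))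
    rw [← intervalIntegral.integral_const_mul]
    refine intervalIntegral.integral_mono_on hx.1 (MemLp.ii01 hp ((mQn n).sub mQ) hx).norm ((MemLp.ii01 hp dm hx).norm.const_mul _) fun t _ => ?_
    have : Qn n t - Q t = ((E n).RK t 0 - R t 0) * Jmat * Bmat := by
      rw [hQn, hQ]; simp only [sub_mul]
    rw [this]
    calc _ ≤ ‖((E n).RK t 0 - R t 0) * Jmat‖ * ‖Bmat‖ := norm_mul_le _ _
      _ ≤ ‖(E n).RK t 0 - R t 0‖ * ‖Jmat‖ * ‖Bmat‖ := by gcongr; exact norm_mul_le _ _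
      _ = _ := by ring
  -- integrability of the derivative
  have iw : ∀ {v : ℝ → Fin 2 → ℂ} {S : ℝ → M2}, ContinuousOn v (Icc 0 1) → MemLp S p μ01 →
      IntegrableOn (fun y => -Bmat.mulVec (l • v y - (S y).mulVec (v y))) (Ioc 0 1) := by
    intro v S hv hS
    obtain ⟨V, hV⟩ := isCompact_Icc.exists_bound_of_continuousOn (s := Icc (0:ℝ) 1) hv
    have s1 : IntegrableOn S (Ioc 0 1) := by
      have := hS.integrable hp
      rwa [mu01_eq] at this
    have v1 : IntegrableOn v (Ioc 0 1) := (hv.integrableOn_compact isCompact_Icc).mono_set Ioc_subset_Icc_self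
    have h2 : AEStronglyMeasurable (fun t => mv (S t) (v t)) (volume.restrict (Ioc 0 1)) :=
      mv.aestronglyMeasurable_comp₂ s1.aestronglyMeasurable v1.aestronglyMeasurable
    have h3 : Integrable (fun t => mv (S t) (v t)) (volume.restrict (Ioc 0 1)) := by
      refine Integrable.mono' (g := fun t => ‖mv‖ * V * ‖S t‖) (s1.norm.const_mul _) h2 ?_
      rw [ae_restrict_iff' measurableSet_Ioc]
      refine Eventually.of_forall fun t ht => ?_
      refine (mv.le_opNorm₂ _ _).trans ?_
      have := hV t (Ioc_subset_Icc_self ht)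
      calc ‖mv‖ * ‖S t‖ * ‖v t‖ ≤ ‖mv‖ * ‖S t‖ * V := by gcongr
        _ = _ := by ring
    have h4 : Integrable (fun t => l • v t - mv (S t) (v t)) (volume.restrict (Ioc 0 1)) := (Integrable.smul l v1).sub h3
    exact ((mv Bmat).integrable_comp h4).neg
  obtain ⟨w, hw⟩ : ∃ w : ℝ → Fin 2 → ℂ, w = fun y => -Bmat.mulVec (l • u y - (Q y).mulVec (u y)) := ⟨_, rfl⟩
  obtain ⟨wn, hwn⟩ : ∃ wn : ℕ → ℝ → Fin 2 → ℂ, wn = fun n y => -Bmat.mulVec (l • (E n).u l y - (Qn n y).mulVec ((E n).u l y)) := ⟨_, rfl⟩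
  have i1 : IntegrableOn w (Ioc 0 1) := by rw [hw]; exact iw cu mQ
  have i2 : ∀ n, IntegrableOn (wn n) (Ioc 0 1) := fun n => by rw [hwn]; exact iw ((E n).contOn_u (hreg n) l) (mQn n)
  have ii : ∀ {f : ℝ → Fin 2 → ℂ} {x : ℝ}, x ∈ Icc (0:ℝ) 1 → IntegrableOn f (Ioc 0 1) → IntervalIntegrable f volume 0 x := fun hx hf => by
    rw [intervalIntegrable_iff_integrableOn_Ioc_of_le hx.1]
    exact hf.mono_set (Ioc_subset_Ioc_right hx.2)
  refine ⟨w, i1.mono_set Ioo_subset_Ioc_self, fun x hx => ?_, Eventually.of_forall fun x => ?_⟩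
  · have t1 : Tendsto (fun n => (E n).u l x) atTop (nhds (u x)) := uu.tendsto_at hx
    have t2 : Tendsto (fun n => ∫ t in (0:ℝ)..x, wn n t) atTop (nhds (∫ t in (0:ℝ)..x, w t)) := by
      rw [tendsto_iff_norm_sub_tendsto_zero]
      set d : ℕ → ℝ := fun n => ‖mv‖ * c * (ε n).toReal with hd
      have d0 : Tendsto d atTop (nhds 0) := by simpa [hd] using dl.const_mul (‖mv‖ * c)
      have dn : ∀ n, 0 ≤ d n := fun n => by positivity
      have bound : ∀ n, ‖(∫ t in (0:ℝ)..x, wn n t) - ∫ t in (0:ℝ)..x, w t‖ ≤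
          ‖mv Bmat‖ * (‖l‖ * d n * x + ‖mv‖ * (U + d n) * (‖Jmat‖ * ‖Bmat‖ * (ε n).toReal) + ‖mv‖ * d n * ∫ t in (0:ℝ)..x, ‖Q t‖) := by
        intro n
        have q1 := MemLp.ii01 hp ((mQn n).sub mQ) hx
        have q2 := MemLp.ii01 hp mQ hx
        have k1 : IntervalIntegrable (fun t => ‖mv‖ * (U + d n) * ‖Qn n t - Q t‖) volume 0 x := q1.norm.const_mul _
        have k2 : IntervalIntegrable (fun t => ‖mv‖ * d n * ‖Q t‖) volume 0 x := q2.norm.const_mul _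
        have k0 : IntervalIntegrable (fun _ : ℝ => ‖l‖ * d n) volume 0 x := intervalIntegrable_const
        have k3 : IntervalIntegrable (fun t => ‖mv Bmat‖ * (‖l‖ * d n + ‖mv‖ * (U + d n) * ‖Qn n t - Q t‖ + ‖mv‖ * d n * ‖Q t‖)) volume 0 x :=
          ((k0.add k1).add k2).const_mul _
        rw [← intervalIntegral.integral_sub (ii hx (i2 n)) (ii hx i1)]
        refine (intervalIntegral.norm_integral_le_of_norm_le hx.1 ?_ k3).trans ?_
        · refine Eventually.of_forall fun t ht => ?_
          have ht' : t ∈ Icc (0:ℝ) 1 := ⟨ht.1.le, ht.2.trans hx.2⟩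
          have e : wn n t - w t = -Bmat.mulVec (l • ((E n).u l t - u t) - (Qn n t - Q t).mulVec ((E n).u l t) - (Q t).mulVec ((E n).u l t - u t)) := by
            rw [hwn, hw]
            simp only [Matrix.mulVec_sub, Matrix.sub_mulVec, Matrix.mulVec_smul, smul_sub]
            abel
          have n1 := ub n t ht'
          have n2 : ‖(E n).u l t‖ ≤ U + d n := by
            calc _ = ‖u t + ((E n).u l t - u t)‖ := by rw [add_sub_cancel]
              _ ≤ _ := (norm_add_le _ _).trans (add_le_add (hU t ht') n1)
          rw [e, norm_neg]
          refine (b1 _).trans (mul_le_mul_of_nonneg_left ?_ (norm_nonneg _))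
          refine (norm_sub_le _ _).trans (add_le_add ((norm_sub_le _ _).trans (add_le_add ?_ ?_)) ?_)
          · rw [norm_smul]; exact mul_le_mul_of_nonneg_left n1 (norm_nonneg _)
          · refine (b2 _ _).trans ?_
            calc _ ≤ ‖mv‖ * ‖Qn n t - Q t‖ * (U + d n) := by gcongr
              _ = _ := by ring
          · refine (b2 _ _).trans ?_
            calc _ ≤ ‖mv‖ * ‖Q t‖ * d n := by gcongr
              _ = _ := by ring
        · rw [intervalIntegral.integral_const_mul, intervalIntegral.integral_add (k0.add k1) k2, intervalIntegral.integral_add k0 k1, intervalIntegral.integral_const,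
            intervalIntegral.integral_const_mul, intervalIntegral.integral_const_mul, sub_zero, smul_eq_mul]
          have h5 : 0 ≤ ‖mv‖ * (U + d n) := mul_nonneg (by positivity) (add_nonneg hU0 (dn n))
          refine mul_le_mul_of_nonneg_left (add_le_add (add_le_add (le_of_eq (by ring)) (mul_le_mul_of_nonneg_left (dQ n x hx) h5)) le_rfl) (norm_nonneg _)
      refine squeeze_zero (fun _ => norm_nonneg _) bound ?_
      have := ((((d0.const_mul ‖l‖).mul_const x).add (((d0.const_add U).const_mul ‖mv‖).mul (dl.const_mul (‖Jmat‖ * ‖Bmat‖)))).add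
        ((d0.const_mul ‖mv‖).mul_const (∫ t in (0:ℝ)..x, ‖Q t‖))).const_mul ‖mv Bmat‖
      simpa using this
    have t3 : Tendsto (fun n => (E n).u l x) atTop (nhds (![1, 0] + ∫ t in (0:ℝ)..x, w t)) := by
      refine (t2.const_add ![1, 0]).congr fun n => ?_
      rw [(E n).u_int (hreg n) l hx, hwn, hQn]
    rw [hu0]
    exact tendsto_nhds_unique t1 t3
  · rw [hw]
    simp only
    rw [BB_neg]; abel

lemma expB_Phi (τ : ℝ) : expB (τ:ℂ) = PhiL (cexp (-(I*τ))) := by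
  have e : cexp (-(I*τ)) = Complex.cos τ - Complex.sin τ * I := by
    have : -(I*τ) = (-(τ:ℂ)) * I := by ring
    rw [this, Complex.exp_mul_I, Complex.cos_neg, Complex.sin_neg]; ring
  have hr : (cexp (-(I*τ))).re = Real.cos τ := by
    rw [e, ← ofReal_cos, ← ofReal_sin]; simp [-ofReal_cos, -ofReal_sin]
  have hi : (cexp (-(I*τ))).im = -Real.sin τ := by
    rw [e, ← ofReal_cos, ← ofReal_sin]; simp [-ofReal_cos, -ofReal_sin]
  rw [PhiL_apply, PhiF, hr, hi]
  simp [expB]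

lemma Phi_real (a : ℝ) (z : ℂ) : (a:ℂ) • PhiL z = PhiL (a * z) := by
  rw [Complex.coe_smul, ← map_smul, Complex.real_smul]

lemma term_Phi (lam al : ℤ → ℝ) (n : ℤ) (s : ℝ) :
    (al n : ℂ) • expB (2 * (lam n : ℂ) * (s : ℂ)) - expB (Real.pi * (2 * (n : ℂ) + 1) * (s : ℂ)) =
    PhiL ((al n : ℂ) * ex (-(2 * lam n)) s - ex (-(Real.pi * (2 * (n:ℝ) + 1))) s) := by
  have e1 : 2 * (lam n : ℂ) * (s : ℂ) = ((2 * lam n * s : ℝ) : ℂ) := by push_cast; ring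
  have e2 : Real.pi * (2 * (n : ℂ) + 1) * (s : ℂ) = ((Real.pi * (2 * n + 1) * s : ℝ) : ℂ) := by push_cast; ring
  rw [e1, e2, expB_Phi, expB_Phi, Phi_real, ← map_sub]
  unfold ex
  congr 3
  · congr 2; push_cast; ring
  · congr 1; push_cast; ring

lemma sum_Phi (lam al wt : ℤ → ℝ) (N : ℕ) (s : ℝ) :
    ∑ n ∈ Finset.Icc (-(N:ℤ)) (N:ℤ), (wt n : ℂ) • ((al n : ℂ) • expB (2 * (lam n : ℂ) * (s : ℂ)) - expB (Real.pi * (2 * (n : ℂ) + 1) * (s : ℂ))) =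
    PhiL ((esN lam al wt N).h s) := by
  rw [esN_h, map_sum]
  refine Finset.sum_congr rfl fun n _ => ?_
  rw [term_Phi, Phi_real]

def cwt (N : ℕ) (n : ℤ) : ℝ := (N:ℝ)⁻¹ * ((Finset.Icc 1 N).filter fun k : ℕ => n ∈ Finset.Icc (-(k:ℤ)) (k:ℤ)).card

lemma cwt_nonneg (N : ℕ) (n : ℤ) : 0 ≤ cwt N n := by unfold cwt; positivity

lemma cwt_le (N : ℕ) (n : ℤ) : cwt N n ≤ 1 := by
  unfold cwt
  have : ((Finset.Icc 1 N).filter fun k : ℕ => n ∈ Finset.Icc (-(k:ℤ)) (k:ℤ)).card ≤ N := by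
    refine (Finset.card_filter_le _ _).trans ?_
    simp
  have h2 : (((Finset.Icc 1 N).filter fun k : ℕ => n ∈ Finset.Icc (-(k:ℤ)) (k:ℤ)).card : ℝ) ≤ N := by exact_mod_cast this
  calc _ ≤ (N:ℝ)⁻¹ * N := by gcongr
    _ ≤ 1 := inv_mul_le_one

lemma cwt_lower (N : ℕ) (hN : 0 < N) (n : ℤ) : 1 - n.natAbs / (N:ℝ) ≤ cwt N n := by
  unfold cwt
  have h1 := Finset.card_filter_add_card_filter_not (s := Finset.Icc 1 N) (fun k : ℕ => n ∈ Finset.Icc (-(k:ℤ)) (k:ℤ))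
  have h2 : ((Finset.Icc 1 N).filter fun k : ℕ => ¬ n ∈ Finset.Icc (-(k:ℤ)) (k:ℤ)).card ≤ n.natAbs := by
    rw [← Finset.card_range n.natAbs]
    refine Finset.card_le_card fun k hk => ?_
    rw [Finset.mem_filter, Finset.mem_Icc, Finset.mem_Icc] at hk
    rw [Finset.mem_range]
    omega
  rw [Nat.card_Icc] at h1
  have h3 : N ≤ ((Finset.Icc 1 N).filter fun k : ℕ => n ∈ Finset.Icc (-(k:ℤ)) (k:ℤ)).card + n.natAbs := by omega
  have h4 : (N:ℝ) ≤ (((Finset.Icc 1 N).filter fun k : ℕ => n ∈ Finset.Icc (-(k:ℤ)) (k:ℤ)).card : ℝ) + n.natAbs := by exact_mod_cast h3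
  have hN' : (0:ℝ) < N := by exact_mod_cast hN
  rw [inv_mul_eq_div, le_div_iff₀ hN', sub_mul, div_mul_cancel₀ _ hN'.ne']
  linarith

lemma cwt_lim (n : ℤ) : Tendsto (fun N => cwt N n) atTop (nhds 1) := by
  have h1 : Tendsto (fun N : ℕ => 1 - n.natAbs / (N:ℝ)) atTop (nhds 1) := by
    have := (tendsto_const_div_atTop_nhds_zero_nat (n.natAbs : ℝ)).const_sub 1
    simpa using this
  refine tendsto_of_tendsto_of_tendsto_of_le_of_le' h1 tendsto_const_nhds ?_ (Eventually.of_forall fun N => cwt_le N n)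
  filter_upwards [eventually_gt_atTop 0] with N hN using cwt_lower N hN n

lemma cesaro_sum (f : ℤ → M2) (N : ℕ) : (N:ℂ)⁻¹ • ∑ k ∈ Finset.Icc 1 N, ∑ n ∈ Finset.Icc (-(k:ℤ)) (k:ℤ), f n =
    ∑ n ∈ Finset.Icc (-(N:ℤ)) (N:ℤ), (cwt N n : ℂ) • f n := by
  have h : ∀ k ∈ Finset.Icc 1 N, ∑ n ∈ Finset.Icc (-(k:ℤ)) (k:ℤ), f n =
      ∑ n ∈ Finset.Icc (-(N:ℤ)) (N:ℤ), if n ∈ Finset.Icc (-(k:ℤ)) (k:ℤ) then f n else 0 := by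
    intro k hk
    rw [Finset.mem_Icc] at hk
    rw [← Finset.sum_filter]
    refine Finset.sum_congr ?_ fun _ _ => rfl
    ext n
    simp only [Finset.mem_filter, Finset.mem_Icc]
    omega
  rw [Finset.sum_congr rfl h, Finset.sum_comm, Finset.smul_sum]
  refine Finset.sum_congr rfl fun n _ => ?_
  rw [← Finset.sum_filter, Finset.sum_const, cwt]
  push_cast
  rw [mul_smul, Nat.cast_smul_eq_nsmul]

lemma exists_wt {p : ℝ≥0∞} (hp : 1 ≤ p) {lam al : ℤ → ℝ} {H : ℝ → M2} (hH : IsHSum p lam al H) :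
    ∃ wt : ℕ → ℤ → ℝ, (∀ N n, 0 ≤ wt N n) ∧ (∀ N n, wt N n ≤ 1) ∧ (∀ n, Tendsto (fun N => wt N n) atTop (nhds 1)) ∧
      Tendsto (fun N => eLpNorm (fun s => PhiL ((esN lam al (wt N) N).h s) - H s) p μ11) atTop (nhds 0) := by
  obtain ⟨_, h1, h2⟩ := hH
  rcases hp.eq_or_lt with h | h
  · refine ⟨cwt, cwt_nonneg, cwt_le, cwt_lim, ?_⟩
    subst h
    refine (h2 rfl).congr fun N => ?_
    congr 1; funext s
    rw [cesaro_sum, sum_Phi]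
  · refine ⟨fun _ _ => 1, fun _ _ => zero_le_one, fun _ _ => le_rfl, fun _ => tendsto_const_nhds, ?_⟩
    refine (h1 h).congr fun N => ?_
    congr 1; funext s
    rw [← sum_Phi]
    simp

lemma mu11_Icc : μ11 = volume.restrict (Icc (-1:ℝ) 1) := by
  unfold μ11; exact Measure.restrict_congr_set Ioo_ae_eq_Icc

instance : IsFiniteMeasure μ11 := by
  unfold μ11; infer_instance

/-- inverting `PhiL` -/
lemma hk_bound {p : ℝ≥0∞} (f : ℝ → ℂ) :
    eLpNorm ((Icc (-1:ℝ) 1).indicator f) p volume ≤ ENNReal.ofReal ‖ell 0 1‖ * eLpNorm (fun s => PhiL (f s)) p μ11 := by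
  rw [eLpNorm_indicator_eq_eLpNorm_restrict measurableSet_Icc, ← mu11_Icc]
  refine eLpNorm_le_mul_eLpNorm_of_ae_le_mul (Eventually.of_forall fun s => ?_) p
  have h := (ell 0 1).le_opNorm (PhiL (f s))
  have e : ell 0 1 (PhiL (f s)) = f s := by
    have := ell_Phi 0 1 (f s)
    rw [one_mul] at this
    rw [this]; simp [ell_apply]
  rwa [e] at h

lemma L1_11 {p : ℝ≥0∞} (hp : 1 ≤ p) : ∃ c : ℝ≥0∞, c ≠ ∞ ∧ ∀ f : ℝ → M2, AEStronglyMeasurable f μ11 → ∫⁻ u, ‖f u‖ₑ ∂μ11 ≤ c * eLpNorm f p μ11 := by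
  refine ⟨μ11 univ ^ (1/(1:ℝ≥0∞).toReal - 1/p.toReal), ?_, fun f hf => ?_⟩
  · refine ENNReal.rpow_ne_top_of_nonneg ?_ (measure_ne_top _ _)
    rw [ENNReal.toReal_one, sub_nonneg, div_one]
    rcases eq_or_ne p ∞ with rfl | h
    · simp
    · have : 1 ≤ p.toReal := by rw [← ENNReal.toReal_one]; exact ENNReal.toReal_mono h hp
      rw [div_le_one (by linarith)]; exact this
  · rw [← eLpNorm_one_eq_lintegral_enorm, mul_comm]
    exact eLpNorm_le_eLpNorm_mul_rpow_measure_univ hp hf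

/-- a good approximating sequence -/
lemma good_seq {p : ℝ≥0∞} (hp : 1 ≤ p) {lam al : ℤ → ℝ} (hm : StrictMono lam) (hlam : LamAsymp p lam)
    (hal : (∀ n, 0 < al n) ∨ (∀ n, al n = 0)) {H : ℝ → M2} (hH : IsHSum p lam al H) :
    (∀ n, 0 < al n) ∧ ∃ (E : ℕ → ES) (M B : ℝ) (Λ c : ℝ≥0∞) (d : ℕ → ℝ≥0∞), 0 ≤ M ∧ Λ ≠ ∞ ∧ c ≠ ∞ ∧ (∀ n, Good p (E n) M B Λ) ∧
      (∀ n, d n ≠ ∞) ∧ Tendsto d atTop (nhds 0) ∧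
      (∀ n, eLpNorm (fun s => PhiL ((E n).h s) - H s) p μ11 = d n) ∧
      (∀ n m, eLpNorm (fun u => (E n).hk u - (E m).hk u) p volume ≤ c * (d n + d m)) := by
  obtain ⟨wt, w0, w1, wl, hT⟩ := exists_wt hp hH
  obtain ⟨F, hF⟩ : ∃ F : ℕ → ES, F = fun N => esN lam al (wt N) N := ⟨_, rfl⟩
  obtain ⟨d, hd⟩ : ∃ d : ℕ → ℝ≥0∞, d = fun N => eLpNorm (fun s => PhiL ((F N).h s) - H s) p μ11 := ⟨_, rfl⟩
  have hd0 : Tendsto d atTop (nhds 0) := by rw [hd, hF]; exact hT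
  obtain ⟨c, hc⟩ : ∃ c, c = ENNReal.ofReal ‖ell 0 1‖ := ⟨_, rfl⟩
  have hct : c ≠ ∞ := by rw [hc]; exact ENNReal.ofReal_ne_top
  have am : ∀ N, AEStronglyMeasurable (fun s => PhiL ((F N).h s)) μ11 := fun N => (PhiL.continuous.comp (F N).continuous_h).aestronglyMeasurable
  have hdiff : ∀ n m, eLpNorm (fun u => (F n).hk u - (F m).hk u) p volume ≤ c * (d n + d m) := by
    intro n m
    have e : (fun u => (F n).hk u - (F m).hk u) = (Icc (-1:ℝ) 1).indicator (fun u => (F n).h u - (F m).h u) := by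
      funext u
      simp only [ES.hk, indicator]
      split_ifs <;> simp
    rw [e, hc]
    refine (hk_bound _).trans (mul_le_mul_right ?_ _)
    have e2 : (fun s => PhiL ((F n).h s - (F m).h s)) = (fun s => PhiL ((F n).h s) - H s) - (fun s => PhiL ((F m).h s) - H s) := by
      funext s; simp
    rw [e2, hd]
    exact eLpNorm_sub_le ((am n).sub hH.1.1) ((am m).sub hH.1.1) hp
  have h_itl : ∀ n m, d n + d m ≠ ∞ → ∫ u in (-1:ℝ)..1, ‖(F n).h u - (F m).h u‖ ≤ (2 * (c * (d n + d m))).toReal := by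
    intro n m hnm
    have cF : Continuous fun u => (F n).h u - (F m).h u := (F n).continuous_h.sub (F m).continuous_h
    rw [intervalIntegral.integral_of_le (by norm_num), integral_norm_eq_lintegral_enorm cF.aestronglyMeasurable]
    refine ENNReal.toReal_mono (by finiteness) ?_
    refine le_trans ?_ (mul_le_mul_right (hdiff n m) 2)
    refine le_trans ?_ (L1_le_Lp hp ((F n).measurable_hk.sub (F m).measurable_hk) ?_)
    · refine (setLIntegral_mono' measurableSet_Ioc (g := fun u => ‖(F n).hk u - (F m).hk u‖ₑ) fun u hu => ?_).trans (setLIntegral_le_lintegral _ _)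
      rw [(F n).hk_eq (Ioc_subset_Icc_self hu), (F m).hk_eq (Ioc_subset_Icc_self hu)]
    · intro u hu
      simp [(F n).hk_out u hu, (F m).hk_out u hu]
  have hsmall : ∀ ε > (0:ℝ), ∃ n0 : ℕ, ∀ n ≥ n0, ∀ m ≥ n0, d n ≤ 1 ∧ ∫ u in (-1:ℝ)..1, ‖(F n).h u - (F m).h u‖ ≤ ε := by
    intro ε hε
    have t : Tendsto (fun n => 4 * c * d n) atTop (nhds 0) := by
      have := ENNReal.Tendsto.const_mul (a := 4 * c) hd0 (Or.inr (by finiteness))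
      rwa [mul_zero] at this
    have ev := (hd0.eventually_le_const (zero_lt_one)).and (t.eventually_le_const (ENNReal.ofReal_pos.2 hε))
    obtain ⟨n0, hn0⟩ := eventually_atTop.1 ev
    refine ⟨n0, fun n hn m hm => ⟨(hn0 n hn).1, ?_⟩⟩
    have f : d n + d m ≠ ∞ := ENNReal.add_ne_top.2 ⟨ne_top_of_le_ne_top ENNReal.one_ne_top (hn0 n hn).1, ne_top_of_le_ne_top ENNReal.one_ne_top (hn0 m hm).1⟩
    refine (h_itl n m f).trans ?_
    refine ENNReal.toReal_le_of_le_ofReal hε.le ?_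
    have a := (hn0 n hn).2
    have b := (hn0 m hm).2
    have e : 2 * (2 * (c * (d n + d m))) = 4 * c * d n + 4 * c * d m := by ring
    have h2 : 2 * (2 * (c * (d n + d m))) ≤ 2 * ENNReal.ofReal ε := by
      rw [e, two_mul]; exact add_le_add a b
    rwa [ENNReal.mul_le_mul_iff_right (by norm_num) (by norm_num)] at h2
  obtain ⟨hpos, δ, hδ, n1, hco⟩ := coer_main hp hm hlam hal wt w0 w1 wl (fun ε hε => by
    obtain ⟨n0, h⟩ := hsmall ε hε
    rw [hF] at h
    exact ⟨n0, fun n hn m hm => (h n hn m hm).2⟩)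
  refine ⟨hpos, ?_⟩
  obtain ⟨n2, hn2⟩ := hsmall (1/2) (by norm_num)
  obtain ⟨n3, hn3⟩ : ∃ n3, n3 = max n1 n2 := ⟨_, rfl⟩
  have g1 : n1 ≤ n3 := hn3 ▸ le_max_left _ _
  have g2 : n2 ≤ n3 := hn3 ▸ le_max_right _ _
  obtain ⟨B, hB⟩ : ∃ B : ℝ, B = ∑ j, |(F n3).c j| := ⟨_, rfl⟩
  have hB0 : 0 ≤ B := by rw [hB]; positivity
  have hBh : ∀ u, ‖(F n3).h u‖ ≤ B := fun u => by rw [hB]; exact (F n3).norm_h_le u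
  have hco' : ∀ n ≥ n3, Coer (F n) δ := fun n hn => by rw [hF]; exact hco n (g1.trans hn)
  have dle : ∀ n ≥ n3, d n ≤ 1 := fun n hn => (hn2 n (g2.trans hn) n (g2.trans hn)).1
  refine ⟨fun n => F (n + n3), 2 * (1 + B/δ), B, c * (1 + eLpNorm H p μ11), c, fun n => d (n + n3), by positivity, ?_, hct, fun n => ?_, fun n => ?_, ?_, fun n => ?_, fun n m => hdiff _ _⟩
  · exact ENNReal.mul_ne_top hct (ENNReal.add_ne_top.2 ⟨ENNReal.one_ne_top, hH.1.2.ne⟩)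
  · have hn : n + n3 ≥ n3 := Nat.le_add_left _ _
    have hi := (hn2 (n + n3) (g2.trans hn) n3 g2).2
    refine ⟨fun x hx => (hco' _ hn).det_ne hδ hx, lb_of_coer hδ (hco' _ hn) hBh hi, ⟨F n3, hBh, hi⟩, ?_⟩
    have e : (F (n+n3)).hk = (Icc (-1:ℝ) 1).indicator (F (n+n3)).h := rfl
    rw [e, hc]
    refine (hk_bound _).trans (mul_le_mul_right ?_ _)
    have e2 : (fun s => PhiL ((F (n+n3)).h s)) = (fun s => PhiL ((F (n+n3)).h s) - H s) + H := by
      funext s; simp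
    rw [e2]
    refine (eLpNorm_add_le ((am _).sub hH.1.1) hH.1.1 hp).trans (add_le_add_left ?_ _)
    have := dle _ hn
    rwa [hd] at this
  · exact ne_top_of_le_ne_top ENNReal.one_ne_top (dle _ (Nat.le_add_left _ _))
  · exact (tendsto_add_atTop_iff_nat n3).2 hd0
  · rw [hd]

lemma dirac_closed : IsClosed {A : M2 | A 0 0 = A 1 1 ∧ A 0 1 = - A 1 0} := by
  have h : ∀ i j, Continuous fun A : M2 => A i j := fun i j => (LinearMap.toContinuousLinearMap (Matrix.entryLinearMap ℂ ℂ i j)).continuous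
  exact (isClosed_eq (h 0 0) (h 1 1)).inter (isClosed_eq (h 0 1) (h 1 0).neg)

lemma main_part (p : ℝ≥0∞) (hp : 1 ≤ p) (hp' : p ≠ ∞) {lam al : ℤ → ℝ} (hm : StrictMono lam) (hlam : LamAsymp p lam)
    (hal : (∀ n, 0 < al n) ∨ (∀ n, al n = 0)) {H : ℝ → M2} (hH : IsHSum p lam al H) :
    (∀ n : ℤ, 0 < al n) ∧
    ∃ R K : ℝ → ℝ → M2,
      (MemGp p R ∧ SolvesKrein H R ∧
        (∀ R' : ℝ → ℝ → M2, MemGp p R' → SolvesKrein H R' →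
          ∀ x ∈ Set.Icc (0:ℝ) 1, (fun t => R' x t) =ᵐ[μ01] (fun t => R x t))) ∧
      (MemGp p K ∧ SolvesGLMwith (Fker H) K ∧
        (∀ K' : ℝ → ℝ → M2, MemGp p K' → SolvesGLMwith (Fker H) K' →
          ∀ x ∈ Set.Icc (0:ℝ) 1, (fun t => K' x t) =ᵐ[μ01] (fun t => K x t))) ∧
      (∃ Q : ℝ → M2, IsDiracForm Q ∧ MemLp Q p μ01 ∧
        Q =ᵐ[μ01] (fun x => R x 0 * Jmat * Bmat) ∧
        ∀ l : ℂ,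
          IsVecSolution Q l
            (fun x => c0 l x + ∫ t in (0:ℝ)..x, (K x t).mulVec (c0 l t)) ∧
          (fun x : ℝ => c0 l x + ∫ t in (0:ℝ)..x, (K x t).mulVec (c0 l t)) 0 = ![1, 0]) := by
  obtain ⟨hpos, E₀, M, B, Λ, c, d₀, hM, hΛ, hc, hG₀, hdt₀, hd0₀, hdE₀, hdd₀⟩ := good_seq hp hm hlam hal hH
  refine ⟨hpos, ?_⟩
  obtain ⟨C, hC, hker⟩ := ker_cauchy hp hp' (B := B) hM hΛ
  -- subsequence
  have ev : ∀ N : ℕ, ∀ᶠ k in atTop, ∀ j ≥ k, C * (c * d₀ j) < (1/2:ℝ≥0∞)^(N+1) := by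
    intro N
    have t : Tendsto (fun n => C * (c * d₀ n)) atTop (nhds 0) := by
      have := ENNReal.Tendsto.const_mul (a := C * c) hd0₀ (Or.inr (by finiteness))
      rw [mul_zero] at this
      simpa only [mul_assoc] using this
    have := t.eventually_lt_const (show (0:ℝ≥0∞) < (1/2:ℝ≥0∞)^(N+1) from ENNReal.pow_pos (by simp) _)
    obtain ⟨k0, hk0⟩ := eventually_atTop.1 this
    exact eventually_atTop.2 ⟨k0, fun k hk j hj => hk0 j (hk.trans hj)⟩
  obtain ⟨φ, hφ, hφd⟩ := extraction_forall_of_eventually ev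
  obtain ⟨E, hE⟩ : ∃ E : ℕ → ES, E = fun n => E₀ (φ n) := ⟨_, rfl⟩
  obtain ⟨d, hd⟩ : ∃ d : ℕ → ℝ≥0∞, d = fun n => d₀ (φ n) := ⟨_, rfl⟩
  have hG : ∀ n, Good p (E n) M B Λ := fun n => by rw [hE]; exact hG₀ _
  have hdt : ∀ n, d n ≠ ∞ := fun n => by rw [hd]; exact hdt₀ _
  have hd0 : Tendsto d atTop (nhds 0) := by rw [hd]; exact hd0₀.comp hφ.tendsto_atTop
  have hdE : ∀ n, eLpNorm (fun s => PhiL ((E n).h s) - H s) p μ11 = d n := fun n => by rw [hE, hd]; exact hdE₀ _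
  obtain ⟨ε, hε⟩ : ∃ ε : ℕ → ℝ≥0∞, ε = fun N => (1/2:ℝ≥0∞)^N := ⟨_, rfl⟩
  have hεt : ∀ n, ε n ≠ ∞ := fun n => by rw [hε]; simp
  have hεs : ∑' n, ε n ≠ ∞ := by
    rw [hε, ENNReal.tsum_geometric]
    simp
  have hε0 : Tendsto ε atTop (nhds 0) := by
    rw [hε]; exact ENNReal.tendsto_pow_atTop_nhds_zero_of_lt_one (by simp)
  have hdiff : ∀ N n m, N ≤ n → N ≤ m → C * eLpNorm (fun u => (E n).hk u - (E m).hk u) p volume < ε N := by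
    intro N n m hn hm
    have h1 := hφd N (φ n) (hφ.monotone hn)
    have h2 := hφd N (φ m) (hφ.monotone hm)
    have h3 := hdd₀ (φ n) (φ m)
    calc C * eLpNorm (fun u => (E n).hk u - (E m).hk u) p volume ≤ C * (c * (d₀ (φ n) + d₀ (φ m))) := by rw [hE]; gcongr
      _ = C * (c * d₀ (φ n)) + C * (c * d₀ (φ m)) := by ring
      _ < (1/2:ℝ≥0∞)^(N+1) + (1/2:ℝ≥0∞)^(N+1) := ENNReal.add_lt_add h1 h2
      _ = ε N := by
        rw [hε]
        simp only
        rw [pow_succ, ← mul_add, one_div, ENNReal.inv_two_add_inv_two, mul_one]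
  have hreg := fun n => (hG n).reg
  obtain ⟨gR, rR, cR⟩ := limK_Gp hp (P := fun n => (E n).RK) (fun n => ((E n).RK_Gp hp hp' (hreg n)).2) hεt hεs
    (fun N n m hn hm x hx => ((hker _ _ (hG n) (hG m)).1 x hx).trans_lt (hdiff N n m hn hm))
    (fun N n m hn hm x hx => ((hker _ _ (hG n) (hG m)).2.1 x hx).trans_lt (hdiff N n m hn hm))
  obtain ⟨gK, rK, cK⟩ := limK_Gp hp (P := fun n => (E n).KK) (fun n => ((E n).KK_Gp hp hp' (hreg n)).2) hεt hεs
    (fun N n m hn hm x hx => ((hker _ _ (hG n) (hG m)).2.2.1 x hx).trans_lt (hdiff N n m hn hm))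
    (fun N n m hn hm x hx => ((hker _ _ (hG n) (hG m)).2.2.2 x hx).trans_lt (hdiff N n m hn hm))
  have sR : ∀ x t : ℝ, ¬ (0 ≤ t ∧ t ≤ x ∧ x ≤ 1) → limK (fun n => (E n).RK) x t = 0 := fun x t h => by
    have := limK_mem (P := fun n => (E n).RK) (x := x) (t := t) (S := {0}) isClosed_singleton rfl (fun n => by
      simp [ES.RK, ES.rk, triI_of_notMem (show (x,t) ∉ Tri from h)])
    exact this
  have sK : ∀ x t : ℝ, ¬ (0 ≤ t ∧ t ≤ x ∧ x ≤ 1) → limK (fun n => (E n).KK) x t = 0 := fun x t h => by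
    have := limK_mem (P := fun n => (E n).KK) (x := x) (t := t) (S := {0}) isClosed_singleton rfl (fun n => by
      simp [ES.KK, ES.kk, triI_of_notMem (show (x,t) ∉ Tri from h)])
    exact this
  have tR : ∀ x ∈ Icc (0:ℝ) 1, Tendsto (fun n => eLpNorm (fun t => (E n).RK x t - limK (fun n => (E n).RK) x t) p μ01) atTop (nhds 0) := fun x hx =>
    tendsto_of_tendsto_of_tendsto_of_le_of_le tendsto_const_nhds hε0 (fun _ => zero_le) (fun n => rR n x hx)
  have tK : ∀ x ∈ Icc (0:ℝ) 1, Tendsto (fun n => eLpNorm (fun t => (E n).KK x t - limK (fun n => (E n).KK) x t) p μ01) atTop (nhds 0) := fun x hx =>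
    tendsto_of_tendsto_of_tendsto_of_le_of_le tendsto_const_nhds hε0 (fun _ => zero_le) (fun n => rK n x hx)
  -- the limit function
  obtain ⟨cl, hcl, hL1⟩ := L1_11 hp
  have aH := hH.1.1
  obtain ⟨Ht, hHt⟩ : ∃ Ht : ℝ → M2, Ht = (Ioo (-1:ℝ) 1).indicator (aH.mk H) := ⟨_, rfl⟩
  have mHt : StronglyMeasurable Ht := by rw [hHt]; exact aH.stronglyMeasurable_mk.indicator measurableSet_Ioo
  have eH : ∀ᵐ u : ℝ, u ∈ Ioo (-1:ℝ) 1 → H u = Ht u := by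
    have := aH.ae_eq_mk
    unfold μ11 at this
    rw [EventuallyEq, ae_restrict_iff' measurableSet_Ioo] at this
    filter_upwards [this] with u h hu
    rw [hHt, indicator_of_mem hu]
    exact h hu
  have eH' : H =ᵐ[μ11] Ht := by
    unfold μ11
    rw [EventuallyEq, ae_restrict_iff' measurableSet_Ioo]
    exact eH
  have lint : ∀ f : ℝ → M2, (∀ u ∉ Icc (-1:ℝ) 1, f u = 0) → ∫⁻ u, ‖f u‖ₑ = ∫⁻ u, ‖f u‖ₑ ∂μ11 := by
    intro f hf
    rw [mu11_Icc]
    refine (setLIntegral_eq_of_support_subset ?_).symm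
    intro u hu
    by_contra h
    exact hu (by simp [hf u h])
  have oHt : ∀ u ∉ Icc (-1:ℝ) 1, Ht u = 0 := fun u hu => by
    rw [hHt, indicator_of_notMem (fun h => hu (Ioo_subset_Icc_self h))]
  have hA : ∫⁻ u, ‖Ht u‖ₑ ≠ ∞ := by
    rw [lint Ht oHt]
    refine ne_top_of_le_ne_top ?_ (hL1 Ht mHt.aestronglyMeasurable)
    rw [← eLpNorm_congr_ae eH']
    exact ENNReal.mul_ne_top hcl hH.1.2.ne
  have hη : ∀ n, ∫⁻ u, ‖Ht u - (E n).HT u‖ₑ ≤ cl * d n := by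
    intro n
    rw [lint (fun u => Ht u - (E n).HT u) (fun u hu => by simp [oHt u hu, ES.HT, (E n).hk_out u hu])]
    refine (hL1 _ (mHt.sub (E n).sm_HT).aestronglyMeasurable).trans (mul_le_mul_right ?_ _)
    rw [← hdE n]
    refine le_of_eq ?_
    rw [← eLpNorm_neg]
    refine eLpNorm_congr_ae ?_
    have hmem : ∀ᵐ u ∂μ11, u ∈ Ioo (-1:ℝ) 1 := ae_restrict_mem measurableSet_Ioo
    filter_upwards [eH', hmem] with u h hu
    rw [Pi.neg_apply, Pi.sub_apply, neg_sub, ← h, (E n).HT_eq (Ioo_subset_Icc_self hu)]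
    rfl
  have hη1 : ∀ n, ∫⁻ u, ‖Ht u - (E n).HT u‖ₑ ≠ ∞ := fun n => ne_top_of_le_ne_top (ENNReal.mul_ne_top hcl (hdt n)) (hη n)
  have hη0 : Tendsto (fun n => ∫⁻ u, ‖Ht u - (E n).HT u‖ₑ) atTop (nhds 0) := by
    have t := ENNReal.Tendsto.const_mul (a := cl) hd0 (Or.inr hcl)
    rw [mul_zero] at t
    exact tendsto_of_tendsto_of_tendsto_of_le_of_le tendsto_const_nhds t (fun _ => zero_le) hη
  have z01 : (0:ℝ) ∈ Icc (0:ℝ) 1 := ⟨le_rfl, zero_le_one⟩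
  have KP := krein_part hp hp' mHt hA eH hreg hM (fun n => (hG n).lb) hη1 hη0 gR sR tR
  have GP := glm_part hp hp' mHt hA eH hreg hM (fun n => (hG n).lb) hη1 hη0 gK sK tK
  refine ⟨limK fun n => (E n).RK, limK fun n => (E n).KK, ⟨gR, KP⟩, ⟨gK, GP⟩, fun x => limK (fun n => (E n).RK) x 0 * Jmat * Bmat, ?_, ?_, EventuallyEq.rfl,
    fun l => ode_part hp hp' hreg gR gK hε0 hεt rK (fun n => cR n 0 z01) l⟩
  · refine ⟨fun x => limK (fun n => (E n).RK) x 0 0 1, fun x => limK (fun n => (E n).RK) x 0 0 0, fun x => ?_⟩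
    have h := limK_mem (P := fun n => (E n).RK) (x := x) (t := 0) dirac_closed (by simp) (fun n => by
      simp only [ES.RK, PhiL_apply, PhiF]
      constructor <;> simp)
    obtain ⟨A, hAA⟩ : ∃ A : M2, A = limK (fun n => (E n).RK) x 0 := ⟨_, rfl⟩
    simp only
    rw [← hAA] at h ⊢
    obtain ⟨h1, h2⟩ := h
    rw [Matrix.eta_fin_two A, Jmat, Bmat, Matrix.mul_fin_two, Matrix.mul_fin_two]
    ext i j; fin_cases i <;> fin_cases j <;> simp [h1, h2]
  · have hk := gR.2.1 0 z01
    have h1 : AEStronglyMeasurable (fun x => limK (fun n => (E n).RK) x 0 * Jmat * Bmat) μ01 := (hk.1.mul aestronglyMeasurable_const).mul aestronglyMeasurable_const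
    refine hk.of_le_mul (c := ‖Jmat‖ * ‖Bmat‖) h1 (Eventually.of_forall fun x => ?_)
    calc _ ≤ ‖limK (fun n => (E n).RK) x 0 * Jmat‖ * ‖Bmat‖ := norm_mul_le _ _
      _ ≤ ‖limK (fun n => (E n).RK) x 0‖ * ‖Jmat‖ * ‖Bmat‖ := by gcongr; exact norm_mul_le _ _
      _ = _ := by ring

/-- Given spectral data in `SD_p`: the α's are positive, the Krein and GLM
equations are uniquely solvable in `G_p(M₂)`, and `Q(x) = R̃(x,0)JB` is a Dirac-form `L_p`
potential for which `I + 𝒦` is the transformation operator. -/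
theorem statement14 (p : ℝ≥0∞) (hp : 1 ≤ p) (hp' : p ≠ ∞)
    (lam mu : ℤ → ℝ) (hSD : MemSD p lam mu)
    (phi psi : ℂ → ℂ)
    (hphi : ∀ S : Set ℂ, IsCompact S →
      TendstoUniformlyOn
        (fun (N : ℕ) (l : ℂ) =>
          ∏ n ∈ Finset.Icc (-(N:ℤ)) (N:ℤ), ((lam n : ℂ) - l) / (Real.pi * ((n : ℂ) + 1/2)))
        phi atTop S)
    (hpsi : ∀ S : Set ℂ, IsCompact S →
      TendstoUniformlyOn
        (fun (N : ℕ) (l : ℂ) => (l - (mu 0 : ℂ)) *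
          ∏ n ∈ (Finset.Icc (-(N:ℤ)) (N:ℤ)).erase 0, ((mu n : ℂ) - l) / (Real.pi * (n : ℂ)))
        psi atTop S)
    (al : ℤ → ℝ)
    (hal : ∀ n : ℤ, (al n : ℂ) = -1 / (deriv phi (lam n) * psi (lam n)))
    (H : ℝ → M2) (hH : IsHSum p lam al H) :
    (∀ n : ℤ, 0 < al n) ∧
    ∃ R K : ℝ → ℝ → M2,
      -- (i) unique solubility of the Krein equation in G_p(M₂)
      (MemGp p R ∧ SolvesKrein H R ∧
        (∀ R' : ℝ → ℝ → M2, MemGp p R' → SolvesKrein H R' →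
          ∀ x ∈ Set.Icc (0:ℝ) 1, (fun t => R' x t) =ᵐ[μ01] (fun t => R x t))) ∧
      -- (ii) unique solubility of the GLM equation in G_p(M₂)
      (MemGp p K ∧ SolvesGLMwith (Fker H) K ∧
        (∀ K' : ℝ → ℝ → M2, MemGp p K' → SolvesGLMwith (Fker H) K' →
          ∀ x ∈ Set.Icc (0:ℝ) 1, (fun t => K' x t) =ᵐ[μ01] (fun t => K x t))) ∧
      -- (iii) Q(x) = R̃(x,0)JB is a Dirac-form potential in L_p(M₂) and I + 𝒦 is the
      -- transformation operator for (Ã_Q, Ã₀)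
      (∃ Q : ℝ → M2, IsDiracForm Q ∧ MemLp Q p μ01 ∧
        Q =ᵐ[μ01] (fun x => R x 0 * Jmat * Bmat) ∧
        ∀ l : ℂ,
          IsVecSolution Q l
            (fun x => c0 l x + ∫ t in (0:ℝ)..x, (K x t).mulVec (c0 l t)) ∧
          (fun x : ℝ => c0 l x + ∫ t in (0:ℝ)..x, (K x t).mulVec (c0 l t)) 0 = ![1, 0]) := by
  exact main_part p hp hp' (lam_strictMono hSD.1) hSD.2.1
    (al_dichotomy lam mu hSD.1 phi psi hphi hpsi al hal) hH
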